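/- Let X be a compact metric space that can be obtained as the Gromov-Hausdorff limit of a sequence of compact length spaces each homeomorphic to a fixed compact surface. Then the covering dimension of X is at most 2. -/

import Mathlib

open Filter Topology Metric Set GromovHausdorff
open scoped ENNReal unitInterval

noncomputable section

/-! ## Model spaces -/

/-- The closed upper half plane in `ℝ × ℝ` (used for topological charts). -/
def HalfPlane : Set (ℝ × ℝ) := {p | 0 ≤ p.2}

/-- The closed upper half plane in the Euclidean plane (used for metric charts). -/
def EHalfPlane : Set (EuclideanSpace ℝ (Fin 2)) := {p | 0 ≤ p 1}

/-- The unit circle (the 1-sphere). -/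
def Circle1 : Set (EuclideanSpace ℝ (Fin 2)) := Metric.sphere 0 1

/-- The 2-sphere. -/
def Sphere2 : Set (EuclideanSpace ℝ (Fin 3)) := Metric.sphere 0 1

/-- The closed 2-disc. -/
def Disc2 : Set (EuclideanSpace ℝ (Fin 2)) := Metric.closedBall 0 1

/-- The relation on the unit square generating the Möbius identification
`(0, y) ∼ (1, 1 - y)`. -/
def mobiusRel (p q : I × I) : Prop :=
  ((p.1 : ℝ) = 0 ∧ (q.1 : ℝ) = 1 ∧ (p.2 : ℝ) = 1 - (q.2 : ℝ)) ∨
  ((p.1 : ℝ) = 1 ∧ (q.1 : ℝ) = 0 ∧ (p.2 : ℝ) = 1 - (q.2 : ℝ))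

/-- The Möbius band, as a quotient of the unit square. -/
def MobiusBand : Type := Quot mobiusRel

instance : TopologicalSpace MobiusBand :=
  inferInstanceAs (TopologicalSpace (Quot mobiusRel))

/-! ## Surfaces -/

/-- A topological 2-manifold with (possibly empty) boundary: every point has an open
neighborhood homeomorphic to an open subset of the closed half plane. -/
def IsSurface (X : Type*) [TopologicalSpace X] : Prop :=
  ∀ x : X, ∃ (U : Set X) (V : Set HalfPlane),
    IsOpen U ∧ x ∈ U ∧ IsOpen V ∧ Nonempty (↥U ≃ₜ ↥V)

/-- A compact surface: a compact connected (Hausdorff) topological 2-manifold with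
possibly empty boundary. -/
def IsCompactSurface (X : Type*) [TopologicalSpace X] : Prop :=
  CompactSpace X ∧ ConnectedSpace X ∧ T2Space X ∧ IsSurface X

/-- The (manifold) boundary of a surface: the set of points having no open neighborhood
homeomorphic to an open subset of the plane. -/
def surfaceBoundary (X : Type*) [TopologicalSpace X] : Set X :=
  {x | ¬ ∃ (U : Set X) (V : Set (ℝ × ℝ)), IsOpen U ∧ x ∈ U ∧ IsOpen V ∧ Nonempty (↥U ≃ₜ ↥V)}

/-- The set of boundary components of a surface, i.e. the connected components of the
boundary. -/
def surfaceBoundaryComponents (X : Type*) [TopologicalSpace X] : Set (Set X) :=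
  {b | ∃ x ∈ surfaceBoundary X, b = connectedComponentIn (surfaceBoundary X) x}

/-- A surface is orientable iff it contains no subset homeomorphic to the Möbius band. -/
def SurfOrientable (X : Type*) [TopologicalSpace X] : Prop :=
  ¬ ∃ A : Set X, Nonempty (↥A ≃ₜ MobiusBand)

/-- The free rank of the first homology (the abelianized fundamental group). -/
noncomputable def h1Rank (X : Type*) [TopologicalSpace X] : ℕ :=
  ⨆ x : X, (Module.rank ℤ (Additive (Abelianization (FundamentalGroup X x)))).toNat

open Classical in
/-- The connectivity number of a compact surface `S`, i.e. `2 - χ(S)`.  By the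
classification of compact surfaces this equals the free rank of the first homology,
plus one unless the surface is closed and orientable. -/
noncomputable def connNum (X : Type*) [TopologicalSpace X] : ℕ :=
  h1Rank X + (if surfaceBoundary X = ∅ ∧ SurfOrientable X then 0 else 1)

/-- The reduced connectivity number: the connectivity number minus the number of
boundary components. -/
noncomputable def redConnNum (X : Type*) [TopologicalSpace X] : ℤ :=
  (connNum X : ℤ) - ((surfaceBoundaryComponents X).ncard : ℤ)

/-! ## Length and geodesic spaces -/

/-- The length of a path, as the total variation of the parametrization. -/
noncomputable def pathLength {X : Type*} [MetricSpace X] {x y : X} (γ : Path x y) : ℝ≥0∞ :=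
  eVariationOn (fun t => γ t) Set.univ

/-- A metric space is a length space if the distance between any two points is the
infimum of the lengths of paths joining them. -/
def IsLengthSpace (X : Type*) [MetricSpace X] : Prop :=
  ∀ x y : X, edist x y = ⨅ γ : Path x y, pathLength γ

/-- A metric space is geodesic if any two points are joined by a path whose length
realizes the distance. -/
def IsGeodesicSpace (X : Type*) [MetricSpace X] : Prop :=
  ∀ x y : X, ∃ γ : Path x y, pathLength γ = edist x y

/-! ## Peano spaces, Jordan curves and cyclic elements -/

/-- A Peano space: a compact connected locally connected metric space. -/
def IsPeano (X : Type*) [MetricSpace X] : Prop :=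
  CompactSpace X ∧ ConnectedSpace X ∧ LocallyConnectedSpace X

/-- A Jordan curve: a subset homeomorphic to the 1-sphere. -/
def IsJordanCurve {X : Type*} [TopologicalSpace X] (J : Set X) : Prop :=
  Nonempty (↥J ≃ₜ ↥Circle1)

/-- A set is cyclicly connected if every pair of distinct points of it lies on a common
Jordan curve contained in it. -/
def CycliclyConnected {X : Type*} [TopologicalSpace X] (A : Set X) : Prop :=
  ∀ x ∈ A, ∀ y ∈ A, x ≠ y → ∃ J : Set X, J ⊆ A ∧ IsJordanCurve J ∧ x ∈ J ∧ y ∈ J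

/-- A maximal cyclic subset: a nondegenerate cyclicly connected subset which is not a
proper subset of any cyclicly connected subset. -/
def IsMaximalCyclic {X : Type*} [TopologicalSpace X] (A : Set X) : Prop :=
  A.Nontrivial ∧ CycliclyConnected A ∧ ∀ B : Set X, CycliclyConnected B → A ⊆ B → A = B

/-- A subcontinuum: a compact connected (hence nonempty) subset. -/
def IsSubcontinuum {X : Type*} [TopologicalSpace X] (C : Set X) : Prop :=
  IsCompact C ∧ IsConnected C

/-- `b` is a boundary component of the subset `T` (viewed as a subspace). -/
def IsBoundaryComponentOf {X : Type*} [TopologicalSpace X] (T b : Set X) : Prop :=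
  ∃ b' ∈ surfaceBoundaryComponents ↥T, b = Subtype.val '' b'

/-- An admissible subcontinuum: it meets every maximal cyclic subset `T` in at most a
point or in a boundary component of `T`. -/
def IsAdmissible {X : Type*} [TopologicalSpace X] (C : Set X) : Prop :=
  IsSubcontinuum C ∧
    ∀ T : Set X, IsMaximalCyclic T →
      ((T ∩ C).Subsingleton ∨ IsBoundaryComponentOf T (T ∩ C))

/-- A 1-cactoid: a Peano space all of whose maximal cyclic subsets are homeomorphic to
the 1-sphere. -/
def IsOneCactoid (X : Type*) [MetricSpace X] : Prop :=
  IsPeano X ∧ ∀ T : Set X, IsMaximalCyclic T → Nonempty (↥T ≃ₜ ↥Circle1)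

/-- A subset homeomorphic to the 2-sphere or the closed 2-disc. -/
def SphereOrDisc {X : Type*} [TopologicalSpace X] (T : Set X) : Prop :=
  Nonempty (↥T ≃ₜ ↥Sphere2) ∨ Nonempty (↥T ≃ₜ ↥Disc2)

/-! ## Generalized cactoids -/

/-- A generalized cactoid. -/
def IsGeneralizedCactoid (X : Type*) [MetricSpace X] : Prop :=
  IsPeano X ∧ (∀ T : Set X, IsMaximalCyclic T → IsCompactSurface ↥T) ∧
  {T : Set X | IsMaximalCyclic T ∧ ¬ SphereOrDisc T}.Finite ∧
  ∃ (n : ℕ) (C : Fin n → Set X),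
    (∀ i, IsAdmissible (C i)) ∧ (Pairwise fun i j => Disjoint (C i) (C j)) ∧
    ∀ T b : Set X, IsMaximalCyclic T → IsBoundaryComponentOf T b → b ⊆ ⋃ i, C i

/-- A pre-boundary consisting of `n` disjoint admissible subcontinua, each containing a
boundary component of some maximal cyclic subset, which together cover all boundary
components of all maximal cyclic subsets. -/
def IsPreBoundaryOfSize {X : Type*} [TopologicalSpace X] (n : ℕ) (P : Set X) : Prop :=
  ∃ C : Fin n → Set X,
    (∀ i, IsAdmissible (C i)) ∧ (Pairwise fun i j => Disjoint (C i) (C j)) ∧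
    (∀ i, ∃ T b : Set X, IsMaximalCyclic T ∧ IsBoundaryComponentOf T b ∧ b ⊆ C i) ∧
    (∀ T b : Set X, IsMaximalCyclic T → IsBoundaryComponentOf T b → b ⊆ ⋃ i, C i) ∧
    P = ⋃ i, C i

def IsPreBoundary {X : Type*} [TopologicalSpace X] (P : Set X) : Prop :=
  ∃ n, IsPreBoundaryOfSize n P

/-- A minimal pre-boundary: one with the minimal possible number of pieces. -/
def IsMinimalPreBoundary {X : Type*} [TopologicalSpace X] (P : Set X) : Prop :=
  ∃ n, IsPreBoundaryOfSize n P ∧ ∀ (m : ℕ) (Q : Set X), IsPreBoundaryOfSize m Q → n ≤ m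

/-- The boundary of a generalized cactoid: the union of all minimal pre-boundaries. -/
def cactoidBoundary (X : Type*) [TopologicalSpace X] : Set X :=
  ⋃₀ {P : Set X | IsMinimalPreBoundary P}

/-- The boundary components of a generalized cactoid: the connected components of its
boundary. -/
def cactoidBoundaryComponents (X : Type*) [TopologicalSpace X] : Set (Set X) :=
  {b | ∃ x ∈ cactoidBoundary X, b = connectedComponentIn (cactoidBoundary X) x}

/-- The connectivity number of a generalized cactoid: the sum of the reduced
connectivity numbers of its maximal cyclic subsets plus the number of its boundary
components. -/
noncomputable def cactoidConnNum (X : Type*) [TopologicalSpace X] : ℤ :=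
  (∑ᶠ T ∈ {T : Set X | IsMaximalCyclic T}, redConnNum ↥T) +
    ((cactoidBoundaryComponents X).ncard : ℤ)

/-! ## Bundled spaces -/

structure BundledMet where
  carrier : Type
  [str : MetricSpace carrier]

attribute [instance] BundledMet.str

structure BundledTop where
  carrier : Type
  [str : TopologicalSpace carrier]

attribute [instance] BundledTop.str

/-! ## Metric two-point identifications -/

/-- `p : A → B` is (the projection of) a metric 2-point identification: it glues exactly
two distinct points `x₁, x₂` of `A` and carries the corresponding quotient metric. -/
def IsTwoPointIdentification {A B : Type*} [MetricSpace A] [MetricSpace B] (p : A → B) : Prop :=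
  Function.Surjective p ∧ ∃ x₁ x₂ : A, x₁ ≠ x₂ ∧
    (∀ a b : A, p a = p b ↔ (a = b ∨ (a = x₁ ∧ b = x₂) ∨ (a = x₂ ∧ b = x₁))) ∧
    ∀ a b : A, dist (p a) (p b) =
      min (dist a b) (min (dist a x₁ + dist x₂ b) (dist a x₂ + dist x₁ b))

/-- `Y` is obtained from `X` by a successive application of `k` metric 2-point
identifications, exactly `k₀` of which are boundary identifications with respect to the
subset `B ⊆ X`. -/
def ObtainedByIdentifications (X : Type) [MetricSpace X] (B : Set X) (k k0 : ℕ)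
    (Y : Type) [MetricSpace Y] : Prop :=
  ∃ (Z : ℕ → BundledMet) (p : ∀ i : ℕ, (Z i).carrier → (Z (i + 1)).carrier)
    (e : X ≃ᵢ (Z 0).carrier) (f : (Z k).carrier ≃ᵢ Y) (q : ∀ i : ℕ, X → (Z i).carrier),
    (∀ i, i < k → IsTwoPointIdentification (p i)) ∧
    (∀ x, q 0 x = e x) ∧ (∀ i x, q (i + 1) x = p i (q i x)) ∧
    {i : ℕ | i < k ∧ ∃ a b : (Z i).carrier,
        a ∈ q i '' B ∧ b ∈ q i '' B ∧ a ≠ b ∧ p i a = p i b}.ncard = k0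

/-! ## Gromov–Hausdorff sequences of surfaces -/

/-- A sequence of (isometry classes of) compact length surfaces with connectivity
number `c`. -/
def IsSurfaceGHSeq (c : ℕ) (K : ℕ → GHSpace) : Prop :=
  ∀ n, IsCompactSurface (K n).Rep ∧ IsLengthSpace (K n).Rep ∧ connNum (K n).Rep = c

/-- The structural description of the limit spaces in the Main Theorem: `X` is obtained
from a geodesic generalized cactoid `Y` by `k` successive metric 2-point
identifications, `k₀` of them boundary identifications, where the connectivity number
of `Y` is at most `c + k₀ - 2k`. -/
def MainThmRHS (c : ℕ) (X : Type) [MetricSpace X] : Prop :=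
  ∃ (k k0 : ℕ) (Y : BundledMet),
    IsGeneralizedCactoid Y.carrier ∧ IsGeodesicSpace Y.carrier ∧
    ObtainedByIdentifications Y.carrier (cactoidBoundary Y.carrier) k k0 X ∧
    cactoidConnNum Y.carrier ≤ (c : ℤ) + (k0 : ℤ) - 2 * (k : ℤ)

/-! ## Covering dimension -/

/-- `X` has covering dimension at most `n`: every open cover admits an open refinement
of order at most `n + 1`. -/
def CoveringDimLE (X : Type*) [TopologicalSpace X] (n : ℕ) : Prop :=
  ∀ U : Set (Set X), (∀ u ∈ U, IsOpen u) → ⋃₀ U = Set.univ →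
    ∃ V : Set (Set X), (∀ v ∈ V, IsOpen v) ∧ ⋃₀ V = Set.univ ∧
      (∀ v ∈ V, ∃ u ∈ U, v ⊆ u) ∧
      ∀ x : X, {v | v ∈ V ∧ x ∈ v}.encard ≤ (n : ℕ∞) + 1

/-! ## Curves in surfaces -/

/-- A continuous map from the circle is nullhomotopic if it is homotopic to a constant. -/
def IsNullhomotopic {X : Type*} [TopologicalSpace X] (f : C(↥Circle1, X)) : Prop :=
  ∃ y : X, f.Homotopic (ContinuousMap.const _ y)

/-- A contractible Jordan curve. -/
def IsContractibleJordanCurve {X : Type*} [TopologicalSpace X] (J : Set X) : Prop :=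
  IsJordanCurve J ∧
    ∀ f : C(↥Circle1, X), Function.Injective f → Set.range f = J → IsNullhomotopic f

/-- A non-contractible Jordan curve. -/
def IsNonContractibleJordanCurve {X : Type*} [TopologicalSpace X] (J : Set X) : Prop :=
  IsJordanCurve J ∧
    ∀ f : C(↥Circle1, X), Function.Injective f → Set.range f = J → ¬ IsNullhomotopic f

/-- A simple arc in a surface: an injective path whose endpoints lie on the boundary and
whose interior does not. -/
def IsSimpleArc {X : Type*} [TopologicalSpace X] (γ : C(I, X)) : Prop :=
  Function.Injective γ ∧ γ 0 ∈ surfaceBoundary X ∧ γ 1 ∈ surfaceBoundary X ∧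
    ∀ t : I, t ≠ 0 → t ≠ 1 → γ t ∉ surfaceBoundary X

/-- A subset separates the space if its complement is disconnected. -/
def SeparatesSpace {X : Type*} [TopologicalSpace X] (A : Set X) : Prop :=
  ¬ IsPreconnected Aᶜ

/-- The arc `γ` forms a contractible Jordan curve together with a subarc of some
boundary component. -/
def FormsContractibleJordanWithBoundary {X : Type*} [TopologicalSpace X]
    (γ : C(I, X)) : Prop :=
  ∃ β : C(I, X), Function.Injective β ∧ Set.range β ⊆ surfaceBoundary X ∧
    β 0 = γ 0 ∧ β 1 = γ 1 ∧ IsContractibleJordanCurve (Set.range γ ∪ Set.range β)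

/-- `z` separates `x` and `y` inside the subset `A`: both lie in `A \ {z}` and no
connected subset of `A \ {z}` contains both. -/
def SeparatesIn {X : Type*} [TopologicalSpace X] (A : Set X) (z x y : X) : Prop :=
  x ∈ A \ {z} ∧ y ∈ A \ {z} ∧
    ∀ C : Set X, C ⊆ A \ {z} → IsPreconnected C → ¬ (x ∈ C ∧ y ∈ C)

/-! ## Metric doubles -/

/-- `D` together with the two canonical maps `ip, im : X → D` is the metric double of
`X` along the subset `B`. -/
structure IsMetricDouble (X : Type*) [MetricSpace X] (B : Set X) (D : Type*)
    [MetricSpace D] (ip im : X → D) : Prop where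
  isom_p : Isometry ip
  isom_m : Isometry im
  surj : Set.range ip ∪ Set.range im = Set.univ
  agree : ∀ z ∈ B, ip z = im z
  dist_mix : ∀ a b : X, dist (ip a) (im b) = ⨅ z : ↥B, (dist a (z : X) + dist (z : X) b)

/-- Regularity of a sequence of doubles: there is no sequence of non-contractible
Jordan curves in the doubles with vanishing diameters. -/
def RegularDoubleSeq (D : ℕ → Type) [∀ n, MetricSpace (D n)] : Prop :=
  ∀ J : ∀ n, Set (D n), (∀ n, IsNonContractibleJordanCurve (J n)) →
    0 < ⨅ n, Metric.diam (J n)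

/-- The copy `A^+` (or `A^-`) in the double limit corresponding to a subset `A` of the
limit `X`, via the isometric identification `j` of `X` with `X^+` (resp. `X^-`). -/
def plusCopy {Z D : Type*} {X : Set Z} {Xp : Set D} (j : ↥X → ↥Xp) (A : Set Z) :
    Set D :=
  (fun x => ((j x : ↥Xp) : D)) '' {x : ↥X | (x : Z) ∈ A}

/-! ## Riemannian and polyhedral surfaces -/

/-- The Riemannian length integrand `√(g_{γ(t)}(γ'(t), γ'(t)))`. -/
noncomputable def riemLengthIntegrand (g : (ℝ × ℝ) → (ℝ × ℝ) → (ℝ × ℝ) → ℝ)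
    (γ : ℝ → ℝ × ℝ) (t : ℝ) : ℝ :=
  Real.sqrt (g (γ t) (deriv γ t) (deriv γ t))

/-- A compact connected smooth Riemannian 2-manifold, as a metric space: a compact
length surface such that around every point there is a chart in which the length of
every C¹ curve is computed by a smooth positive definite symmetric bilinear metric. -/
def IsSmoothRiemannianSurface (X : Type*) [MetricSpace X] : Prop :=
  IsCompactSurface X ∧ IsLengthSpace X ∧
  ∀ x : X, ∃ (U : Set X) (V : Set (ℝ × ℝ)) (φ : X → ℝ × ℝ) (ψ : ℝ × ℝ → X)
      (g : (ℝ × ℝ) → (ℝ × ℝ) → (ℝ × ℝ) → ℝ),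
    IsOpen U ∧ x ∈ U ∧ (∃ V' : Set (ℝ × ℝ), IsOpen V' ∧ V = V' ∩ HalfPlane) ∧
    ContinuousOn φ U ∧ φ '' U = V ∧ ContinuousOn ψ V ∧
    (∀ y ∈ U, ψ (φ y) = y) ∧ (∀ v ∈ V, φ (ψ v) = v) ∧
    (∀ m : ℕ, ContDiffOn ℝ m
      (fun pq : (ℝ × ℝ) × (ℝ × ℝ) × (ℝ × ℝ) => g pq.1 pq.2.1 pq.2.2)
      (V ×ˢ ((Set.univ : Set (ℝ × ℝ)) ×ˢ (Set.univ : Set (ℝ × ℝ))))) ∧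
    (∀ p u v, g p u v = g p v u) ∧
    (∀ p (a : ℝ) u u' v, g p (a • u + u') v = a * g p u v + g p u' v) ∧
    (∀ p ∈ V, ∀ u : ℝ × ℝ, u ≠ 0 → 0 < g p u u) ∧
    ∀ (cur : ℝ → X) (a b : ℝ), a ≤ b → Set.MapsTo cur (Set.Icc a b) U →
      ContDiffOn ℝ 1 (φ ∘ cur) (Set.Icc a b) →
      eVariationOn cur (Set.Icc a b) =
        ENNReal.ofReal (∫ t in a..b, riemLengthIntegrand g (φ ∘ cur) t)

/-- A polyhedral surface: a compact length surface which is flat (locally isometric to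
a subset of the Euclidean half plane) away from finitely many singular points. -/
def IsPolyhedralSurface (X : Type*) [MetricSpace X] : Prop :=
  IsCompactSurface X ∧ IsLengthSpace X ∧
  ∃ F : Set X, F.Finite ∧ ∀ x : X, x ∉ F →
    ∃ (U : Set X) (W : Set (EuclideanSpace ℝ (Fin 2))),
      IsOpen U ∧ x ∈ U ∧ W ⊆ EHalfPlane ∧ Nonempty (↥U ≃ᵢ ↥W)

end

/-! ## Chains and coarse components -/

section Chains

variable {Y : Type*} [MetricSpace Y]

/-- One step of an `r`-chain inside `T`. -/
def ChainStep (r : ℝ) (T : Set Y) (a b : Y) : Prop := a ∈ T ∧ b ∈ T ∧ dist a b < r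

/-- Two points of `T` joined by an `r`-chain inside `T` are at distance at most `R`. -/
def ChainBounded (r R : ℝ) (T : Set Y) : Prop :=
  ∀ x y, Relation.ReflTransGen (ChainStep r T) x y → dist x y ≤ R

theorem ChainStep.symm {r : ℝ} {T : Set Y} {a b : Y} (h : ChainStep r T a b) :
    ChainStep r T b a := ⟨h.2.1, h.1, by rw [dist_comm]; exact h.2.2⟩

theorem ChainStep.reflTransGen_symm {r : ℝ} {T : Set Y} {a b : Y}
    (h : Relation.ReflTransGen (ChainStep r T) a b) :
    Relation.ReflTransGen (ChainStep r T) b a := by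
  induction h with
  | refl => exact .refl
  | tail _ h2 ih => exact Relation.ReflTransGen.head h2.symm ih

theorem ChainStep.mem_of_mem {r : ℝ} {T : Set Y} {a b : Y}
    (h : Relation.ReflTransGen (ChainStep r T) a b) (ha : a ∈ T) : b ∈ T := by
  induction h with
  | refl => exact ha
  | tail _ h2 _ => exact h2.2.1

theorem ChainStep.reflTransGen_mono {r r' : ℝ} {T T' : Set Y} (hr : r ≤ r') (hT : T ⊆ T') {a b : Y}
    (h : Relation.ReflTransGen (ChainStep r T) a b) :
    Relation.ReflTransGen (ChainStep r' T') a b :=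
  Relation.ReflTransGen.mono (r := ChainStep r T) (p := ChainStep r' T')
    (fun _ _ hs => ⟨hT hs.1, hT hs.2.1, hs.2.2.trans_le hr⟩) _ _ h

theorem ChainBounded.mono {r R R' : ℝ} {T T' : Set Y} (h : ChainBounded r R T) (hT : T' ⊆ T)
    (hR : R ≤ R') : ChainBounded r R' T' :=
  fun x y hxy => (h x y (ChainStep.reflTransGen_mono le_rfl hT hxy)).trans hR

theorem ChainBounded.of_dist {r R : ℝ} {T : Set Y} (hR : 0 ≤ R)
    (h : ∀ x ∈ T, ∀ y ∈ T, dist x y ≤ R) : ChainBounded r R T := by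
  intro x y hxy
  rcases Relation.ReflTransGen.cases_head hxy with rfl | ⟨z, hz, hzy⟩
  · simpa using hR
  · exact h x hz.1 y (ChainStep.mem_of_mem hxy hz.1)

theorem ChainBounded.iUnion {ι : Type*} {r R : ℝ} {T : ι → Set Y} (hR : 0 ≤ R)
    (h : ∀ i, ChainBounded r R (T i))
    (hsep : ∀ i j, i ≠ j → ∀ x ∈ T i, ∀ y ∈ T j, r ≤ dist x y) :
    ChainBounded r R (⋃ i, T i) := by
  intro x y hxy
  by_cases hx : x ∈ ⋃ i, T i
  · obtain ⟨i, hi⟩ := mem_iUnion.1 hx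
    have : Relation.ReflTransGen (ChainStep r (T i)) x y := by
      induction hxy with
      | refl => exact .refl
      | @tail b c hb hc ih =>
        refine ih.tail ?_
        have hbi := ChainStep.mem_of_mem ih hi
        obtain ⟨j, hj⟩ := mem_iUnion.1 hc.2.1
        by_cases hij : i = j
        · subst hij; exact ⟨hbi, hj, hc.2.2⟩
        · exact absurd hc.2.2 (not_lt.2 (hsep i j hij b hbi c hj))
    exact h i x y this
  · rcases Relation.ReflTransGen.cases_head hxy with rfl | ⟨z, hz, hzy⟩
    · simpa using hR
    · exact absurd hz.1 hx

theorem ChainBounded.union {r R₁ R₂ : ℝ} {U V : Set Y} (hr : 0 ≤ r) (hR₁ : 0 ≤ R₁) (hR₂ : 0 ≤ R₂)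
    (hU : ChainBounded r R₁ U) (hV : ChainBounded (R₁ + 2 * r) R₂ V) :
    ChainBounded r (R₂ + 2 * R₁ + 2 * r) (U ∪ V) := by
  intro x y hxy
  have key : Relation.ReflTransGen (ChainStep r U) x y ∨
      ∃ v v', v' ∈ V ∧ dist x v ≤ R₁ + r ∧
        Relation.ReflTransGen (ChainStep (R₁ + 2 * r) V) v v' ∧
        (y = v' ∨ ∃ u ∈ U, dist v' u < r ∧ Relation.ReflTransGen (ChainStep r U) u y) := by
    induction hxy with
    | refl => exact Or.inl .refl
    | @tail y z hy hz ih =>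
      obtain ⟨hyT, hzT, hd⟩ := hz
      rcases ih with h | ⟨v, v', hv', hxv, hvv, h⟩
      · rcases hzT with hzU | hzV
        · by_cases hyU : y ∈ U
          · exact Or.inl (h.tail ⟨hyU, hzU, hd⟩)
          · have hxy' : x = y := by
              rcases Relation.ReflTransGen.cases_tail h with h | ⟨w, _, hw⟩
              · exact h.symm
              · exact absurd hw.2.1 hyU
            subst hxy'
            refine Or.inr ⟨x, x, hyT.resolve_left hyU, by simp; positivity, .refl,
              Or.inr ⟨z, hzU, hd, .refl⟩⟩
        · refine Or.inr ⟨z, z, hzV, ?_, .refl, Or.inl rfl⟩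
          have := hU x y h
          linarith [dist_triangle x y z]
      · refine Or.inr ?_
        rcases h with rfl | ⟨u, hu, hvu, huy⟩
        · rcases hzT with hzU | hzV
          · exact ⟨v, y, hv', hxv, hvv, Or.inr ⟨z, hzU, hd, .refl⟩⟩
          · exact ⟨v, z, hzV, hxv, hvv.tail ⟨hv', hzV, by linarith⟩, Or.inl rfl⟩
        · rcases hzT with hzU | hzV
          · exact ⟨v, v', hv', hxv, hvv,
              Or.inr ⟨u, hu, hvu, huy.tail ⟨ChainStep.mem_of_mem huy hu, hzU, hd⟩⟩⟩
          · refine ⟨v, z, hzV, hxv, hvv.tail ⟨hv', hzV, ?_⟩, Or.inl rfl⟩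
            have := hU u y huy
            linarith [dist_triangle v' u z, dist_triangle u y z]
  rcases key with h | ⟨v, v', -, hxv, hvv, h⟩
  · have := hU x y h
    linarith
  · have h1 := hV v v' hvv
    rcases h with rfl | ⟨u, -, hvu, huy⟩
    · linarith [dist_triangle x v y]
    · have := hU u y huy
      linarith [dist_triangle x v y, dist_triangle v v' y, dist_triangle v' u y]

/-- A discrete intermediate value property along chains. -/
theorem ChainStep.exists_dist_mem {r : ℝ} {T : Set Y} {x y : Y}
    (h : Relation.ReflTransGen (ChainStep r T) x y) (c : ℝ) (hr : 0 < r) (hc0 : 0 ≤ c)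
    (hc : c ≤ dist x y) :
    ∃ z, Relation.ReflTransGen (ChainStep r T) x z ∧ c ≤ dist x z ∧ dist x z < c + r := by
  induction h with
  | refl => exact ⟨x, .refl, hc, by simp; linarith⟩
  | @tail y z hy hz ih =>
    by_cases h : c ≤ dist x y
    · exact ih h
    · exact ⟨z, hy.tail hz, hc, by linarith [dist_triangle x y z, hz.2.2]⟩

end Chains

/-! ## Almost geodesic paths -/

section ApproxLength

variable {Y : Type*} [MetricSpace Y]

/-- Any two points are joined by paths which are almost geodesic. -/
def HasAlmostGeodesics (Y : Type*) [MetricSpace Y] : Prop :=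
  ∀ (x y : Y) (ε : ℝ), 0 < ε → ∃ γ : Path x y, ∀ t, dist x (γ t) + dist (γ t) y ≤ dist x y + ε

theorem IsLengthSpace.hasAlmostGeodesics (h : IsLengthSpace Y) : HasAlmostGeodesics Y := by
  intro x y ε hε
  have h1 : (⨅ γ : Path x y, pathLength γ) < edist x y + ENNReal.ofReal ε := by
    rw [← h x y]
    exact ENNReal.lt_add_right (edist_ne_top x y) (by simpa using hε)
  obtain ⟨γ, hγ⟩ := iInf_lt_iff.1 h1
  refine ⟨γ, fun t => ?_⟩
  have h2 : edist x (γ t) + edist (γ t) y ≤ pathLength γ := by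
    have e1 : edist (γ 0) (γ t) ≤ eVariationOn (fun t => γ t) (Set.Iic t) :=
      eVariationOn.edist_le _ (by simp) (by simp)
    have e2 : edist (γ t) (γ 1) ≤ eVariationOn (fun t => γ t) (Set.Ici t) :=
      eVariationOn.edist_le _ (by simp) (by simp [unitInterval.le_one'])
    have e3 := eVariationOn.add_le_union (fun t => γ t) (s := Set.Iic t) (t := Set.Ici t)
      (fun a ha b hb => le_trans ha hb)
    have e4 : eVariationOn (fun t => γ t) (Set.Iic t ∪ Set.Ici t) ≤ pathLength γ :=
      eVariationOn.mono _ (subset_univ _)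
    rw [γ.source] at e1
    rw [γ.target] at e2
    exact (add_le_add e1 e2).trans (e3.trans e4)
  have h3 := h2.trans hγ.le
  rw [edist_dist, edist_dist, edist_dist, ← ENNReal.ofReal_add dist_nonneg dist_nonneg,
    ← ENNReal.ofReal_add dist_nonneg hε.le] at h3
  exact (ENNReal.ofReal_le_ofReal_iff (by positivity)).1 h3

theorem HasAlmostGeodesics.exists_dist_eq (h : HasAlmostGeodesics Y) (x z : Y) {s ε : ℝ} (hs : 0 ≤ s)
    (hs' : s ≤ dist x z) (hε : 0 < ε) : ∃ u, dist x u = s ∧ dist u z ≤ dist x z - s + ε := by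
  obtain ⟨γ, hγ⟩ := h x z ε hε
  have hc : Continuous fun t : I => dist x (γ t) := by fun_prop
  obtain ⟨t, ht⟩ : s ∈ range fun t : I => dist x (γ t) :=
    mem_range_of_exists_le_of_exists_ge hc ⟨0, by simpa using hs⟩ ⟨1, by simpa using hs'⟩
  refine ⟨γ t, ht, ?_⟩
  have := hγ t
  simp only at ht
  linarith

theorem HasAlmostGeodesics.isPreconnected_ball (h : HasAlmostGeodesics Y) (x : Y) (ρ : ℝ) :
    IsPreconnected (ball x ρ) := by
  refine isPreconnected_of_forall x fun q hq => ?_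
  rw [mem_ball'] at hq
  obtain ⟨γ, hγ⟩ := h x q ((ρ - dist x q) / 2) (by linarith)
  refine ⟨range γ, ?_, ⟨0, by simp⟩, ⟨1, by simp⟩, isPreconnected_range γ.continuous⟩
  rintro _ ⟨t, rfl⟩
  rw [mem_ball']
  have := hγ t
  linarith [dist_nonneg (x := γ t) (y := q)]

theorem HasAlmostGeodesics.isPreconnected_thickening (h : HasAlmostGeodesics Y) {x y : Y}
    (γ : Path x y) {ρ : ℝ} (hρ : 0 < ρ) : IsPreconnected (thickening ρ (range γ)) := by
  refine isPreconnected_of_forall x fun q hq => ?_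
  obtain ⟨_, ⟨t, rfl⟩, ht⟩ := mem_thickening_iff.1 hq
  refine ⟨range γ ∪ ball (γ t) ρ, union_subset (self_subset_thickening hρ _)
    (ball_subset_thickening (mem_range_self t) ρ), Or.inl ⟨0, by simp⟩, Or.inr ht, ?_⟩
  exact IsPreconnected.union (γ t) ⟨t, rfl⟩ (mem_ball_self hρ) (isPreconnected_range γ.continuous)
    (h.isPreconnected_ball _ _)

end ApproxLength

/-! ## The intrinsic distance of a slab -/

section Slab

variable {Y : Type*} [MetricSpace Y]

/-- The slab of thickness `δ` above height `ρ`. -/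
def slab (f : Y → ℝ) (ρ δ : ℝ) : Set Y := {y | ρ < f y ∧ f y < ρ + δ}

/-- The distance to the two faces of the slab. -/
def slabMargin (f : Y → ℝ) (ρ δ : ℝ) (y : Y) : ℝ := min (f y - ρ) (ρ + δ - f y)

/-- A short step in the slab, not longer than the margin of one of its endpoints. -/
def SlabStep (f : Y → ℝ) (ρ δ : ℝ) (x y : Y) : Prop :=
  x ∈ slab f ρ δ ∧ y ∈ slab f ρ δ ∧ dist x y < δ / 100 ∧
    dist x y < max (slabMargin f ρ δ x) (slabMargin f ρ δ y)

/-- `x` and `y` are joined by a sequence of steps in the slab of total length `l`. -/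
inductive SlabConn (f : Y → ℝ) (ρ δ : ℝ) : Y → Y → ℝ → Prop
  | refl (x : Y) : SlabConn f ρ δ x x 0
  | step {x y : Y} (h : SlabStep f ρ δ x y) : SlabConn f ρ δ x y (dist x y)
  | trans {x y z : Y} {a b : ℝ} (h₁ : SlabConn f ρ δ x y a) (h₂ : SlabConn f ρ δ y z b) :
      SlabConn f ρ δ x z (a + b)

variable {f : Y → ℝ} {ρ δ : ℝ}

theorem SlabStep.symm {x y : Y} (h : SlabStep f ρ δ x y) : SlabStep f ρ δ y x := by
  obtain ⟨h1, h2, h3, h4⟩ := h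
  exact ⟨h2, h1, by rwa [dist_comm], by rwa [dist_comm, max_comm]⟩

theorem SlabConn.symm {x y : Y} {l : ℝ} (h : SlabConn f ρ δ x y l) : SlabConn f ρ δ y x l := by
  induction h with
  | refl x => exact .refl x
  | step h => rw [dist_comm]; exact .step h.symm
  | trans _ _ ih1 ih2 => rw [add_comm]; exact .trans ih2 ih1

theorem SlabConn.dist_le {x y : Y} {l : ℝ} (h : SlabConn f ρ δ x y l) : dist x y ≤ l := by
  induction h with
  | refl x => simp
  | step h => exact le_rfl
  | trans _ _ ih1 ih2 => exact (dist_triangle _ _ _).trans (add_le_add ih1 ih2)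

theorem SlabConn.nonneg {x y : Y} {l : ℝ} (h : SlabConn f ρ δ x y l) : 0 ≤ l :=
  dist_nonneg.trans h.dist_le

theorem SlabConn.mem_iff {x y : Y} {l : ℝ} (h : SlabConn f ρ δ x y l) :
    x ∈ slab f ρ δ ↔ y ∈ slab f ρ δ := by
  induction h with
  | refl x => rfl
  | step h => exact ⟨fun _ => h.2.1, fun _ => h.1⟩
  | trans _ _ ih1 ih2 => exact ih1.trans ih2

theorem SlabConn.exists_split {x y : Y} {l : ℝ} (h : SlabConn f ρ δ x y l) (hδ : 0 < δ) :
    ∀ c, 0 ≤ c → c ≤ l → ∃ u a b, SlabConn f ρ δ x u a ∧ SlabConn f ρ δ u y b ∧ a + b = l ∧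
      c ≤ a ∧ a ≤ c + δ / 100 := by
  induction h with
  | refl x =>
    intro c h0 h1
    exact ⟨x, 0, 0, .refl x, .refl x, by simp, h1, by linarith⟩
  | @step x y h =>
    intro c h0 h1
    exact ⟨y, dist x y, 0, .step h, .refl y, by simp, h1, by linarith [h.2.2.1]⟩
  | @trans x y z a b h₁ h₂ ih1 ih2 =>
    intro c h0 h1
    rcases le_total c a with hca | hca
    · obtain ⟨u, a', b', h3, h4, h5, h6, h7⟩ := ih1 c h0 hca
      exact ⟨u, a', b' + b, h3, h4.trans h₂, by linarith, h6, h7⟩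
    · obtain ⟨u, a', b', h3, h4, h5, h6, h7⟩ := ih2 (c - a) (by linarith) (by linarith)
      exact ⟨u, a + a', b', h₁.trans h3, h4, by linarith, by linarith, by linarith⟩

/-- The equivalence relation of being joined by steps in the slab. -/
def slabSetoid (f : Y → ℝ) (ρ δ : ℝ) : Setoid Y where
  r x y := ∃ l, SlabConn f ρ δ x y l
  iseqv := ⟨fun x => ⟨0, .refl x⟩, fun ⟨l, h⟩ => ⟨l, h.symm⟩,
    fun ⟨_, h⟩ ⟨_, h'⟩ => ⟨_, h.trans h'⟩⟩

/-- A base point in every component of the slab. -/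
noncomputable def slabRoot (f : Y → ℝ) (ρ δ : ℝ) (x : Y) : Y :=
  (Quotient.mk (slabSetoid f ρ δ) x).out

/-- The intrinsic distance to the base point of the component. -/
noncomputable def slabDist (f : Y → ℝ) (ρ δ : ℝ) (x : Y) : ℝ :=
  sInf {l | SlabConn f ρ δ (slabRoot f ρ δ x) x l}

theorem slabRoot_conn (f : Y → ℝ) (ρ δ : ℝ) (x : Y) : ∃ l, SlabConn f ρ δ (slabRoot f ρ δ x) x l :=
  Quotient.exact (s := slabSetoid f ρ δ) (Quotient.out_eq _)

theorem SlabConn.slabRoot_eq {x y : Y} {l : ℝ} (h : SlabConn f ρ δ x y l) :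
    slabRoot f ρ δ x = slabRoot f ρ δ y := by
  unfold slabRoot
  rw [Quotient.sound (s := slabSetoid f ρ δ) ⟨l, h⟩]

theorem slabDist_le {x : Y} {l : ℝ} (h : SlabConn f ρ δ (slabRoot f ρ δ x) x l) :
    slabDist f ρ δ x ≤ l :=
  csInf_le ⟨0, fun _ h => h.nonneg⟩ h

theorem exists_lt_slabDist_add (f : Y → ℝ) (ρ δ : ℝ) (x : Y) {ε : ℝ} (hε : 0 < ε) :
    ∃ l, SlabConn f ρ δ (slabRoot f ρ δ x) x l ∧ l < slabDist f ρ δ x + ε := by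
  obtain ⟨l, h1, h2⟩ := exists_lt_of_csInf_lt (slabRoot_conn f ρ δ x) (lt_add_of_pos_right _ hε)
  exact ⟨l, h1, h2⟩

theorem SlabConn.slabDist_le_add {x y : Y} {l : ℝ} (h : SlabConn f ρ δ x y l) :
    slabDist f ρ δ y ≤ slabDist f ρ δ x + l := by
  refine le_of_forall_pos_lt_add fun ε hε => ?_
  obtain ⟨k, h1, h2⟩ := exists_lt_slabDist_add f ρ δ x hε
  have : SlabConn f ρ δ (slabRoot f ρ δ y) y (k + l) := by
    rw [← h.slabRoot_eq]; exact h1.trans h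
  linarith [slabDist_le this]

theorem dist_le_slabDist_add {x y : Y} {l : ℝ} (h : SlabConn f ρ δ x y l) :
    dist x y ≤ slabDist f ρ δ x + slabDist f ρ δ y := by
  refine le_of_forall_pos_lt_add fun ε hε => ?_
  obtain ⟨k, h1, h2⟩ := exists_lt_slabDist_add f ρ δ x (half_pos hε)
  obtain ⟨k', h1', h2'⟩ := exists_lt_slabDist_add f ρ δ y (half_pos hε)
  rw [← h.slabRoot_eq] at h1'
  have h3 := h1.dist_le
  have h3' := h1'.dist_le
  rw [dist_comm] at h3
  linarith [dist_triangle x (slabRoot f ρ δ x) y]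

theorem SlabStep.of_dist_lt {r : ℝ} {x y : Y} (hr : r ≤ δ / 100) (hr0 : 0 < r)
    (hx : ρ + r ≤ f x ∧ f x ≤ ρ + δ - r) (hy : ρ + r ≤ f y ∧ f y ≤ ρ + δ - r) (hd : dist x y < r) :
    SlabStep f ρ δ x y := by
  refine ⟨⟨by linarith, by linarith⟩, ⟨by linarith, by linarith⟩, by linarith, ?_⟩
  refine lt_max_of_lt_left (lt_min ?_ ?_) <;> linarith

/-- Steps in the slab are thickened to connected open subsets of the slab. -/
theorem SlabStep.exists_open (hY : HasAlmostGeodesics Y) (hf : ∀ x y, f x ≤ f y + dist x y)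
    {x y : Y} (h : SlabStep f ρ δ x y) :
    ∃ (O : Set Y) (κ : ℝ), IsOpen O ∧ IsPreconnected O ∧ x ∈ O ∧ y ∈ O ∧ 0 < κ ∧
      ∀ q ∈ O, ρ + κ < f q ∧
        (∃ a b, SlabConn f ρ δ x q a ∧ SlabConn f ρ δ q y b ∧ a + b ≤ 3 * (δ / 100)) := by
  wlog hm : dist x y < slabMargin f ρ δ x generalizing x y with H
  · obtain ⟨O, κ, h1, h2, h3, h4, h5, h6⟩ := H h.symm (by
      have := h.2.2.2
      rw [dist_comm]
      exact (lt_max_iff.1 this).resolve_left hm)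
    refine ⟨O, κ, h1, h2, h4, h3, h5, fun q hq => ?_⟩
    obtain ⟨h7, a, b, ha, hb, hab⟩ := h6 q hq
    exact ⟨h7, b, a, hb.symm, ha.symm, by linarith⟩
  obtain ⟨hx, hy, hd, -⟩ := id h
  set M := min (δ / 100) (slabMargin f ρ δ x) with hM
  have hdM : dist x y < M := lt_min hd hm
  set ε := (M - dist x y) / 3 with hε
  have hε0 : 0 < ε := by rw [hε]; linarith
  obtain ⟨γ, hγ⟩ := hY x y ε hε0
  refine ⟨thickening ε (range γ), ε / 2, isOpen_thickening, hY.isPreconnected_thickening γ hε0,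
    self_subset_thickening hε0 _ ⟨0, by simp⟩, self_subset_thickening hε0 _ ⟨1, by simp⟩,
    by positivity, fun q hq => ?_⟩
  obtain ⟨_, ⟨t, rfl⟩, ht⟩ := mem_thickening_iff.1 hq
  have hxq : dist x q < dist x y + 2 * ε := by
    have h1 := hγ t
    have h2 := dist_triangle x (γ t) q
    rw [dist_comm q] at ht
    linarith [dist_nonneg (x := γ t) (y := y)]
  have hxM : dist x q < M - ε := by linarith
  have hM1 : M ≤ f x - ρ := (min_le_right _ _).trans (min_le_left _ _)
  have hM2 : M ≤ ρ + δ - f x := (min_le_right _ _).trans (min_le_right _ _)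
  have hM3 : M ≤ δ / 100 := min_le_left _ _
  have hM4 : M ≤ slabMargin f ρ δ x := min_le_right _ _
  have hfq := hf x q
  have hfq' := hf q x
  rw [dist_comm] at hfq'
  have hst : SlabStep f ρ δ x q :=
    ⟨hx, ⟨by linarith, by linarith⟩, by linarith, lt_max_of_lt_left (by linarith)⟩
  refine ⟨by linarith, dist x q, dist x q + dist x y, .step hst, ?_, by linarith⟩
  have := (SlabConn.step hst.symm).trans (SlabConn.step h)
  rwa [dist_comm] at this

theorem SlabConn.exists_open (hY : HasAlmostGeodesics Y) (hf : ∀ x y, f x ≤ f y + dist x y)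
    {x y : Y} {l : ℝ} (h : SlabConn f ρ δ x y l) (hδ : 0 < δ) (hx : x ∈ slab f ρ δ) :
    ∃ (O : Set Y) (κ : ℝ), IsOpen O ∧ IsPreconnected O ∧ x ∈ O ∧ y ∈ O ∧ 0 < κ ∧
      ∀ q ∈ O, ρ + κ < f q ∧
        (∃ a b, SlabConn f ρ δ x q a ∧ SlabConn f ρ δ q y b ∧ a + b ≤ l + 3 * (δ / 100)) := by
  induction h with
  | refl x =>
    have : SlabStep f ρ δ x x := by
      refine ⟨hx, hx, by simpa using hδ, ?_⟩
      rw [dist_self, max_self]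
      exact lt_min (by linarith [hx.1]) (by linarith [hx.2])
    simpa using this.exists_open hY hf
  | step h =>
    obtain ⟨O, κ, h1, h2, h3, h4, h5, h6⟩ := h.exists_open hY hf
    refine ⟨O, κ, h1, h2, h3, h4, h5, fun q hq => ?_⟩
    obtain ⟨h7, a, b, ha, hb, hab⟩ := h6 q hq
    exact ⟨h7, a, b, ha, hb, by linarith [dist_nonneg (x := ‹Y›) (y := ‹Y›),
      (SlabConn.step h).nonneg]⟩
  | @trans x y z a b h₁ h₂ ih1 ih2 =>
    obtain ⟨O, κ, h1, h2, h3, h4, h5, h6⟩ := ih1 hx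
    obtain ⟨O', κ', h1', h2', h3', h4', h5', h6'⟩ := ih2 (h₁.mem_iff.1 hx)
    refine ⟨O ∪ O', min κ κ', h1.union h1', h2.union y h4 h3' h2', Or.inl h3, Or.inr h4',
      lt_min h5 h5', ?_⟩
    rintro q (hq | hq)
    · obtain ⟨h7, c, d, hc, hd, hcd⟩ := h6 q hq
      exact ⟨by linarith [min_le_left κ κ'], c, d + b, hc, hd.trans h₂, by linarith⟩
    · obtain ⟨h7, c, d, hc, hd, hcd⟩ := h6' q hq
      exact ⟨by linarith [min_le_right κ κ'], a + c, d, h₁.trans hc, hd, by linarith⟩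

/-- Chains of short steps in the slab are thickened to connected open sets. -/
theorem exists_open_of_chain (hY : HasAlmostGeodesics Y) (hf : ∀ x y, f x ≤ f y + dist x y)
    {r : ℝ} (hr : r ≤ δ / 100) (hr0 : 0 < r) {T : Set Y}
    (hT : ∀ x ∈ T, ρ + r ≤ f x ∧ f x ≤ ρ + δ - r) {x y : Y} (hx : x ∈ T)
    (h : Relation.ReflTransGen (ChainStep r T) x y) :
    ∃ (O : Set Y) (κ : ℝ), IsOpen O ∧ IsPreconnected O ∧ x ∈ O ∧ y ∈ O ∧ 0 < κ ∧
      ∀ q ∈ O, ρ + κ < f q ∧ ∃ z ∈ T, ∃ a, SlabConn f ρ δ q z a ∧ a ≤ 3 * (δ / 100) := by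
  have hstep : ∀ {x y}, x ∈ T → y ∈ T → dist x y < r → SlabStep f ρ δ x y := fun hx hy hd =>
    SlabStep.of_dist_lt hr hr0 (hT _ hx) (hT _ hy) hd
  have hone : ∀ {x y}, x ∈ T → y ∈ T → dist x y < r →
      ∃ (O : Set Y) (κ : ℝ), IsOpen O ∧ IsPreconnected O ∧ x ∈ O ∧ y ∈ O ∧ 0 < κ ∧
      ∀ q ∈ O, ρ + κ < f q ∧ ∃ z ∈ T, ∃ a, SlabConn f ρ δ q z a ∧ a ≤ 3 * (δ / 100) := by
    intro x y hx hy hd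
    obtain ⟨O, κ, h1, h2, h3, h4, h5, h6⟩ := (hstep hx hy hd).exists_open hY hf
    refine ⟨O, κ, h1, h2, h3, h4, h5, fun q hq => ?_⟩
    obtain ⟨h7, a, b, ha, hb, hab⟩ := h6 q hq
    exact ⟨h7, y, hy, b, hb, by linarith [ha.nonneg]⟩
  induction h with
  | refl => exact hone hx hx (by simpa using hr0)
  | @tail y z hy hz ih =>
    obtain ⟨O, κ, h1, h2, h3, h4, h5, h6⟩ := ih
    obtain ⟨O', κ', h1', h2', h3', h4', h5', h6'⟩ := hone hz.1 hz.2.1 hz.2.2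
    refine ⟨O ∪ O', min κ κ', h1.union h1', h2.union y h4 h3' h2', Or.inl h3, Or.inr h4',
      lt_min h5 h5', ?_⟩
    rintro q (hq | hq)
    · obtain ⟨h7, hc⟩ := h6 q hq
      exact ⟨by linarith [min_le_left κ κ'], hc⟩
    · obtain ⟨h7, hc⟩ := h6' q hq
      exact ⟨by linarith [min_le_right κ κ'], hc⟩

/-- One can descend in the slab towards the base point. -/
theorem exists_slabConn_lt (hY : HasAlmostGeodesics Y) (x₀ : Y) {ρ δ : ℝ} (hρ : 0 ≤ ρ) (hδ : 0 < δ)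
    {u : Y} (hu : u ∈ slab (dist x₀) ρ δ) {κ : ℝ} (hκ : 0 < κ) :
    ∃ q l, SlabConn (dist x₀) ρ δ u q l ∧ dist x₀ q < ρ + κ ∧ l ≤ 10 / 9 * δ := by
  set τ := 9 / 10 * (min (δ / 200) (κ / 2)) with hτ
  have hτ0 : 0 < τ := by have := lt_min (show 0 < δ / 200 by linarith) (half_pos hκ); linarith
  have key : ∀ (n : ℕ) (x : Y), x ∈ slab (dist x₀) ρ δ → dist x₀ x < ρ + κ + n * τ →
      ∃ q l, SlabConn (dist x₀) ρ δ x q l ∧ dist x₀ q < ρ + κ ∧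
        l ≤ 10 / 9 * (dist x₀ x - dist x₀ q) := by
    intro n
    induction n with
    | zero =>
      intro x hx h
      exact ⟨x, 0, .refl x, by simpa using h, by simp⟩
    | succ n ih =>
      intro x hx h
      by_cases hxκ : dist x₀ x < ρ + κ
      · exact ⟨x, 0, .refl x, hxκ, by simp⟩
      push Not at hxκ
      set D := dist x₀ x with hD
      set s := min (δ / 200) ((D - ρ) / 2) with hs
      have hs1 : s ≤ δ / 200 := min_le_left _ _
      have hs2 : s ≤ (D - ρ) / 2 := min_le_right _ _
      have hs0 : 0 < s := lt_min (by linarith) (by linarith [hx.1])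
      have hsτ : τ ≤ 9 / 10 * s := by
        have : min (δ / 200) (κ / 2) ≤ s := min_le_min le_rfl (by linarith)
        linarith
      obtain ⟨hx1, hx2⟩ := hx
      obtain ⟨x', h1, h2⟩ := hY.exists_dist_eq x x₀ (s := s) (ε := min (s / 10) ((ρ + δ - D) / 2))
        hs0.le (by rw [dist_comm]; linarith) (lt_min (by linarith) (by linarith))
      have he1 := min_le_left (s / 10) ((ρ + δ - D) / 2)
      have he2 := min_le_right (s / 10) ((ρ + δ - D) / 2)
      rw [dist_comm x' x₀, dist_comm x x₀, ← hD] at h2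
      have h3 := dist_triangle x₀ x' x
      rw [dist_comm x' x, h1, ← hD] at h3
      have hx' : x' ∈ slab (dist x₀) ρ δ := ⟨by linarith, by linarith⟩
      have hstep : SlabStep (dist x₀) ρ δ x x' := by
        refine ⟨⟨hx1, hx2⟩, hx', by linarith, ?_⟩
        rw [h1]
        by_cases hhalf : D - ρ ≤ δ / 2
        · exact lt_max_of_lt_left (lt_min (by linarith) (by linarith))
        · exact lt_max_of_lt_right (lt_min (by linarith) (by linarith))
      obtain ⟨q, l, h4, h5, h6⟩ := ih x' hx' (by push_cast at h; linarith)
      exact ⟨q, dist x x' + l, (SlabConn.step hstep).trans h4, h5, by rw [h1]; linarith⟩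
  obtain ⟨n, hn⟩ := exists_nat_gt (δ / τ)
  obtain ⟨q, l, h1, h2, h3⟩ := key n u hu (by
    rw [div_lt_iff₀ hτ0] at hn
    linarith [hu.2])
  by_cases hq : q ∈ slab (dist x₀) ρ δ
  · exact ⟨q, l, h1, h2, by linarith [hq.1, hu.2]⟩
  · exact absurd (h1.mem_iff.1 hu) hq

end Slab

/-! ## Slabs and configurations of disjoint connected sets -/

section SlabConfig

/-- A drawing of the complete bipartite graph on `3 + p` vertices by connected open sets such that
the sets of independent edges are disjoint. -/
def BipartiteConfig (p : ℕ) (Y : Type*) [TopologicalSpace Y] : Prop :=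
  ∃ (h : Fin 3 → Y) (u : Fin p → Y) (O : Fin p → Fin 3 → Set Y),
    (∀ i a, IsOpen (O i a) ∧ IsPreconnected (O i a) ∧ u i ∈ O i a ∧ h a ∈ O i a) ∧
    ∀ i j a b, i ≠ j → a ≠ b → Disjoint (O i a) (O j b)

variable {Y : Type*} [MetricSpace Y]

/-- The part of the core of a slab lying in the `m`-th intrinsic annulus. -/
def slabPiece (f : Y → ℝ) (ρ δ r : ℝ) (m : ℤ) : Set Y :=
  {x | (ρ + r ≤ f x ∧ f x ≤ ρ + δ - r) ∧ m * δ ≤ slabDist f ρ δ x ∧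
    slabDist f ρ δ x < (m + 1) * δ}

theorem bipartiteConfig_of_slabPiece (hY : HasAlmostGeodesics Y) (x₀ : Y) {ρ δ r : ℝ} (hρ : 0 ≤ ρ)
    (hδ : 0 < δ) (hr0 : 0 < r) (hr : r ≤ δ / 100) {m : ℤ} (hm : 3 ≤ m) {p : ℕ} {x : Y}
    (hx : x ∈ slabPiece (dist x₀) ρ δ r m) (v : Fin p → Y)
    (hv : ∀ i, Relation.ReflTransGen (ChainStep r (slabPiece (dist x₀) ρ δ r m)) x (v i))
    (hsep : ∀ i j, i ≠ j → 10 * δ ≤ dist (v i) (v j)) : BipartiteConfig p Y := by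
  set f := dist x₀ with hf'
  set g := slabDist f ρ δ with hg
  set T := slabPiece f ρ δ r m with hT
  have hf : ∀ x y, f x ≤ f y + dist x y := fun x y => by
    rw [dist_comm x y]; exact dist_triangle _ _ _
  have hTA : ∀ y ∈ T, y ∈ slab f ρ δ := fun y hy => ⟨by linarith [hy.1.1], by linarith [hy.1.2]⟩
  have hm' : (3 : ℝ) ≤ m := by exact_mod_cast hm
  have hmδ : 3 * δ ≤ m * δ := by nlinarith
  have hvT : ∀ i, v i ∈ T := fun i => ChainStep.mem_of_mem (hv i) hx
  have hconn : ∀ y, Relation.ReflTransGen (ChainStep r T) x y → slabRoot f ρ δ y = slabRoot f ρ δ x := by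
    intro y hy
    induction hy with
    | refl => rfl
    | tail _ hs ih =>
      rw [← ih]
      exact ((SlabConn.step (SlabStep.of_dist_lt hr hr0 hs.1.1 hs.2.1.1 hs.2.2)).slabRoot_eq).symm
  set R := slabRoot f ρ δ x with hR
  have hRA : R ∈ slab f ρ δ := by
    obtain ⟨l, hl⟩ := slabRoot_conn f ρ δ x
    exact hl.mem_iff.2 (hTA x hx)
  have hgR : ∀ {q a}, SlabConn f ρ δ R q a → g q ≤ a := by
    intro q a h
    refine slabDist_le ?_
    rwa [← h.slabRoot_eq, show slabRoot f ρ δ R = R from ?_]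
    obtain ⟨l, hl⟩ := slabRoot_conn f ρ δ x
    exact hl.slabRoot_eq
  set c := (m - 2) * δ with hc
  -- the branch points
  have hu : ∀ i, ∃ u a b, SlabConn f ρ δ R u a ∧ SlabConn f ρ δ u (v i) b ∧
      c ≤ a ∧ a ≤ c + δ / 100 ∧ a + b < g (v i) + δ / 100 := by
    intro i
    obtain ⟨l, h1, h2⟩ := exists_lt_slabDist_add f ρ δ (v i) (show 0 < δ / 100 by linarith)
    rw [hconn _ (hv i)] at h1
    have := (hvT i).2.1
    have h3 := hgR h1
    obtain ⟨u, a, b, h4, h5, h6, h7, h8⟩ := h1.exists_split hδ c (by rw [hc]; nlinarith)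
      (by linarith)
    exact ⟨u, a, b, h4, h5, h7, h8, by rw [h6]; exact h2⟩
  choose u a b hRu huv hca hac hab using hu
  have huA : ∀ i, u i ∈ slab f ρ δ := fun i => (hRu i).mem_iff.1 hRA
  have hgu : ∀ i, g (u i) ≤ a i := fun i => hgR (hRu i)
  have hgv : ∀ i, g (v i) ≤ g (u i) + b i := fun i => (huv i).slabDist_le_add
  have hb : ∀ i, b i ≤ 3 * δ + δ / 100 := fun i => by
    linarith [hab i, hca i, (hvT i).2.2]
  have husep : ∀ i j, i ≠ j → 39 / 10 * δ ≤ dist (u i) (u j) := by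
    intro i j hij
    have h1 := hsep i j hij
    have h2 := (huv i).symm.dist_le
    have h3 := (huv j).dist_le
    linarith [hb i, hb j, dist_triangle (v i) (u i) (v j), dist_triangle (u i) (u j) (v j)]
  -- the edges to the base point
  have h2 := fun i => (hRu i).exists_open hY hf hδ hRA
  choose O2 κ2 hO2o hO2c hO2R hO2u hκ2 hO2 using h2
  have h3 := fun i => (huv i).exists_open hY hf hδ (huA i)
  choose O3 κ3 hO3o hO3c hO3u hO3v hκ3 hO3 using h3
  have h4 := fun i => exists_open_of_chain hY hf hr hr0 (T := T) (fun y hy => hy.1) hx (hv i)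
  choose O4 κ4 hO4o hO4c hO4x hO4v hκ4 hO4 using h4
  obtain ⟨κ, hκ0, hκ⟩ : ∃ κ > 0, ∀ i, κ ≤ κ2 i ∧ κ ≤ κ3 i ∧ κ ≤ κ4 i := by
    have : ∀ᶠ κ in 𝓝[>] (0 : ℝ), ∀ i, κ ≤ κ2 i ∧ κ ≤ κ3 i ∧ κ ≤ κ4 i := by
      refine eventually_all.2 fun i => ?_
      have e : ∀ {c : ℝ}, 0 < c → ∀ᶠ κ in 𝓝[>] (0 : ℝ), κ ≤ c := fun hc =>
        mem_nhdsWithin_of_mem_nhds (Iic_mem_nhds hc)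
      exact (e (hκ2 i)).and ((e (hκ3 i)).and (e (hκ4 i)))
    obtain ⟨κ, h1, h2⟩ := (this.and self_mem_nhdsWithin).exists
    exact ⟨κ, h2, h1⟩
  have h1 := fun i => exists_slabConn_lt hY x₀ hρ hδ (huA i) hκ0
  choose q l hul hfq hl using h1
  have h1 := fun i => (hul i).exists_open hY hf hδ (huA i)
  choose O1 κ1 hO1o hO1c hO1u hO1q hκ1 hO1 using h1
  have hx₀q : ∀ i, q i ∈ ball x₀ (ρ + κ) := fun i => by rw [mem_ball']; exact hfq i
  -- facts on the points of the sets
  have fact1 : ∀ i, ∀ z ∈ O1 i, dist (u i) z ≤ 115 / 100 * δ ∧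
      g z ≤ g (u i) + 115 / 100 * δ ∧ g (u i) ≤ g z + 115 / 100 * δ := by
    intro i z hz
    obtain ⟨-, s, t, hs, ht, hst⟩ := hO1 i z hz
    have hs' : s ≤ 115 / 100 * δ := by linarith [ht.nonneg, hl i]
    exact ⟨hs.dist_le.trans hs', by linarith [hs.slabDist_le_add],
      by linarith [hs.symm.slabDist_le_add]⟩
  have fact2 : ∀ i, ∀ z ∈ O2 i, g z + dist z (u i) ≤ a i + 3 * (δ / 100) := by
    intro i z hz
    obtain ⟨-, s, t, hs, ht, hst⟩ := hO2 i z hz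
    linarith [hgR hs, ht.dist_le]
  have fact3 : ∀ i, ∀ z ∈ O3 i, a i + dist (u i) z ≤ g z + 4 * (δ / 100) := by
    intro i z hz
    obtain ⟨-, s, t, hs, ht, hst⟩ := hO3 i z hz
    linarith [hs.dist_le, ht.slabDist_le_add, hab i]
  have fact4 : ∀ i, ∀ z ∈ O4 i, m * δ ≤ g z + 3 * (δ / 100) := by
    intro i z hz
    obtain ⟨-, w, hw, s, hs, hs'⟩ := hO4 i z hz
    linarith [hs.slabDist_le_add, hw.2.1]
  -- disjointness
  have d12 : ∀ i j, i ≠ j → Disjoint (O1 i ∪ ball x₀ (ρ + κ)) (O2 j) := by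
    intro i j hij
    refine Set.disjoint_left.2 ?_
    rintro z (hz | hz) hz'
    · have e1 := fact1 i z hz
      have e2 := fact2 j z hz'
      have e3 := husep i j hij
      have e4 := hgv i
      linarith [dist_triangle (u i) z (u j), hca j, hac j, hca i, hac i, hab i]
    · rw [mem_ball'] at hz
      have := (hO2 j z hz').1
      have := (hκ j).1
      linarith
  have d13 : ∀ i j, i ≠ j → Disjoint (O1 i ∪ ball x₀ (ρ + κ)) (O3 j ∪ O4 j) := by
    intro i j hij
    refine Set.disjoint_left.2 ?_
    rintro z (hz | hz) (hz' | hz')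
    · have e1 := fact1 i z hz
      have e2 := fact3 j z hz'
      have e3 := husep i j hij
      rw [dist_comm (u j)] at e2
      linarith [dist_triangle (u i) z (u j), hca j, hac j, hca i, hac i, hgu i]
    · have e1 := fact1 i z hz
      have e2 := fact4 j z hz'
      linarith [hca j, hac j, hca i, hac i, hgu i]
    · rw [mem_ball'] at hz
      have := (hO3 j z hz').1
      have := (hκ j).2.1
      linarith
    · rw [mem_ball'] at hz
      have := (hO4 j z hz').1
      have := (hκ j).2.2
      linarith
  have d23 : ∀ i j, i ≠ j → Disjoint (O2 i) (O3 j ∪ O4 j) := by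
    intro i j hij
    refine Set.disjoint_left.2 ?_
    rintro z hz (hz' | hz')
    · have e1 := fact2 i z hz
      have e2 := fact3 j z hz'
      have e3 := husep i j hij
      rw [dist_comm (u j)] at e2
      rw [dist_comm z] at e1
      linarith [dist_triangle (u i) z (u j), hca j, hac j, hca i, hac i, hgu i]
    · have e1 := fact2 i z hz
      have e2 := fact4 j z hz'
      linarith [hca j, hac j, hca i, hac i, hgu i, dist_nonneg (x := z) (y := u i)]
  refine ⟨![x₀, R, x], u, fun i => ![O1 i ∪ ball x₀ (ρ + κ), O2 i, O3 i ∪ O4 i], ?_, ?_⟩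
  · intro i k
    fin_cases k
    · exact ⟨(hO1o i).union isOpen_ball,
        (hO1c i).union (q i) (hO1q i) (hx₀q i) (hY.isPreconnected_ball _ _),
        Or.inl (hO1u i), Or.inr (mem_ball_self (by linarith))⟩
    · exact ⟨hO2o i, hO2c i, hO2u i, hO2R i⟩
    · exact ⟨(hO3o i).union (hO4o i), (hO3c i).union (v i) (hO3v i) (hO4v i) (hO4c i),
        Or.inl (hO3u i), Or.inr (hO4x i)⟩
  · intro i j k k' hij hk
    fin_cases k <;> fin_cases k' <;> first | exact absurd rfl hk | skip
    · exact d12 i j hij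
    · exact d13 i j hij
    · exact (d12 j i hij.symm).symm
    · exact d23 i j hij
    · exact (d13 j i hij.symm).symm
    · exact (d23 j i hij.symm).symm

theorem chainBounded_slabPiece (hY : HasAlmostGeodesics Y) (x₀ : Y) {ρ δ r : ℝ} (hρ : 0 ≤ ρ)
    (hδ : 0 < δ) (hr0 : 0 < r) (hr : r ≤ δ / 100) {p : ℕ} (hp : ¬ BipartiteConfig p Y) (m : ℤ) :
    ChainBounded r ((11 * p + 8) * δ) (slabPiece (dist x₀) ρ δ r m) := by
  intro x y hxy
  by_cases hx : x ∈ slabPiece (dist x₀) ρ δ r m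
  swap
  · rcases Relation.ReflTransGen.cases_head hxy with rfl | ⟨z, hz, hzy⟩
    · rw [dist_self]; positivity
    · exact absurd hz.1 hx
  have hy := ChainStep.mem_of_mem hxy hx
  by_cases hm : 3 ≤ m
  · by_contra hd
    push Not at hd
    refine hp ?_
    have hz : ∀ i : Fin p, ∃ z, Relation.ReflTransGen (ChainStep r (slabPiece (dist x₀) ρ δ r m)) x z ∧
        i * (11 * δ) ≤ dist x z ∧ dist x z < i * (11 * δ) + r := fun i => by
      refine ChainStep.exists_dist_mem hxy _ hr0 (by positivity) ?_
      have : (i : ℝ) ≤ p := by exact_mod_cast i.2.le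
      nlinarith
    choose v hv1 hv2 hv3 using hz
    refine bipartiteConfig_of_slabPiece hY x₀ hρ hδ hr0 hr hm hx v hv1 ?_
    have main : ∀ i j : Fin p, i < j → 10 * δ ≤ dist (v i) (v j) := by
      intro i j hij
      have h1 : (i : ℝ) + 1 ≤ j := by exact_mod_cast hij
      have := dist_triangle x (v i) (v j)
      nlinarith [hv3 i, hv2 j]
    intro i j hij
    rcases lt_or_gt_of_ne hij with h | h
    · exact main i j h
    · rw [dist_comm]; exact main j i h
  · have hc : ∃ l, SlabConn (dist x₀) ρ δ x y l := by
      clear hy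
      induction hxy with
      | refl => exact ⟨0, .refl x⟩
      | tail _ hs ih =>
        obtain ⟨l, hl⟩ := ih
        exact ⟨_, hl.trans (.step (SlabStep.of_dist_lt hr hr0 hs.1.1 hs.2.1.1 hs.2.2))⟩
    obtain ⟨l, hl⟩ := hc
    have h1 := dist_le_slabDist_add hl
    have h2 := hx.2.2
    have h3 := hy.2.2
    have hm' : (m : ℝ) + 1 ≤ 3 := by
      have : m + 1 ≤ 3 := by omega
      exact_mod_cast this
    have h4 : ((m : ℝ) + 1) * δ ≤ 3 * δ := by nlinarith
    have h5 : (0 : ℝ) ≤ p * δ := by positivity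
    nlinarith

/-- The core of a slab is the union of two sets with bounded coarse components. -/
theorem exists_slab_cover (hY : HasAlmostGeodesics Y) (x₀ : Y) {p : ℕ} (hp : ¬ BipartiteConfig p Y)
    (ρ : ℝ) {δ r : ℝ} (hδ : 0 < δ) (hr0 : 0 < r) (hr : r ≤ δ / 100) :
    ∃ B B' : Set Y, ChainBounded r ((11 * p + 8) * δ) B ∧ ChainBounded r ((11 * p + 8) * δ) B' ∧
      B ∪ B' = {x | ρ + r ≤ dist x₀ x ∧ dist x₀ x ≤ ρ + δ - r} := by
  have hC : 0 ≤ (11 * p + 8) * δ := by positivity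
  rcases lt_or_ge ρ 0 with hρ | hρ
  · refine ⟨{x | ρ + r ≤ dist x₀ x ∧ dist x₀ x ≤ ρ + δ - r}, ∅, ?_, ?_, by simp⟩
    · refine ChainBounded.of_dist hC fun x hx y hy => ?_
      have h5 : (0 : ℝ) ≤ p * δ := by positivity
      have := dist_triangle_left x y x₀
      linarith [hx.2, hy.2]
    · exact ChainBounded.of_dist hC (by simp)
  · have hsep : ∀ m m' : ℤ, m + 2 ≤ m' → ∀ x ∈ slabPiece (dist x₀) ρ δ r m,
        ∀ y ∈ slabPiece (dist x₀) ρ δ r m', r ≤ dist x y := by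
      intro m m' hmm x hx y hy
      by_contra hd
      push Not at hd
      have h1 := (SlabConn.step (SlabStep.of_dist_lt hr hr0 hx.1 hy.1 hd)).slabDist_le_add
      have h2 : (m : ℝ) + 2 ≤ m' := by exact_mod_cast hmm
      have h3 := hx.2.2
      have h4 := hy.2.1
      nlinarith
    have hsep' : ∀ m m' : ℤ, m + 2 ≤ m' ∨ m' + 2 ≤ m → ∀ x ∈ slabPiece (dist x₀) ρ δ r m,
        ∀ y ∈ slabPiece (dist x₀) ρ δ r m', r ≤ dist x y := by
      rintro m m' (h | h) x hx y hy
      · exact hsep m m' h x hx y hy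
      · rw [dist_comm]; exact hsep m' m h y hy x hx
    refine ⟨⋃ k : ℤ, slabPiece (dist x₀) ρ δ r (2 * k), ⋃ k : ℤ, slabPiece (dist x₀) ρ δ r (2 * k + 1),
      ChainBounded.iUnion hC (fun k => chainBounded_slabPiece hY x₀ hρ hδ hr0 hr hp _)
        (fun i j hij => hsep' _ _ (by omega)),
      ChainBounded.iUnion hC (fun k => chainBounded_slabPiece hY x₀ hρ hδ hr0 hr hp _)
        (fun i j hij => hsep' _ _ (by omega)), ?_⟩
    ext x
    simp only [mem_union, mem_iUnion]
    constructor
    · rintro (⟨k, hk⟩ | ⟨k, hk⟩) <;> exact hk.1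
    · intro hx
      have h1 := Int.floor_le (slabDist (dist x₀) ρ δ x / δ)
      have h2 := Int.lt_floor_add_one (slabDist (dist x₀) ρ δ x / δ)
      rw [le_div_iff₀ hδ] at h1
      rw [div_lt_iff₀ hδ] at h2
      have h3 : x ∈ slabPiece (dist x₀) ρ δ r ⌊slabDist (dist x₀) ρ δ x / δ⌋ := ⟨hx, h1, h2⟩
      rcases Int.even_or_odd' ⌊slabDist (dist x₀) ρ δ x / δ⌋ with ⟨k, hk | hk⟩
      · exact Or.inl ⟨k, hk ▸ h3⟩
      · exact Or.inr ⟨k, hk ▸ h3⟩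

end SlabConfig

/-! ## Linear control of coarse dimension two -/

section CoarseCover

variable {Y : Type*} [MetricSpace Y]

/-- The ratio between the diameter of coarse components and the scale. -/
def coarseConst (p : ℕ) : ℝ :=
  (11 * p + 8) * (100 * ((11 * p + 8) * 100 + 2)) + 2 * ((11 * p + 8) * 100) + 2

theorem chainBounded_iUnion_of_period {f : Y → ℝ} (hf : ∀ x y, f x ≤ f y + dist x y) {r R P α : ℝ}
    (hR : 0 ≤ R) (hP : 0 ≤ P) {T : ℤ → Set Y} (h : ∀ k, ChainBounded r R (T k))
    (hT : ∀ k, ∀ x ∈ T k, α + k * P ≤ f x ∧ f x ≤ α + (k + 1) * P - r) :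
    ChainBounded r R (⋃ k, T k) := by
  have key : ∀ i j : ℤ, i < j → ∀ x ∈ T i, ∀ y ∈ T j, r ≤ dist x y := by
    intro i j hij x hx y hy
    have h1 : (i : ℝ) + 1 ≤ j := by exact_mod_cast hij
    have h2 := hf y x
    rw [dist_comm] at h2
    nlinarith [(hT i x hx).2, (hT j y hy).1]
  refine ChainBounded.iUnion hR h fun i j hij x hx y hy => ?_
  rcases lt_or_gt_of_ne hij with h | h
  · exact key i j h x hx y hy
  · rw [dist_comm]; exact key j i h y hy x hx

theorem exists_coarse_cover (hY : HasAlmostGeodesics Y) {p : ℕ} (hp : ¬ BipartiteConfig p Y)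
    {r : ℝ} (hr : 0 < r) :
    ∃ T : Fin 3 → Set Y, (∀ c, ChainBounded r (coarseConst p * r) (T c)) ∧ ⋃ c, T c = univ := by
  rcases isEmpty_or_nonempty Y with hE | ⟨⟨x₀⟩⟩
  · refine ⟨fun _ => ∅, fun c x => (IsEmpty.false x).elim, ?_⟩
    ext x; exact (IsEmpty.false x).elim
  set f := dist x₀ with hf'
  have hf : ∀ x y, f x ≤ f y + dist x y := fun x y => by
    rw [dist_comm x y]; exact dist_triangle _ _ _
  set C : ℝ := 11 * p + 8 with hC
  have hC0 : 8 ≤ C := by rw [hC]; have : (0 : ℝ) ≤ p := by positivity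
                         linarith
  set R₁ := C * (100 * r) with hR₁
  have hR₁0 : 0 ≤ R₁ := by positivity
  set r₂ := R₁ + 2 * r with hr₂
  set R₂ := C * (100 * r₂) with hR₂
  have hR₂0 : 0 ≤ R₂ := by positivity
  have hr₂r : r ≤ r₂ := by linarith
  have hR : R₂ + 2 * R₁ + 2 * r = coarseConst p * r := by
    unfold coarseConst; rw [hR₂, hr₂, hR₁]; ring
  set P := 98 * r + 98 * r₂ with hP
  have hP0 : 0 < P := by positivity
  have hN := fun k : ℤ => exists_slab_cover hY x₀ hp (k * P - r) (δ := 100 * r) (r := r)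
    (by positivity) hr (by linarith)
  choose N N' hNb hN'b hNN' using hN
  have hW := fun k : ℤ => exists_slab_cover hY x₀ hp (k * P + 98 * r - r₂) (δ := 100 * r₂) (r := r₂)
    (by positivity) (by linarith) (by linarith)
  choose W W' hWb hW'b hWW' using hW
  have hNm : ∀ k, ∀ x ∈ N k ∪ N' k, k * P ≤ f x ∧ f x ≤ k * P + 98 * r := fun k x hx => by
    rw [hNN' k] at hx
    exact ⟨by linarith [hx.1], by linarith [hx.2]⟩
  have hWm : ∀ k, ∀ x ∈ W k ∪ W' k, k * P + 98 * r ≤ f x ∧ f x ≤ (k + 1) * P := fun k x hx => by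
    rw [hWW' k] at hx
    exact ⟨by linarith [hx.1], by linarith [hx.2]⟩
  refine ⟨![⋃ k : ℤ, ((N k ∩ {x | k * P + 49 * r ≤ f x}) ∪ W k),
    ⋃ k : ℤ, ((N k ∩ {x | f x < k * P + 49 * r}) ∪ W' (k - 1)), ⋃ k : ℤ, N' k], ?_, ?_⟩
  · intro c
    fin_cases c
    · refine chainBounded_iUnion_of_period hf (by rw [← hR]; positivity) hP0.le (α := 49 * r)
        (fun k => hR ▸ ChainBounded.union hr.le hR₁0 hR₂0
          ((hNb k).mono inter_subset_left le_rfl) (hWb k)) ?_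
      rintro k x (⟨hx, hx'⟩ | hx)
      · have := hNm k x (Or.inl hx)
        simp only [mem_ofPred_eq] at hx'
        exact ⟨by linarith, by linarith⟩
      · have := hWm k x (Or.inl hx)
        exact ⟨by linarith, by linarith⟩
    · refine chainBounded_iUnion_of_period hf (by rw [← hR]; positivity) hP0.le (α := 98 * r - P)
        (fun k => hR ▸ ChainBounded.union hr.le hR₁0 hR₂0
          ((hNb k).mono inter_subset_left le_rfl) (hW'b (k - 1))) ?_
      rintro k x (⟨hx, hx'⟩ | hx)
      · have := hNm k x (Or.inl hx)
        simp only [mem_ofPred_eq] at hx'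
        exact ⟨by linarith, by linarith⟩
      · have := hWm (k - 1) x (Or.inr hx)
        push_cast at this
        exact ⟨by linarith, by linarith⟩
    · refine chainBounded_iUnion_of_period hf (by rw [← hR]; positivity) hP0.le (α := 0)
        (fun k => (hN'b k).mono subset_rfl (by rw [← hR]; linarith)) ?_
      intro k x hx
      have := hNm k x (Or.inr hx)
      exact ⟨by linarith, by linarith⟩
  · refine eq_univ_of_forall fun x => ?_
    set k := ⌊f x / P⌋ with hk
    have h1 := Int.floor_le (f x / P)
    have h2 := Int.lt_floor_add_one (f x / P)
    rw [← hk, le_div_iff₀ hP0] at h1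
    rw [← hk, div_lt_iff₀ hP0] at h2
    rw [mem_iUnion]
    by_cases hx : f x ≤ k * P + 98 * r
    · have : x ∈ N k ∪ N' k := by
        rw [hNN' k]; exact ⟨by linarith, by linarith⟩
      rcases this with h | h
      · by_cases hx' : k * P + 49 * r ≤ f x
        · exact ⟨0, mem_iUnion.2 ⟨k, Or.inl ⟨h, hx'⟩⟩⟩
        · exact ⟨1, mem_iUnion.2 ⟨k, Or.inl ⟨h, not_le.1 hx'⟩⟩⟩
      · exact ⟨2, mem_iUnion.2 ⟨k, h⟩⟩
    · have : x ∈ W k ∪ W' k := by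
        rw [hWW' k]; exact ⟨by linarith, by linarith⟩
      rcases this with h | h
      · exact ⟨0, mem_iUnion.2 ⟨k, Or.inr h⟩⟩
      · refine ⟨1, mem_iUnion.2 ⟨k + 1, Or.inr ?_⟩⟩
        simpa using h

end CoarseCover

/-! ## Covering dimension of limits -/

section Transfer

theorem coveringDimLE_two_of_coarse {X : Type} [MetricSpace X] [CompactSpace X] {D : ℝ}
    (h : ∀ r > 0, ∃ T : Fin 3 → Set X, (∀ c, ChainBounded r (D * r) (T c)) ∧ ⋃ c, T c = univ) :
    CoveringDimLE X 2 := by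
  intro U hU hcov
  obtain ⟨ε, hε, hLeb⟩ := lebesgue_number_lemma_of_metric_sUnion isCompact_univ hU hcov.ge
  set r := ε / (2 * (|D| + 2)) with hr
  have hr0 : 0 < r := by positivity
  have hDr : D * r + r < ε := by
    have h1 : r * (2 * (|D| + 2)) = ε := by rw [hr]; field_simp
    nlinarith [le_abs_self D, abs_nonneg D]
  obtain ⟨T, hT, hTc⟩ := h r hr0
  set V : Fin 3 → X → Set X := fun c x =>
    {z | ∃ y, Relation.ReflTransGen (ChainStep r (T c)) x y ∧ dist z y < r / 2} with hV
  refine ⟨{v | ∃ c, ∃ x ∈ T c, v = V c x}, ?_, ?_, ?_, ?_⟩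
  · rintro _ ⟨c, x, hx, rfl⟩
    have : V c x = ⋃ y ∈ {y | Relation.ReflTransGen (ChainStep r (T c)) x y}, ball y (r / 2) := by
      ext z; simp [hV]
    rw [this]
    exact isOpen_biUnion fun _ _ => isOpen_ball
  · refine eq_univ_of_forall fun x => ?_
    obtain ⟨c, hc⟩ := mem_iUnion.1 (hTc.ge (mem_univ x))
    exact mem_sUnion.2 ⟨V c x, ⟨c, x, hc, rfl⟩, x, .refl, by simpa using hr0⟩
  · rintro _ ⟨c, x, hx, rfl⟩
    obtain ⟨u, hu, hxu⟩ := hLeb x (mem_univ x)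
    refine ⟨u, hu, fun z hz => hxu ?_⟩
    obtain ⟨y, hy, hzy⟩ := hz
    have := hT c x y hy
    rw [mem_ball']
    linarith [dist_triangle_right x z y]
  · intro z
    have huniq : ∀ c, ∀ x ∈ T c, ∀ x' ∈ T c, z ∈ V c x → z ∈ V c x' → V c x = V c x' := by
      rintro c x hx x' hx' ⟨y, hy, hzy⟩ ⟨y', hy', hzy'⟩
      have hyy : ChainStep r (T c) y y' := ⟨ChainStep.mem_of_mem hy hx, ChainStep.mem_of_mem hy' hx',
        by linarith [dist_triangle_left y y' z]⟩
      have hxx : Relation.ReflTransGen (ChainStep r (T c)) x x' :=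
        (hy.tail hyy).trans (ChainStep.reflTransGen_symm hy')
      ext w
      exact ⟨fun ⟨a, ha, hw⟩ => ⟨a, (ChainStep.reflTransGen_symm hxx).trans ha, hw⟩,
        fun ⟨a, ha, hw⟩ => ⟨a, hxx.trans ha, hw⟩⟩
    have hsub : {v | v ∈ {v | ∃ c, ∃ x ∈ T c, v = V c x} ∧ z ∈ v} ⊆
        ⋃ c : Fin 3, {v | (∃ x ∈ T c, v = V c x) ∧ z ∈ v} := by
      rintro v ⟨⟨c, h⟩, hz⟩
      exact mem_iUnion.2 ⟨c, h, hz⟩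
    have hone : ∀ c, {v | (∃ x ∈ T c, v = V c x) ∧ z ∈ v}.encard ≤ 1 := by
      intro c
      rw [encard_le_one_iff]
      rintro _ _ ⟨⟨x, hx, rfl⟩, hz⟩ ⟨⟨x', hx', rfl⟩, hz'⟩
      exact huniq c x hx x' hx' hz hz'
    refine (encard_le_encard hsub).trans ?_
    have h3 : (⋃ c : Fin 3, {v | (∃ x ∈ T c, v = V c x) ∧ z ∈ v}) =
        {v | (∃ x ∈ T 0, v = V 0 x) ∧ z ∈ v} ∪ {v | (∃ x ∈ T 1, v = V 1 x) ∧ z ∈ v} ∪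
        {v | (∃ x ∈ T 2, v = V 2 x) ∧ z ∈ v} := by
      ext v; simp [Fin.exists_fin_succ, or_and_right, or_assoc]
    rw [h3]
    refine (encard_union_le _ _).trans ?_
    refine (add_le_add ((encard_union_le _ _).trans (add_le_add (hone 0) (hone 1))) (hone 2)).trans ?_
    norm_num

theorem exists_almost_isometry {X Y : Type} [MetricSpace X] [CompactSpace X] [Nonempty X]
    [MetricSpace Y] [CompactSpace Y] [Nonempty Y] {r : ℝ} (h : ghDist X Y < r) :
    ∃ φ : X → Y, ∀ x y, |dist (φ x) (φ y) - dist x y| < 2 * r := by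
  obtain ⟨Φ, Ψ, hΦ, hΨ, hd⟩ := ghDist_eq_hausdorffDist X Y
  rw [hd] at h
  have hfin : hausdorffEDist (range Φ) (range Ψ) ≠ ⊤ :=
    hausdorffEDist_ne_top_of_nonempty_of_bounded (range_nonempty _) (range_nonempty _)
      (isCompact_range hΦ.continuous).isBounded (isCompact_range hΨ.continuous).isBounded
  have : ∀ x, ∃ y, dist (Φ x) (Ψ y) < r := fun x => by
    obtain ⟨_, ⟨y, rfl⟩, hy⟩ := exists_dist_lt_of_hausdorffDist_lt (mem_range_self x) h hfin
    exact ⟨y, hy⟩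
  choose φ hφ using this
  refine ⟨φ, fun x y => ?_⟩
  rw [← hΨ.dist_eq, ← hΦ.dist_eq]
  have h1 := dist_triangle4 (Ψ (φ x)) (Φ x) (Φ y) (Ψ (φ y))
  have h2 := dist_triangle4 (Φ x) (Ψ (φ x)) (Ψ (φ y)) (Φ y)
  rw [dist_comm (Ψ (φ x)) (Φ x)] at h1
  rw [dist_comm (Ψ (φ y)) (Φ y)] at h2
  rw [abs_lt]
  constructor <;> linarith [hφ x, hφ y]

theorem BipartiteConfig.of_homeomorph {X Y : Type*} [TopologicalSpace X] [TopologicalSpace Y] {p : ℕ}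
    (e : X ≃ₜ Y) (h : BipartiteConfig p X) : BipartiteConfig p Y := by
  obtain ⟨a, u, O, h1, h2⟩ := h
  refine ⟨e ∘ a, e ∘ u, fun i k => e '' O i k, fun i k => ?_, fun i j k l hij hkl => ?_⟩
  · obtain ⟨h3, h4, h5, h6⟩ := h1 i k
    exact ⟨e.isOpenMap _ h3, h4.image _ e.continuous.continuousOn, mem_image_of_mem _ h5,
      mem_image_of_mem _ h6⟩
  · exact (disjoint_image_iff e.injective).2 (h2 i j k l hij hkl)

theorem coveringDimLE_two_of_limit {X : Type} [MetricSpace X] [CompactSpace X] [Nonempty X]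
    {p : ℕ} {K : ℕ → GHSpace} (hlen : ∀ n, IsLengthSpace (K n).Rep)
    (hK : ∀ n, ¬ BipartiteConfig p (K n).Rep)
    (hconv : Tendsto K atTop (𝓝 (toGHSpace X))) : CoveringDimLE X 2 := by
  refine coveringDimLE_two_of_coarse (D := 2 * coarseConst p + 1) fun r hr => ?_
  obtain ⟨n, hn⟩ := ((Metric.tendsto_nhds.1 hconv) (r / 2) (half_pos hr)).exists
  have hgh : ghDist X (K n).Rep < r / 2 := by
    rw [ghDist, GHSpace.toGHSpace_rep, dist_comm]; exact hn
  obtain ⟨φ, hφ⟩ := exists_almost_isometry hgh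
  obtain ⟨T, hT, hTc⟩ := exists_coarse_cover (hlen n).hasAlmostGeodesics (hK n)
    (show 0 < 2 * r by linarith)
  refine ⟨fun c => φ ⁻¹' T c, fun c x y hxy => ?_, ?_⟩
  · have hchain : Relation.ReflTransGen (ChainStep (2 * r) (T c)) (φ x) (φ y) := by
      refine hxy.lift φ fun a b hab => ⟨hab.1, hab.2.1, ?_⟩
      have := (abs_lt.1 (hφ a b)).2
      linarith [hab.2.2]
    have h1 := hT c _ _ hchain
    have h2 := (abs_lt.1 (hφ x y)).1
    linarith
  · rw [← preimage_iUnion, hTc, preimage_univ]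

end Transfer

/-! ## Logarithmic variation and the crossing number of two plane curves -/

section Variation

theorem eq_of_cexp_eq {A : Type*} [TopologicalSpace A] [PreconnectedSpace A] {D : A → ℂ}
    (hD : Continuous D) (h : ∀ a b, Complex.exp (D a) = Complex.exp (D b)) (a b : A) :
    D a = D b := by
  have hloc : IsLocallyConstant D := by
    rw [IsLocallyConstant.iff_eventually_eq]
    intro x
    filter_upwards [hD.continuousAt.eventually (Metric.ball_mem_nhds (D x) Real.pi_pos)] with y hy
    change dist (D y) (D x) < Real.pi at hy
    obtain ⟨n, hn⟩ := Complex.exp_eq_exp_iff_exists_int.1 (h y x)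
    rw [dist_eq_norm, hn, add_sub_cancel_left] at hy
    simp only [norm_mul, Complex.norm_intCast, Complex.norm_ofNat, Complex.norm_real, Complex.norm_I,
      mul_one, Real.norm_eq_abs, abs_of_pos Real.pi_pos] at hy
    have h1 : |(n : ℝ)| < 1 := by nlinarith [Real.pi_pos]
    have h2 : |n| < 1 := by exact_mod_cast h1
    have : n = 0 := Int.abs_lt_one_iff.1 h2
    simpa [this] using hn
  exact hloc.apply_eq_of_preconnectedSpace a b

theorem exists_continuous_log {A : Type*} [TopologicalSpace A] [SimplyConnectedSpace A]
    [LocallyPathConnectedSpace A] {f : A → ℂ} (hf : Continuous f) (h0 : ∀ a, f a ≠ 0) :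
    ∃ L : A → ℂ, Continuous L ∧ ∀ a, Complex.exp (L a) = f a := by
  obtain ⟨a₀⟩ : Nonempty A := inferInstance
  obtain ⟨F, ⟨-, hF⟩, -⟩ := Complex.isCoveringMapOn_exp.existsUnique_continuousMap_lifts
    (f := ⟨f, hf⟩) (a₀ := a₀) (e₀ := Complex.log (f a₀)) (Complex.exp_log (h0 a₀))
    (fun a => by simpa using h0 a)
  exact ⟨F, F.continuous, fun a => congrFun hF a⟩

theorem exists_continuous_log_unitInterval {f : I → ℂ} (hf : Continuous f) (h0 : ∀ a, f a ≠ 0) :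
    ∃ L : I → ℂ, Continuous L ∧ ∀ a, Complex.exp (L a) = f a := by
  obtain ⟨L, hL, hexp⟩ := exists_continuous_log (f := fun t : ℝ => f (projIcc 0 1 zero_le_one t))
    (hf.comp continuous_projIcc) (fun a => h0 _)
  exact ⟨fun t => L t, hL.comp continuous_subtype_val, fun a => by simp [hexp]⟩

open Classical in
/-- The variation of a continuous logarithm of `f` along the unit interval. -/
noncomputable def logVar (f : I → ℂ) : ℂ :=
  if h : ∃ L : I → ℂ, Continuous L ∧ ∀ t, Complex.exp (L t) = f t then h.choose 1 - h.choose 0 else 0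

theorem logVar_eq {f L : I → ℂ} (hL : Continuous L) (h : ∀ t, Complex.exp (L t) = f t) :
    logVar f = L 1 - L 0 := by
  have hex : ∃ L : I → ℂ, Continuous L ∧ ∀ t, Complex.exp (L t) = f t := ⟨L, hL, h⟩
  rw [logVar, dif_pos hex]
  have hne : ∀ t, f t ≠ 0 := fun t => h t ▸ Complex.exp_ne_zero _
  have := eq_of_cexp_eq (hex.choose_spec.1.sub hL) (fun a b => by
    simp only [Pi.sub_apply, Complex.exp_sub, hex.choose_spec.2, h, div_self (hne _)]) 1 0
  simp only [Pi.sub_apply] at this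
  linear_combination this

theorem exp_logVar {f : I → ℂ} (hf : Continuous f) (h0 : ∀ t, f t ≠ 0) :
    Complex.exp (logVar f) = f 1 / f 0 := by
  obtain ⟨L, hL, h⟩ := exists_continuous_log_unitInterval hf h0
  rw [logVar_eq hL h, Complex.exp_sub, h, h]

theorem logVar_of_slitPlane {f : I → ℂ} (hf : Continuous f) (h0 : f 0 ≠ 0)
    (h : ∀ t, f t / f 0 ∈ Complex.slitPlane) : logVar f = Complex.log (f 1 / f 0) := by
  have hL : Continuous fun t => Complex.log (f t / f 0) + Complex.log (f 0) :=
    ((hf.div_const _).clog h).add continuous_const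
  rw [logVar_eq hL fun t => ?_]
  · simp [h0]
  · rw [Complex.exp_add, Complex.exp_log h0, Complex.exp_log (Complex.slitPlane_ne_zero (h t)),
      div_mul_cancel₀ _ h0]

theorem logVar_const (z : ℂ) : logVar (fun _ => z) = 0 := by
  by_cases hz : z = 0
  · rw [logVar, dif_neg]
    rintro ⟨L, -, h⟩
    exact Complex.exp_ne_zero _ ((h 0).trans hz)
  · rw [logVar_eq (L := fun _ => Complex.log z) continuous_const fun t => Complex.exp_log hz, sub_self]

theorem logVar_eq_of_real {f : I → ℂ} {L : ℝ → ℂ} (hL : Continuous L) (a : ℝ)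
    (h : ∀ t : I, Complex.exp (L (a + t)) = f t) : logVar f = L (a + 1) - L a := by
  rw [logVar_eq (L := fun t : I => L (a + t)) (by fun_prop) h]; simp

theorem logVar_eq_of_real_rev {f : I → ℂ} {L : ℝ → ℂ} (hL : Continuous L) (a : ℝ)
    (h : ∀ t : I, Complex.exp (L (a + 1 - t)) = f t) : logVar f = L a - L (a + 1) := by
  rw [logVar_eq (L := fun t : I => L (a + 1 - t)) (by fun_prop) h]; simp

theorem logVar_eq_of_real_neg {f : I → ℂ} {L : ℝ → ℂ} (hL : Continuous L) (a : ℝ)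
    (h : ∀ t : I, Complex.exp (L (a + t)) = - f t) : logVar f = L (a + 1) - L a := by
  rw [logVar_eq (L := fun t : I => L (a + t) + Real.pi * Complex.I) (by fun_prop) fun t => ?_]
  · simp
  · rw [Complex.exp_add, h, Complex.exp_pi_mul_I]; ring

theorem logVar_eq_of_real_rev_neg {f : I → ℂ} {L : ℝ → ℂ} (hL : Continuous L) (a : ℝ)
    (h : ∀ t : I, Complex.exp (L (a + 1 - t)) = - f t) : logVar f = L a - L (a + 1) := by
  rw [logVar_eq (L := fun t : I => L (a + 1 - t) + Real.pi * Complex.I) (by fun_prop) fun t => ?_]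
  · simp
  · rw [Complex.exp_add, h, Complex.exp_pi_mul_I]; ring

/-- A complex number is a period if it is an integral multiple of `2 * π * I`. -/
def IsPeriod (w : ℂ) : Prop := ∃ n : ℤ, w = n * (2 * Real.pi * Complex.I)

open Classical in
/-- The parity of a period. -/
noncomputable def periodParity (w : ℂ) : ZMod 2 := if h : IsPeriod w then (h.choose : ZMod 2) else 0

theorem periodParity_eq {w : ℂ} {n : ℤ} (h : w = n * (2 * Real.pi * Complex.I)) :
    periodParity w = n := by
  have hw : IsPeriod w := ⟨n, h⟩
  rw [periodParity, dif_pos hw]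
  have h1 := hw.choose_spec.symm.trans h
  have h2 := mul_right_cancel₀ Complex.two_pi_I_ne_zero h1
  have h3 : hw.choose = n := by exact_mod_cast h2
  rw [h3]

theorem isPeriod_iff {w : ℂ} : IsPeriod w ↔ Complex.exp w = 1 := Complex.exp_eq_one_iff.symm

theorem IsPeriod.neg {w : ℂ} (h : IsPeriod w) : IsPeriod (-w) := by
  obtain ⟨n, rfl⟩ := h
  exact ⟨-n, by push_cast; ring⟩

theorem periodParity_neg (w : ℂ) : periodParity (-w) = periodParity w := by
  by_cases h : IsPeriod w
  · obtain ⟨n, hn⟩ := h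
    rw [periodParity_eq hn, periodParity_eq (n := -n) (by rw [hn]; push_cast; ring)]
    push_cast
    exact ZMod.neg_eq_self_mod_two _
  · rw [periodParity, periodParity, dif_neg h, dif_neg fun h' => h (by simpa using h'.neg)]

theorem periodParity_zero : periodParity 0 = 0 := by
  simpa using periodParity_eq (w := 0) (n := 0) (by simp)

theorem periodParity_add {w z : ℂ} (hw : IsPeriod w) (hz : IsPeriod z) :
    periodParity (w + z) = periodParity w + periodParity z := by
  obtain ⟨n, hn⟩ := hw
  obtain ⟨m, hm⟩ := hz
  rw [periodParity_eq hn, periodParity_eq hm,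
    periodParity_eq (n := n + m) (by rw [hn, hm]; push_cast; ring)]
  push_cast; rfl

theorem IsPeriod.add {w z : ℂ} (hw : IsPeriod w) (hz : IsPeriod z) : IsPeriod (w + z) := by
  obtain ⟨n, hn⟩ := hw
  obtain ⟨m, hm⟩ := hz
  exact ⟨n + m, by rw [hn, hm]; push_cast; ring⟩

theorem periodParity_list_sum (l : List ℂ) (h : ∀ w ∈ l, IsPeriod w) :
    IsPeriod l.sum ∧ periodParity l.sum = (l.map periodParity).sum := by
  induction l with
  | nil => exact ⟨⟨0, by simp⟩, by simp [periodParity_zero]⟩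
  | cons a l ih =>
    have h1 := ih fun w hw => h w (List.mem_cons_of_mem _ hw)
    have h2 := h a List.mem_cons_self
    simp only [List.sum_cons, List.map_cons]
    exact ⟨h2.add h1.1, by rw [periodParity_add h2 h1.1, h1.2]⟩

/-- The endpoints of each of two curves lie off the other curve. -/
def EndsApart {α : Type*} (s t : I → α) : Prop :=
  (∀ r, s r ≠ t 0 ∧ s r ≠ t 1) ∧ ∀ r, t r ≠ s 0 ∧ t r ≠ s 1

theorem EndsApart.symm {α : Type*} {s t : I → α} (h : EndsApart s t) : EndsApart t s := ⟨h.2, h.1⟩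

theorem EndsApart.comp {α β : Type*} {s t : I → α} (h : EndsApart s t) {E : Set α} {φ : α → β}
    (hφ : InjOn φ E) (hs : ∀ r, s r ∈ E) (ht : ∀ r, t r ∈ E) :
    EndsApart (φ ∘ s) (φ ∘ t) :=
  ⟨fun r => ⟨fun e => (h.1 r).1 (hφ (hs _) (ht _) e), fun e => (h.1 r).2 (hφ (hs _) (ht _) e)⟩,
    fun r => ⟨fun e => (h.2 r).1 (hφ (ht _) (hs _) e), fun e => (h.2 r).2 (hφ (ht _) (hs _) e)⟩⟩

/-- The rotation of the difference of two plane curves around the boundary of the square. -/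
noncomputable def crossing (s t : I → ℂ) : ℂ :=
  logVar (fun r => s r - t 0) + logVar (fun r => t r - s 1) - logVar (fun r => s r - t 1) -
    logVar (fun r => t r - s 0)

theorem crossing_symm (s t : I → ℂ) : crossing t s = - crossing s t := by
  unfold crossing; ring

theorem crossing_isPeriod {s t : I → ℂ} (hs : Continuous s) (ht : Continuous t)
    (h : EndsApart s t) : IsPeriod (crossing s t) := by
  rw [isPeriod_iff, crossing, Complex.exp_sub, Complex.exp_sub, Complex.exp_add,
    exp_logVar (by fun_prop) fun r => sub_ne_zero.2 (h.1 r).1,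
    exp_logVar (by fun_prop) fun r => sub_ne_zero.2 (h.2 r).2,
    exp_logVar (by fun_prop) fun r => sub_ne_zero.2 (h.1 r).2,
    exp_logVar (by fun_prop) fun r => sub_ne_zero.2 (h.2 r).1]
  have h1 := sub_ne_zero.2 (h.1 0).1
  have h2 := sub_ne_zero.2 (h.1 1).1
  have h3 := sub_ne_zero.2 (h.1 0).2
  have h4 := sub_ne_zero.2 (h.1 1).2
  rw [← neg_sub (s 0) (t 0), ← neg_sub (s 1) (t 0), ← neg_sub (s 0) (t 1), ← neg_sub (s 1) (t 1)]
  field_simp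

/-- The first coordinate of the boundary loop of the square. -/
noncomputable def squareFst (t : ℝ) : I := projIcc 0 1 zero_le_one (min t (3 - t))

/-- The second coordinate of the boundary loop of the square. -/
noncomputable def squareSnd (t : ℝ) : I := projIcc 0 1 zero_le_one (min (t - 1) (4 - t))

theorem continuous_squareFst : Continuous squareFst := continuous_projIcc.comp (by fun_prop)

theorem continuous_squareSnd : Continuous squareSnd := continuous_projIcc.comp (by fun_prop)

theorem squareFst_eq_zero {t : ℝ} (h : t ≤ 0 ∨ 3 ≤ t) : squareFst t = 0 :=
  projIcc_of_le_left _ (by rcases h with h | h; exacts [min_le_of_left_le h, min_le_of_right_le (by linarith)])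

theorem squareFst_eq_one {t : ℝ} (h : 1 ≤ t) (h' : t ≤ 2) : squareFst t = 1 :=
  projIcc_of_right_le _ (le_min h (by linarith))

theorem squareSnd_eq_zero {t : ℝ} (h : t ≤ 1 ∨ 4 ≤ t) : squareSnd t = 0 :=
  projIcc_of_le_left _ (by rcases h with h | h; exacts [min_le_of_left_le (by linarith), min_le_of_right_le (by linarith)])

theorem squareSnd_eq_one {t : ℝ} (h : 2 ≤ t) (h' : t ≤ 3) : squareSnd t = 1 :=
  projIcc_of_right_le _ (le_min (by linarith) (by linarith))

theorem EndsApart.square_ne {α : Type*} {s t : I → α} (h : EndsApart s t) (r : ℝ) :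
    s (squareFst r) ≠ t (squareSnd r) := by
  rcases le_total r 1 with h1 | h1
  · rw [squareSnd_eq_zero (Or.inl h1)]; exact (h.1 _).1
  rcases le_total r 2 with h2 | h2
  · rw [squareFst_eq_one h1 h2]; exact (h.2 _).2.symm
  rcases le_total r 3 with h3 | h3
  · rw [squareSnd_eq_one h2 h3]; exact (h.1 _).2
  · rw [squareFst_eq_zero (Or.inr h3)]; exact (h.2 _).1.symm

theorem crossing_eq {s t : I → ℂ} {L : ℝ → ℂ} (hL : Continuous L)
    (h : ∀ r, Complex.exp (L r) = s (squareFst r) - t (squareSnd r)) :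
    crossing s t = L 4 - L 0 := by
  have e1 : logVar (fun r => s r - t 0) = L (0 + 1) - L 0 := logVar_eq_of_real hL 0 fun r => by
    have hr := r.2
    rw [h, squareSnd_eq_zero (Or.inl (by linarith [hr.2])), squareFst,
      min_eq_left (by linarith [hr.2]), zero_add, projIcc_val]
  have e2 : logVar (fun r => t r - s 1) = L (1 + 1) - L 1 := logVar_eq_of_real_neg hL 1 fun r => by
    have hr := r.2
    rw [h, squareFst_eq_one (by linarith [hr.1]) (by linarith [hr.2]), squareSnd,
      min_eq_left (by linarith [hr.2]), add_sub_cancel_left, projIcc_val]; ring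
  have e3 : logVar (fun r => s r - t 1) = L 2 - L (2 + 1) := logVar_eq_of_real_rev hL 2 fun r => by
    have hr := r.2
    rw [h, squareSnd_eq_one (by linarith [hr.2]) (by linarith [hr.1]), squareFst,
      min_eq_right (by linarith [hr.2]), show (3 - (2 + 1 - (r : ℝ))) = r by ring, projIcc_val]
  have e4 : logVar (fun r => t r - s 0) = L 3 - L (3 + 1) := logVar_eq_of_real_rev_neg hL 3 fun r => by
    have hr := r.2
    rw [h, squareFst_eq_zero (Or.inr (by linarith [hr.2])), squareSnd,
      min_eq_right (by linarith [hr.2]), show (4 - (3 + 1 - (r : ℝ))) = r by ring, projIcc_val]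
    ring
  rw [crossing, e1, e2, e3, e4]
  norm_num

theorem crossing_eq_zero_of_disjoint {s t : I → ℂ} (hs : Continuous s) (ht : Continuous t)
    (h : ∀ a b, s a ≠ t b) : crossing s t = 0 := by
  obtain ⟨L, hL, hexp⟩ := exists_continuous_log (A := ℝ × ℝ)
    (f := fun p => s (projIcc 0 1 zero_le_one p.1) - t (projIcc 0 1 zero_le_one p.2))
    ((hs.comp (continuous_projIcc.comp continuous_fst)).sub
      (ht.comp (continuous_projIcc.comp continuous_snd))) fun p => sub_ne_zero.2 (h _ _)
  rw [crossing_eq (L := fun r => L (squareFst r, squareSnd r))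
    (hL.comp ((continuous_subtype_val.comp continuous_squareFst).prodMk
      (continuous_subtype_val.comp continuous_squareSnd))) (fun r => by simp [hexp]),
    squareFst_eq_zero (Or.inr (by norm_num)), squareFst_eq_zero (Or.inl le_rfl),
    squareSnd_eq_zero (Or.inr le_rfl), squareSnd_eq_zero (Or.inl zero_le_one), sub_self]

end Variation

section ChartIndependence

/-- The logarithmic rotation of an odd antiperiodic function along half a turn is an odd multiple
of half a turn. -/
theorem exists_odd_rotation {L : ℝ → ℂ} (hL : Continuous L)
    (h : ∀ r, Complex.exp (L (r + Real.pi)) = - Complex.exp (L r)) :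
    ∃ m : ℤ, ∀ (n : ℤ) (r : ℝ),
      L (r + n * (2 * Real.pi)) - L r = (n * (2 * m + 1) : ℤ) * (2 * Real.pi * Complex.I) := by
  have hconst : ∀ a b, L (a + Real.pi) - L a = L (b + Real.pi) - L b :=
    eq_of_cexp_eq (D := fun r => L (r + Real.pi) - L r) (by fun_prop) fun a b => by
      simp only [Complex.exp_sub, h]
      rw [neg_div, neg_div, div_self (Complex.exp_ne_zero _), div_self (Complex.exp_ne_zero _)]
  have h0 : Complex.exp (L (0 + Real.pi) - L 0) = Complex.exp (Real.pi * Complex.I) := by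
    rw [Complex.exp_sub, h, neg_div, div_self (Complex.exp_ne_zero _), Complex.exp_pi_mul_I]
  obtain ⟨m, hm⟩ := Complex.exp_eq_exp_iff_exists_int.1 h0
  have hstep : ∀ r, L (r + 2 * Real.pi) = L r + (2 * m + 1) * (2 * Real.pi * Complex.I) := by
    intro r
    have h1 := hconst r 0
    have h2 := hconst (r + Real.pi) 0
    rw [show r + Real.pi + Real.pi = r + 2 * Real.pi by ring] at h2
    linear_combination h1 + h2 + 2 * hm
  refine ⟨m, fun n => ?_⟩
  induction n using Int.induction_on with
  | zero => simp
  | succ k ih =>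
    intro r
    have h1 := ih r
    have h2 := hstep (r + k * (2 * Real.pi))
    push_cast at h1 ⊢
    rw [show r + ((k : ℝ) + 1) * (2 * Real.pi) = r + k * (2 * Real.pi) + 2 * Real.pi by ring, h2]
    linear_combination h1
  | pred k ih =>
    intro r
    have h1 := ih r
    have h2 := hstep (r + (-(k : ℝ) - 1) * (2 * Real.pi))
    push_cast at h1 ⊢
    rw [show r + (-(k : ℝ) - 1) * (2 * Real.pi) + 2 * Real.pi = r + -(k : ℝ) * (2 * Real.pi) by ring]
      at h2
    linear_combination h1 - h2

theorem exp_im_mul_I (z : ℂ) : Complex.exp (z.im * Complex.I) * ‖Complex.exp z‖ = Complex.exp z := by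
  conv_rhs => rw [← Complex.re_add_im z, Complex.exp_add]
  rw [Complex.norm_exp, Complex.ofReal_exp, mul_comm]

/-- The parity of the crossing number does not change under embeddings of convex sets with
nonempty interior. -/
theorem periodParity_crossing_comp {E : Set ℂ} (hE : Convex ℝ E) (hE₀ : (interior E).Nonempty)
    {φ : ℂ → ℂ} (hφ : ContinuousOn φ E) (hinj : InjOn φ E) {s t : I → ℂ} (hs : Continuous s)
    (ht : Continuous t) (hsE : ∀ r, s r ∈ E) (htE : ∀ r, t r ∈ E) (h : EndsApart s t) :
    periodParity (crossing (φ ∘ s) (φ ∘ t)) = periodParity (crossing s t) := by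
  obtain ⟨c, hc⟩ := hE₀
  obtain ⟨ε, hε, hball⟩ := Metric.isOpen_iff.1 isOpen_interior c hc
  have hE' : ∀ v : ℂ, ‖v‖ = 1 → c + (ε / 2 : ℝ) * v ∈ E := fun v hv =>
    interior_subset (hball (by
      rw [Metric.mem_ball, dist_eq_norm, add_sub_cancel_left, norm_mul, hv, Complex.norm_real,
        Real.norm_eq_abs, abs_of_pos (by positivity)]; linarith))
  have hx : Continuous fun r => s (squareFst r) := hs.comp continuous_squareFst
  have hy : Continuous fun r => t (squareSnd r) := ht.comp continuous_squareSnd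
  obtain ⟨ℓ, hℓ, hexp⟩ := exists_continuous_log (hx.sub hy) fun r => sub_ne_zero.2 (h.square_ne r)
  have hW : crossing s t = ℓ 4 - ℓ 0 := crossing_eq hℓ hexp
  set v : ℝ → ℂ := fun r => Complex.exp ((ℓ r).im * Complex.I) with hv
  have hvc : Continuous v := by fun_prop
  have hv1 : ∀ r, ‖v r‖ = 1 := fun r => Complex.norm_exp_ofReal_mul_I _
  have hvx : ∀ r, s (squareFst r) - t (squareSnd r) = ‖Complex.exp (ℓ r)‖ * v r := fun r => by
    rw [mul_comm, exp_im_mul_I]; exact (hexp r).symm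
  set κ : ℝ → ℝ := fun k => (projIcc (0 : ℝ) 1 zero_le_one k : ℝ) with hκ
  have hκc : Continuous κ := continuous_subtype_val.comp continuous_projIcc
  have hκ0 : ∀ k, 0 ≤ κ k := fun k => (projIcc (0 : ℝ) 1 zero_le_one k).2.1
  have hκ1 : ∀ k, 0 ≤ 1 - κ k := fun k => sub_nonneg.2 (projIcc (0 : ℝ) 1 zero_le_one k).2.2
  set X : ℝ × ℝ → ℂ := fun p =>
    (1 - κ p.1) • s (squareFst p.2) + κ p.1 • (c + (ε / 2 : ℝ) * v p.2) with hX
  set Y : ℝ × ℝ → ℂ := fun p =>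
    (1 - κ p.1) • t (squareSnd p.2) + κ p.1 • (c + (ε / 2 : ℝ) * -v p.2) with hY
  have hXE : ∀ p, X p ∈ E := fun p => hE (hsE _) (hE' _ (hv1 _)) (hκ1 _) (hκ0 _) (by ring)
  have hYE : ∀ p, Y p ∈ E := fun p =>
    hE (htE _) (hE' _ (by rw [norm_neg, hv1])) (hκ1 _) (hκ0 _) (by ring)
  have hXc : Continuous X := by
    have h1 := hx.comp (continuous_snd (X := ℝ) (Y := ℝ))
    have h2 : Continuous fun p : ℝ × ℝ => c + (ε / 2 : ℝ) * v p.2 := by fun_prop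
    have h3 : Continuous fun p : ℝ × ℝ => κ p.1 := by fun_prop
    exact ((continuous_const.sub h3).smul h1).add (h3.smul h2)
  have hYc : Continuous Y := by
    have h1 := hy.comp (continuous_snd (X := ℝ) (Y := ℝ))
    have h2 : Continuous fun p : ℝ × ℝ => c + (ε / 2 : ℝ) * -v p.2 := by fun_prop
    have h3 : Continuous fun p : ℝ × ℝ => κ p.1 := by fun_prop
    exact ((continuous_const.sub h3).smul h1).add (h3.smul h2)
  have hXY : ∀ p, X p ≠ Y p := by
    intro p hp
    have h1 : X p - Y p = ((1 - κ p.1) * ‖Complex.exp (ℓ p.2)‖ + κ p.1 * ε : ℝ) * v p.2 := by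
      have := hvx p.2
      simp only [hX, hY, Complex.real_smul]; push_cast
      linear_combination (1 - (κ p.1 : ℂ)) * this
    rw [hp, sub_self, eq_comm, mul_eq_zero] at h1
    rcases h1 with h1 | h1
    · have h2 : 0 < ‖Complex.exp (ℓ p.2)‖ := norm_pos_iff.2 (Complex.exp_ne_zero _)
      have h3 := hκ0 p.1
      have h4 := hκ1 p.1
      have h5 : (1 - κ p.1) * ‖Complex.exp (ℓ p.2)‖ + κ p.1 * ε = 0 := by exact_mod_cast h1
      have h6 := mul_nonneg h4 h2.le
      have h7 := mul_nonneg h3 hε.le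
      have h8 : (1 - κ p.1) * ‖Complex.exp (ℓ p.2)‖ = 0 := by linarith
      have h9 : κ p.1 * ε = 0 := by linarith
      rcases mul_eq_zero.1 h8 with h | h
      · rcases mul_eq_zero.1 h9 with h' | h' <;> linarith
      · exact h2.ne' h
    · exact Complex.exp_ne_zero _ h1
  obtain ⟨L, hL, hLexp⟩ := exists_continuous_log (A := ℝ × ℝ)
    ((hφ.comp_continuous hXc hXE).sub (hφ.comp_continuous hYc hYE))
    (fun p => sub_ne_zero.2 fun e => hXY p (hinj (hXE p) (hYE p) e))
  have hv04 : v 4 = v 0 := by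
    have h1 := hexp 4
    have h2 := hexp 0
    simp only [Pi.sub_apply] at h1 h2
    rw [squareFst_eq_zero (Or.inr (by norm_num)), squareSnd_eq_zero (Or.inr le_rfl)] at h1
    rw [squareFst_eq_zero (Or.inl le_rfl), squareSnd_eq_zero (Or.inl zero_le_one)] at h2
    have h3 := exp_im_mul_I (ℓ 4)
    have h4 := exp_im_mul_I (ℓ 0)
    rw [h1.trans h2.symm] at h3
    refine mul_right_cancel₀ ?_ (h3.trans h4.symm)
    exact_mod_cast norm_ne_zero_iff.2 (Complex.exp_ne_zero _)
  have hclosed : ∀ k, Complex.exp (L (k, 4)) = Complex.exp (L (k, 0)) := by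
    intro k
    rw [hLexp, hLexp]
    simp only [hX, hY, Pi.sub_apply, Function.comp_apply, hv04]
    rw [squareFst_eq_zero (Or.inr (by norm_num)), squareSnd_eq_zero (Or.inr le_rfl),
      squareFst_eq_zero (Or.inl le_rfl), squareSnd_eq_zero (Or.inl zero_le_one)]
  have hconst : L (0, 4) - L (0, 0) = L (1, 4) - L (1, 0) :=
    eq_of_cexp_eq (D := fun k => L (k, 4) - L (k, 0)) (by fun_prop) (fun a b => by
      simp only [Complex.exp_sub, hclosed, div_self (Complex.exp_ne_zero _)]) 0 1
  have hW' : crossing (φ ∘ s) (φ ∘ t) = L (0, 4) - L (0, 0) :=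
    crossing_eq (L := fun r => L (0, r)) (by fun_prop) fun r => by
      rw [hLexp]; simp [hX, hY, hκ]
  set P : ℝ → ℂ := fun θ => c + (ε / 2 : ℝ) * Complex.exp (θ * Complex.I) with hP
  set Q : ℝ → ℂ := fun θ => c + (ε / 2 : ℝ) * -Complex.exp (θ * Complex.I) with hQ
  have hPE : ∀ θ, P θ ∈ E := fun θ => hE' _ (Complex.norm_exp_ofReal_mul_I _)
  have hQE : ∀ θ, Q θ ∈ E := fun θ => hE' _ (by rw [norm_neg]; exact Complex.norm_exp_ofReal_mul_I _)
  obtain ⟨Λ, hΛ, hΛexp⟩ := exists_continuous_log (A := ℝ)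
    ((hφ.comp_continuous (by fun_prop : Continuous P) hPE).sub
      (hφ.comp_continuous (by fun_prop : Continuous Q) hQE)) (fun θ => sub_ne_zero.2 fun e => by
        have h1 := hinj (hPE θ) (hQE θ) e
        simp only [hP, hQ, add_right_inj, mul_neg, self_eq_neg] at h1
        rcases mul_eq_zero.1 h1 with h1 | h1
        · have : ε / 2 = 0 := by exact_mod_cast h1
          linarith
        · exact Complex.exp_ne_zero _ h1)
  have hanti : ∀ r, Complex.exp (Λ (r + Real.pi)) = - Complex.exp (Λ r) := by
    intro r
    have h1 : Complex.exp ((r + Real.pi : ℝ) * Complex.I) = - Complex.exp (r * Complex.I) := by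
      push_cast; rw [add_mul, Complex.exp_add, Complex.exp_pi_mul_I]; ring
    rw [hΛexp, hΛexp]
    have h2 : P (r + Real.pi) = Q r := by simp only [hP, hQ, h1]
    have h3 : Q (r + Real.pi) = P r := by simp only [hP, hQ, h1, neg_neg]
    simp only [Pi.sub_apply, Function.comp_apply, h2, h3, neg_sub]
  have hend : L (1, 4) - L (1, 0) = Λ (ℓ 4).im - Λ (ℓ 0).im := by
    have := eq_of_cexp_eq (D := fun r => L (1, r) - Λ (ℓ r).im) (by fun_prop) (fun a b => by
      have : ∀ r, Complex.exp (L (1, r)) = Complex.exp (Λ (ℓ r).im) := by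
        intro r
        rw [hLexp, hΛexp]; simp [hX, hY, hκ, hP, hQ, hv]
      simp only [Complex.exp_sub, this, div_self (Complex.exp_ne_zero _)]) 4 0
    linear_combination this
  obtain ⟨n, hn⟩ := crossing_isPeriod hs ht h
  obtain ⟨m, hm⟩ := exists_odd_rotation hΛ hanti
  have him : (ℓ 4).im = (ℓ 0).im + n * (2 * Real.pi) := by
    have h1 : ℓ 4 = ℓ 0 + n * (2 * Real.pi * Complex.I) := by rw [← hn, hW]; ring
    rw [h1]; simp
  rw [periodParity_eq hn, hW', hconst, hend, him, periodParity_eq (hm n _)]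
  push_cast
  rw [show (2 : ZMod 2) = 0 from rfl]; ring

end ChartIndependence

section Segments

theorem logVar_segment {A B : ℂ} {f : I → ℂ} (hf : ∀ t : I, f t = A + t * (B - A))
    (h : (B / A).im ≠ 0) : logVar f = Complex.log (B / A) := by
  have hA : A ≠ 0 := by rintro rfl; simp at h
  have h0 : f 0 = A := by simp [hf]
  have h1 : f 1 = B := by simp [hf]
  have hfc : Continuous f := by
    rw [show f = fun t : I => A + t * (B - A) from funext hf]; fun_prop
  rw [logVar_of_slitPlane hfc (h0 ▸ hA), h0, h1]
  intro t
  have ht : f t / f 0 = 1 + (t : ℝ) * (B / A - 1) := by rw [h0, hf]; field_simp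
  rw [ht]
  rcases eq_or_ne (t : ℝ) 0 with h' | h'
  · rw [h']; simp
  · refine Or.inr ?_
    simp [h', h]

/-- Two straight segments in a strip whose endpoints are in opposite orders cross once. -/
theorem periodParity_crossing_segments {c ε : ℂ} (hε : ε ≠ 0) {i j a b : ℝ} (hij : i < j)
    (hab : b < a) {s t : I → ℂ}
    (hs : ∀ r : I, s r = c + ε * ((1 - r) * (i + Complex.I) + r * a))
    (ht : ∀ r : I, t r = c + ε * ((1 - r) * (j + Complex.I) + r * b)) (h : EndsApart s t) :
    periodParity (crossing s t) = 1 := by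
  have hsc : Continuous s := by rw [show s = _ from funext hs]; fun_prop
  have htc : Continuous t := by rw [show t = _ from funext ht]; fun_prop
  have s0 : s 0 = c + ε * (i + Complex.I) := by simp [hs]
  have s1 : s 1 = c + ε * a := by simp [hs]
  have t0 : t 0 = c + ε * (j + Complex.I) := by simp [ht]
  have t1 : t 1 = c + ε * b := by simp [ht]
  have key : ∀ A B : ℂ, (ε * B / (ε * A)) = B / A := fun A B => mul_div_mul_left _ _ hε
  have i1 : 0 < ((a - j - Complex.I : ℂ) / (i - j)).im := by
    rw [← Complex.ofReal_sub, ← Complex.ofReal_sub, Complex.div_ofReal_im]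
    simp; rw [neg_div, ← div_neg]; exact div_pos one_pos (by linarith)
  have i2 : 0 < ((b - a : ℂ) / (j - a + Complex.I)).im := by
    rw [Complex.div_im]; simp [Complex.normSq_apply]
    exact div_neg_of_neg_of_pos (by linarith) (by nlinarith [sq_nonneg (j - a)])
  have i3 : ((a - b : ℂ) / (i - b + Complex.I)).im < 0 := by
    rw [Complex.div_im]; simp [Complex.normSq_apply]
    exact div_pos (by linarith) (by nlinarith [sq_nonneg (i - b)])
  have i4 : ((b - i - Complex.I : ℂ) / (j - i)).im < 0 := by
    rw [← Complex.ofReal_sub, ← Complex.ofReal_sub, Complex.div_ofReal_im]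
    simp; rw [neg_div]; exact neg_neg_of_pos (div_pos one_pos (by linarith))
  have e1 : logVar (fun r => s r - t 0) = Complex.log ((a - j - Complex.I) / (i - j)) := by
    rw [logVar_segment (A := ε * (i - j)) (B := ε * (a - j - Complex.I)), key]
    · intro r; rw [hs, t0]; ring
    · rw [key]; exact i1.ne'
  have e2 : logVar (fun r => t r - s 1) = Complex.log ((b - a) / (j - a + Complex.I)) := by
    rw [logVar_segment (A := ε * (j - a + Complex.I)) (B := ε * (b - a)), key]
    · intro r; rw [ht, s1]; ring
    · rw [key]; exact i2.ne'
  have e3 : logVar (fun r => s r - t 1) = Complex.log ((a - b) / (i - b + Complex.I)) := by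
    rw [logVar_segment (A := ε * (i - b + Complex.I)) (B := ε * (a - b)), key]
    · intro r; rw [hs, t1]; ring
    · rw [key]; exact i3.ne
  have e4 : logVar (fun r => t r - s 0) = Complex.log ((b - i - Complex.I) / (j - i)) := by
    rw [logVar_segment (A := ε * (j - i)) (B := ε * (b - i - Complex.I)), key]
    · intro r; rw [ht, s0]; ring
    · rw [key]; exact i4.ne
  obtain ⟨n, hn⟩ := crossing_isPeriod hsc htc h
  have him := congrArg Complex.im hn
  rw [crossing, e1, e2, e3, e4] at him
  simp only [Complex.add_im, Complex.sub_im, Complex.log_im] at him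
  have a1 := Complex.arg_nonneg_iff.2 i1.le
  have a2 := Complex.arg_nonneg_iff.2 i2.le
  have a3 := Complex.arg_neg_iff.2 i3
  have a4 := Complex.arg_neg_iff.2 i4
  have b1 := Complex.arg_lt_pi_iff.2 (Or.inr i1.ne')
  have b2 := Complex.arg_lt_pi_iff.2 (Or.inr i2.ne')
  have b3 := Complex.neg_pi_lt_arg ((a - b : ℂ) / (i - b + Complex.I))
  have b4 := Complex.neg_pi_lt_arg ((b - i - Complex.I : ℂ) / (j - i))
  simp at him
  have n0 : (0 : ℝ) < n := by
    by_contra hn; push Not at hn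
    nlinarith [Real.pi_pos]
  have n2 : (n : ℝ) < 2 := by
    by_contra hn; push Not at hn
    nlinarith [Real.pi_pos]
  have : n = 1 := by
    have h1 : 0 < n := by exact_mod_cast n0
    have h2 : n < 2 := by exact_mod_cast n2
    omega
  rw [periodParity_eq hn, this]; simp

end Segments

/-! ## Convex charts of a surface -/

/-- A chart onto a convex subset of the plane with nonempty interior. -/
structure ConvexChart (S : Type*) [TopologicalSpace S] where
  source : Set S
  toFun : S → ℂ
  invFun : ℂ → S
  isOpen_source : IsOpen source
  continuousOn_toFun : ContinuousOn toFun source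
  continuousOn_invFun : ContinuousOn invFun (toFun '' source)
  left_inv : ∀ x ∈ source, invFun (toFun x) = x
  convex : Convex ℝ (toFun '' source)
  interior_nonempty : (interior (toFun '' source)).Nonempty

namespace ConvexChart

section TopologicalSpace

variable {S : Type*} [TopologicalSpace S] (C : ConvexChart S)

theorem injOn : InjOn C.toFun C.source := fun x hx y hy h => by
  rw [← C.left_inv x hx, ← C.left_inv y hy, h]

theorem image_invFun : C.invFun '' (C.toFun '' C.source) = C.source := by
  rw [image_image]
  ext x
  constructor
  · rintro ⟨y, hy, rfl⟩; simpa only [C.left_inv y hy] using hy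
  · exact fun hx => ⟨x, hx, C.left_inv x hx⟩

theorem isPreconnected : IsPreconnected C.source := by
  rw [← C.image_invFun]
  exact C.convex.isPreconnected.image _ C.continuousOn_invFun

theorem exists_subchart {x : S} (hx : x ∈ C.source) {N : Set S} (hN : N ∈ 𝓝 x) :
    ∃ C' : ConvexChart S, C'.toFun = C.toFun ∧ x ∈ C'.source ∧ C'.source ⊆ C.source ∩ N := by
  have hlim : Tendsto C.invFun (𝓝[C.toFun '' C.source] C.toFun x) (𝓝 x) := by
    have := C.continuousOn_invFun (C.toFun x) (mem_image_of_mem _ hx)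
    rwa [ContinuousWithinAt, C.left_inv x hx] at this
  obtain ⟨ε, hε, hball⟩ := Metric.mem_nhdsWithin_iff.1 (hlim hN)
  have himg : C.toFun '' (C.source ∩ C.toFun ⁻¹' ball (C.toFun x) ε) =
      C.toFun '' C.source ∩ ball (C.toFun x) ε := image_inter_preimage _ _ _
  refine ⟨⟨C.source ∩ C.toFun ⁻¹' ball (C.toFun x) ε, C.toFun, C.invFun, ?_, ?_, ?_, ?_, ?_, ?_⟩,
    rfl, ⟨hx, mem_ball_self hε⟩, fun y hy => ⟨hy.1, ?_⟩⟩
  · exact C.continuousOn_toFun.isOpen_inter_preimage C.isOpen_source isOpen_ball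
  · exact C.continuousOn_toFun.mono inter_subset_left
  · exact C.continuousOn_invFun.mono (image_mono inter_subset_left)
  · exact fun y hy => C.left_inv y hy.1
  · rw [himg]; exact C.convex.inter (convex_ball _ _)
  · rw [himg, interior_inter, isOpen_ball.interior_eq]
    have : C.toFun x ∈ closure (interior (C.toFun '' C.source)) := by
      rw [C.convex.closure_interior_eq_closure_of_nonempty_interior C.interior_nonempty]
      exact subset_closure (mem_image_of_mem _ hx)
    rw [inter_comm]
    exact mem_closure_iff.1 this _ isOpen_ball (mem_ball_self hε)
  · have := hball ⟨hy.2, mem_image_of_mem _ hy.1⟩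
    rwa [mem_preimage, C.left_inv y hy.1] at this

theorem interior_image_nonempty {U : Set S} (hU : IsOpen U) (hne : U.Nonempty)
    (hUC : U ⊆ C.source) : (interior (C.toFun '' U)).Nonempty := by
  obtain ⟨x, hx⟩ := hne
  obtain ⟨C', h1, -, h3⟩ := C.exists_subchart (hUC hx) (hU.mem_nhds hx)
  refine C'.interior_nonempty.mono (interior_mono ?_)
  rw [h1]
  exact image_mono fun y hy => (h3 hy).2

theorem continuous_comp {γ : C(I, S)} (h : range γ ⊆ C.source) : Continuous (C.toFun ∘ γ) :=
  C.continuousOn_toFun.comp_continuous γ.continuous fun t => h (mem_range_self t)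

end TopologicalSpace

end ConvexChart

theorem exists_convexChart_of_isEmbedding {S : Type*} [TopologicalSpace S] {U : Set S}
    (hU : IsOpen U) {f : U → ℂ} (hf : IsEmbedding f) {B : Set ℂ} (hB : IsOpen B)
    (hconv : Convex ℝ (range f ∩ B)) (hE₀ : (interior (range f ∩ B)).Nonempty) {x : S}
    (hx : x ∈ U) (hxB : f ⟨x, hx⟩ ∈ B) : ∃ C : ConvexChart S, x ∈ C.source := by
  have : Nonempty U := ⟨⟨x, hx⟩⟩
  set φ : S → ℂ := Function.extend Subtype.val f 0 with hφ
  have hφf : ∀ u : U, φ u = f u := fun u => Subtype.val_injective.extend_apply f 0 u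
  have hφc : ContinuousOn φ U := by
    rw [continuousOn_iff_continuous_domRestrict]
    rw [show U.domRestrict φ = f from funext hφf]
    exact hf.continuous
  have himg : φ '' (U ∩ φ ⁻¹' B) = range f ∩ B := by
    rw [image_inter_preimage]
    congr 1
    ext z
    constructor
    · rintro ⟨y, hy, rfl⟩; exact ⟨⟨y, hy⟩, (hφf ⟨y, hy⟩).symm⟩
    · rintro ⟨u, rfl⟩; exact ⟨u, u.2, hφf u⟩
  refine ⟨⟨U ∩ φ ⁻¹' B, φ, fun z => (Function.invFun f z : U),
    hφc.isOpen_inter_preimage hU hB, hφc.mono inter_subset_left, ?_, ?_, ?_, ?_⟩, hx, ?_⟩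
  · rw [himg]
    refine continuous_subtype_val.comp_continuousOn ?_
    intro z hz
    rw [ContinuousWithinAt, hf.tendsto_nhds_iff, Function.invFun_eq hz.1]
    refine tendsto_id.mono_left nhdsWithin_le_nhds |>.congr' ?_
    filter_upwards [self_mem_nhdsWithin] with w hw
    exact (Function.invFun_eq hw.1).symm
  · intro y hy
    have : φ y = f ⟨y, hy.1⟩ := hφf ⟨y, hy.1⟩
    rw [this, Function.leftInverse_invFun hf.injective]
  · rwa [himg]
  · rwa [himg]
  · rw [mem_preimage, hφf ⟨x, hx⟩]; exact hxB

theorem IsSurface.exists_convexChart {S : Type*} [TopologicalSpace S] (hS : IsSurface S) (x : S) :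
    ∃ C : ConvexChart S, x ∈ C.source := by
  obtain ⟨U, V, hU, hx, hV, ⟨e⟩⟩ := hS x
  obtain ⟨V', hV', rfl⟩ := isOpen_induced_iff.1 hV
  set f : U → ℂ := fun u => Complex.equivRealProdCLM.symm (e u : HalfPlane) with hf
  have hemb : IsEmbedding f := Complex.equivRealProdCLM.symm.toHomeomorph.isEmbedding.comp
    (IsEmbedding.subtypeVal.comp (IsEmbedding.subtypeVal.comp e.isEmbedding))
  have hW : IsOpen (Complex.equivRealProdCLM ⁻¹' V') :=
    hV'.preimage Complex.equivRealProdCLM.continuous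
  have hrange : range f = {z | 0 ≤ z.im} ∩ Complex.equivRealProdCLM ⁻¹' V' := by
    ext z
    constructor
    · rintro ⟨u, rfl⟩
      refine ⟨(e u : HalfPlane).2, ?_⟩
      simp only [hf, mem_preimage, ContinuousLinearEquiv.apply_symm_apply]
      exact (e u).2
    · rintro ⟨h1, h2⟩
      refine ⟨e.symm ⟨⟨Complex.equivRealProdCLM z, h1⟩, h2⟩, ?_⟩
      simp only [hf, Homeomorph.apply_symm_apply]
      exact Complex.equivRealProdCLM.symm_apply_apply z
  obtain ⟨ε, hε, hball⟩ := Metric.isOpen_iff.1 hW (f ⟨x, hx⟩) (by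
    have := mem_range_self (f := f) ⟨x, hx⟩; rw [hrange] at this; exact this.2)
  have hinter : range f ∩ ball (f ⟨x, hx⟩) ε = {z | 0 ≤ z.im} ∩ ball (f ⟨x, hx⟩) ε := by
    rw [hrange, inter_assoc, inter_eq_right.2 hball]
  refine exists_convexChart_of_isEmbedding hU hemb (isOpen_ball (x := f ⟨x, hx⟩) (ε := ε)) ?_ ?_ hx
    (mem_ball_self hε)
  · rw [hinter]
    exact (convex_halfSpace_im_ge 0).inter (convex_ball _ _)
  · rw [hinter]
    have h0 : 0 ≤ (f ⟨x, hx⟩).im := (e ⟨x, hx⟩ : HalfPlane).2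
    refine ⟨f ⟨x, hx⟩ + (ε / 2 : ℝ) * Complex.I, mem_interior.2 ⟨{z | 0 < z.im} ∩ ball (f ⟨x, hx⟩) ε,
      fun z hz => ⟨(show 0 < z.im from hz.1).le, hz.2⟩,
      (isOpen_lt continuous_const Complex.continuous_im).inter isOpen_ball, ?_, ?_⟩⟩
    · simp only [mem_ofPred_eq, Complex.add_im, Complex.mul_im, Complex.ofReal_re, Complex.I_im,
        Complex.ofReal_im, Complex.I_re]
      linarith
    · rw [mem_ball, dist_eq_norm, add_sub_cancel_left, norm_mul, Complex.norm_I, Complex.norm_real,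
        Real.norm_eq_abs, abs_of_pos (by positivity)]
      linarith

/-! ## Surface atlases with controlled overlaps -/

/-- A finite cover of a surface by connected sets together with charts in which neighbouring
members of the cover can be compared. -/
structure SurfaceAtlas (S : Type*) [TopologicalSpace S] where
  N : ℕ
  G : Fin N → Set S
  ι : Type
  chart : ι → ConvexChart S
  core : ι → Set S
  small : Set (ConvexChart S)
  isOpen_G : ∀ l, IsOpen (G l)
  isPreconnected_G : ∀ l, IsPreconnected (G l)
  exists_mem_G : ∀ x, ∃ l, x ∈ G l
  core_subset : ∀ j, core j ⊆ (chart j).source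
  convex_core : ∀ j, Convex ℝ ((chart j).toFun '' core j)
  exists_core : ∀ l m, (G l ∩ G m).Nonempty → ∃ j, G l ∪ G m ⊆ core j
  exists_small : ∀ l m, (G l ∩ G m).Nonempty → ∃ E ∈ small, G l ∪ G m ⊆ E.source
  G_subset_source : ∀ l j, (G l ∩ core j).Nonempty → G l ⊆ (chart j).source
  small_subset_source : ∀ E ∈ small, ∀ j, (E.source ∩ core j).Nonempty → E.source ⊆ (chart j).source

theorem Finset.exists_pos_forall_le {α : Type*} (T : Finset α) {r : α → ℝ} (hr : ∀ x, 0 < r x) :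
    ∃ r₀ > 0, ∀ x ∈ T, r₀ ≤ r x := by
  classical
  induction T using Finset.induction_on with
  | empty => exact ⟨1, one_pos, by simp⟩
  | insert a T _ ih =>
    obtain ⟨r₀, h0, h⟩ := ih
    refine ⟨min r₀ (r a), lt_min h0 (hr a), fun x hx => ?_⟩
    rcases Finset.mem_insert.1 hx with rfl | hx
    · exact min_le_right _ _
    · exact (min_le_left _ _).trans (h x hx)

theorem IsSurface.nonempty_surfaceAtlas {S : Type} [MetricSpace S] [CompactSpace S]
    (hS : IsSurface S) : Nonempty (SurfaceAtlas S) := by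
  choose D hD using hS.exists_convexChart
  have hr : ∀ x, ∃ r > 0, ball x (2 * r) ⊆ (D x).source := fun x => by
    obtain ⟨ε, hε, h⟩ := Metric.isOpen_iff.1 (D x).isOpen_source x (hD x)
    exact ⟨ε / 2, half_pos hε, by rwa [mul_div_cancel₀ _ two_ne_zero]⟩
  choose r hr0 hrD using hr
  choose D' hD'f hxD' hD' using fun x => (D x).exists_subchart (hD x) (ball_mem_nhds x (hr0 x))
  obtain ⟨T, hT⟩ := isCompact_univ.elim_finite_subcover (fun x => (D' x).source)
    (fun x => (D' x).isOpen_source) fun x _ => mem_iUnion.2 ⟨x, hxD' x⟩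
  obtain ⟨r₀, hr₀, hr₀T⟩ := T.exists_pos_forall_le hr0
  set small : Set (ConvexChart S) := {E | ∀ a ∈ E.source, ∀ b ∈ E.source, dist a b < r₀} with hsm
  have hnear : ∀ (A : Set S) (j : T), (∀ a ∈ A, ∀ b ∈ A, dist a b < r₀) →
      (A ∩ (D' j).source).Nonempty → A ⊆ (D j).source := by
    rintro A ⟨x, hx⟩ hA ⟨z, hzA, hz⟩ a ha
    refine hrD x ?_
    have h1 : dist z x < r x := (hD' x hz).2
    have h2 := hA a ha z hzA
    have h3 := hr₀T x hx
    rw [mem_ball]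
    linarith [dist_triangle a z x]
  have hloc : ∀ (x : S) {ε : ℝ}, 0 < ε → ∃ C : ConvexChart S, x ∈ C.source ∧
      ∀ a ∈ C.source, ∀ b ∈ C.source, dist a b < ε := by
    intro x ε hε
    obtain ⟨C, -, hx, hC⟩ := (D x).exists_subchart (hD x) (ball_mem_nhds x (half_pos hε))
    refine ⟨C, hx, fun a ha b hb => ?_⟩
    have h1 : dist a x < ε / 2 := (hC ha).2
    have h2 : dist b x < ε / 2 := (hC hb).2
    linarith [dist_triangle_right a b x]
  obtain ⟨δ₁, hδ₁, hL₁⟩ := lebesgue_number_lemma_of_metric (ι := T) isCompact_univ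
    (c := fun x => (D' x).source) (fun x => (D' x).isOpen_source)
    (fun z hz => by
      obtain ⟨x, hx, h⟩ := mem_iUnion₂.1 (hT hz)
      exact mem_iUnion.2 ⟨⟨x, hx⟩, h⟩)
  obtain ⟨δ₂, hδ₂, hL₂⟩ := lebesgue_number_lemma_of_metric (ι := small) isCompact_univ
    (c := fun E => E.1.source) (fun E => E.1.isOpen_source)
    (fun z _ => by
      obtain ⟨C, hz, hC⟩ := hloc z hr₀
      exact mem_iUnion.2 ⟨⟨C, hC⟩, hz⟩)
  set δ := min (min δ₁ δ₂) r₀ with hδ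
  have hδ0 : 0 < δ := lt_min (lt_min hδ₁ hδ₂) hr₀
  choose g hg hgd using fun x => hloc x (half_pos hδ0)
  obtain ⟨T', hT'⟩ := isCompact_univ.elim_finite_subcover (fun x => (g x).source)
    (fun x => (g x).isOpen_source) fun x _ => mem_iUnion.2 ⟨x, hg x⟩
  have hunion : ∀ x y, ((g x).source ∩ (g y).source).Nonempty → ∃ z, (g x).source ∪ (g y).source ⊆
      ball z δ := by
    rintro x y ⟨z, hzx, hzy⟩
    refine ⟨z, ?_⟩
    rintro a (ha | ha)
    · exact (hgd x a ha z hzx).trans (half_lt_self hδ0)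
    · exact (hgd y a ha z hzy).trans (half_lt_self hδ0)
  refine ⟨{
    N := T'.card
    G := fun l => (g (T'.equivFin.symm l)).source
    ι := T
    chart := fun j => D j
    core := fun j => (D' j).source
    small := small
    isOpen_G := fun l => (g _).isOpen_source
    isPreconnected_G := fun l => (g _).isPreconnected
    exists_mem_G := fun x => ?_
    core_subset := fun j x hx => (hD' j hx).1
    convex_core := fun j => hD'f j ▸ (D' j).convex
    exists_core := fun l m h => ?_
    exists_small := fun l m h => ?_
    G_subset_source := fun l j h => hnear _ j (fun a ha b hb => ?_) h
    small_subset_source := fun E hE j h => hnear _ j hE h }⟩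
  · obtain ⟨y, hy, h⟩ := mem_iUnion₂.1 (hT' (mem_univ x))
    exact ⟨T'.equivFin ⟨y, hy⟩, by simpa using h⟩
  · obtain ⟨z, hz⟩ := hunion _ _ h
    obtain ⟨j, hj⟩ := hL₁ z (mem_univ z)
    exact ⟨j, hz.trans ((ball_subset_ball ((min_le_left _ _).trans (min_le_left _ _))).trans hj)⟩
  · obtain ⟨z, hz⟩ := hunion _ _ h
    obtain ⟨E, hE⟩ := hL₂ z (mem_univ z)
    exact ⟨E, E.2, hz.trans ((ball_subset_ball ((min_le_left _ _).trans (min_le_right _ _))).trans hE)⟩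
  · exact (hgd _ a ha b hb).trans_le ((half_le_self hδ0.le).trans (min_le_right _ _))

/-! ## Intersection numbers modulo two of curves in a surface -/

section Chains

variable {S : Type*} [TopologicalSpace S]

/-- `L` is a list of consecutive curves leading from `x` to `y`. -/
def CurveChain : S → List C(I, S) → S → Prop
  | x, [], y => x = y
  | x, γ :: L, y => γ 0 = x ∧ CurveChain (γ 1) L y

theorem CurveChain.append {x y z : S} {L L' : List C(I, S)} (h : CurveChain x L y)
    (h' : CurveChain y L' z) : CurveChain x (L ++ L') z := by
  induction L generalizing x with
  | nil => obtain rfl : x = y := h; exact h'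
  | cons γ L ih => exact ⟨h.1, ih h.2⟩

theorem CurveChain.sum_sub {G : Type*} [AddCommGroup G] {x y : S} {L : List C(I, S)}
    (h : CurveChain x L y) (f : S → G) : (L.map fun γ => f (γ 1) - f (γ 0)).sum = f y - f x := by
  induction L generalizing x with
  | nil => obtain rfl : x = y := h; simp
  | cons γ L ih =>
    rw [List.map_cons, List.sum_cons, ih h.2, h.1]
    abel

theorem CurveChain.sum_add {x y : S} {L : List C(I, S)}
    (h : CurveChain x L y) (f : S → ZMod 2) : (L.map fun γ => f (γ 0) + f (γ 1)).sum = f x + f y := by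
  have := h.sum_sub f
  simp only [sub_eq_add_neg, ZMod.neg_eq_self_mod_two] at this
  simpa only [add_comm] using this

/-- A list of curves whose boundary vanishes modulo two. -/
def IsModTwoCycle (C : List C(I, S)) : Prop :=
  ∀ f : S → ZMod 2, (C.map fun c => f (c 0) + f (c 1)).sum = 0

/-- All members of two lists of curves have their endpoints off each other. -/
def ListApart (L C : List C(I, S)) : Prop := ∀ γ ∈ L, ∀ c ∈ C, EndsApart γ c

end Chains

theorem div_sub_mem_slitPlane {K : Set ℂ} (hK : Convex ℝ K) {z k k₀ : ℂ} (hz : z ∉ K) (hk : k ∈ K)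
    (hk₀ : k₀ ∈ K) : (k - z) / (k₀ - z) ∈ Complex.slitPlane := by
  have h0 : k₀ - z ≠ 0 := sub_ne_zero.2 fun h => hz (h ▸ hk₀)
  by_contra hcon
  rw [Complex.mem_slitPlane_iff, not_or, not_lt, not_not] at hcon
  obtain ⟨h1, h2⟩ := hcon
  set r : ℝ := -((k - z) / (k₀ - z)).re with hr
  have hr0 : 0 ≤ r := by linarith
  have h3 : (k - z) / (k₀ - z) = -(r : ℂ) := by
    apply Complex.ext
    · simp [hr]
    · simpa using h2
  rw [div_eq_iff h0] at h3
  apply hz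
  have h4 : (1 + r : ℂ) ≠ 0 := by
    have : (1 + r : ℝ) ≠ 0 := by linarith
    exact_mod_cast this
  have h5 : z = (1 / (1 + r)) • k + (r / (1 + r)) • k₀ := by
    simp only [Complex.real_smul]; push_cast
    field_simp
    linear_combination -h3
  rw [h5]
  exact hK hk hk₀ (by positivity) (by positivity) (by field_simp)

theorem List.sum_map_sum_comm {α β M : Type*} [AddCommMonoid M] (l : List α) (l' : List β)
    (f : α → β → M) :
    (l.map fun a => (l'.map fun b => f a b).sum).sum = (l'.map fun b => (l.map fun a => f a b).sum).sum := by
  induction l with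
  | nil => simp
  | cons a l ih => simp [ih, List.sum_map_add]

namespace SurfaceAtlas

variable {S : Type*} [TopologicalSpace S] (A : SurfaceAtlas S)

open Classical in
/-- A small chart map defined on `T`, or zero if there is none. -/
noncomputable def smallMap (T : Set S) : S → ℂ :=
  if h : ∃ E ∈ A.small, T ⊆ E.source then h.choose.toFun else 0

/-- The intersection number of two curves modulo two. -/
noncomputable def inter (γ c : C(I, S)) : ZMod 2 :=
  periodParity (crossing (A.smallMap (range γ ∪ range c) ∘ γ) (A.smallMap (range γ ∪ range c) ∘ c))

theorem inter_comm (γ c : C(I, S)) : A.inter γ c = A.inter c γ := by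
  rw [inter, inter, crossing_symm, periodParity_neg, union_comm]

theorem smallMap_cases (T : Set S) :
    (∃ E ∈ A.small, T ⊆ E.source ∧ A.smallMap T = E.toFun) ∨
      (¬ ∃ E ∈ A.small, T ⊆ E.source) ∧ A.smallMap T = 0 := by
  by_cases h : ∃ E ∈ A.small, T ⊆ E.source
  · refine Or.inl ⟨h.choose, h.choose_spec.1, h.choose_spec.2, ?_⟩
    rw [smallMap, dif_pos h]
  · exact Or.inr ⟨h, by rw [smallMap, dif_neg h]⟩

theorem inter_eq_zero {γ c : C(I, S)} (h : Disjoint (range γ) (range c)) : A.inter γ c = 0 := by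
  rw [inter]
  rcases A.smallMap_cases (range γ ∪ range c) with ⟨E, -, hE, heq⟩ | ⟨-, heq⟩
  · rw [heq, crossing_eq_zero_of_disjoint (E.continuous_comp (subset_union_left.trans hE))
      (E.continuous_comp (subset_union_right.trans hE)), periodParity_zero]
    intro a b hab
    exact h.ne_of_mem (mem_range_self a) (mem_range_self b)
      (E.injOn (hE (Or.inl (mem_range_self a))) (hE (Or.inr (mem_range_self b))) hab)
  · rw [heq]
    simp [crossing, logVar_const, periodParity_zero]

/-- A curve inside a member of the atlas that is nowhere dense. -/
def IsPiece (γ : C(I, S)) : Prop := (∃ l, range γ ⊆ A.G l) ∧ interior (range γ) = ∅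

theorem inter_eq_chart {γ c : C(I, S)} (hγ : A.IsPiece γ) (hc : A.IsPiece c) {j : A.ι}
    (hγj : range γ ⊆ A.core j) (hcj : range c ⊆ (A.chart j).source) (h : EndsApart γ c) :
    A.inter γ c = periodParity (crossing ((A.chart j).toFun ∘ γ) ((A.chart j).toFun ∘ c)) := by
  have hγj' := hγj.trans (A.core_subset j)
  rw [inter]
  rcases A.smallMap_cases (range γ ∪ range c) with ⟨E, hEs, hE, heq⟩ | ⟨hno, heq⟩
  · rw [heq]
    have hEj : E.source ⊆ (A.chart j).source := A.small_subset_source E hEs j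
      ⟨γ 0, hE (Or.inl (mem_range_self 0)), hγj (mem_range_self 0)⟩
    have hγE : ∀ r, γ r ∈ E.source := fun r => hE (Or.inl (mem_range_self r))
    have hcE : ∀ r, c r ∈ E.source := fun r => hE (Or.inr (mem_range_self r))
    have hmaps : MapsTo E.invFun (E.toFun '' E.source) (A.chart j).source := by
      rintro _ ⟨x, hx, rfl⟩
      rw [E.left_inv x hx]; exact hEj hx
    have key := periodParity_crossing_comp E.convex E.interior_nonempty
      (φ := (A.chart j).toFun ∘ E.invFun)
      ((A.chart j).continuousOn_toFun.comp E.continuousOn_invFun hmaps)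
      (fun u hu v hv huv => by
        have := (A.chart j).injOn (hmaps hu) (hmaps hv) huv
        obtain ⟨x, hx, rfl⟩ := hu
        obtain ⟨y, hy, rfl⟩ := hv
        rw [E.left_inv x hx, E.left_inv y hy] at this
        rw [this])
      (E.continuous_comp (subset_union_left.trans hE)) (E.continuous_comp (subset_union_right.trans hE))
      (fun r => mem_image_of_mem _ (hγE r)) (fun r => mem_image_of_mem _ (hcE r))
      (h.comp E.injOn hγE hcE)
    rw [← key]
    congr 2 <;> ext r <;> simp only [Function.comp_apply, E.left_inv _ (hγE r), E.left_inv _ (hcE r)]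
  · have hdisj : Disjoint (range γ) (range c) := by
      obtain ⟨⟨l, hl⟩, -⟩ := hγ
      obtain ⟨⟨m, hm⟩, -⟩ := hc
      rw [disjoint_left]
      intro z hz hz'
      obtain ⟨E, hE, hs⟩ := A.exists_small l m ⟨z, hl hz, hm hz'⟩
      exact hno ⟨E, hE, (union_subset_union hl hm).trans hs⟩
    rw [heq, crossing_eq_zero_of_disjoint ((A.chart j).continuous_comp hγj')
      ((A.chart j).continuous_comp hcj)]
    · simp [crossing, logVar_const]
    · intro a b hab
      exact hdisj.ne_of_mem (mem_range_self a) (mem_range_self b)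
        ((A.chart j).injOn (hγj' (mem_range_self a)) (hcj (mem_range_self b)) hab)

/-- The intersection number of two lists of curves modulo two. -/
noncomputable def listInter (L C : List C(I, S)) : ZMod 2 :=
  (C.map fun c => (L.map fun γ => A.inter γ c).sum).sum

theorem listInter_comm (L C : List C(I, S)) : A.listInter L C = A.listInter C L := by
  rw [listInter, List.sum_map_sum_comm, listInter]
  simp only [A.inter_comm]

theorem listInter_append_left (L L' C : List C(I, S)) :
    A.listInter (L ++ L') C = A.listInter L C + A.listInter L' C := by
  simp [listInter, List.sum_map_add]

theorem listInter_append_right (L C C' : List C(I, S)) :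
    A.listInter L (C ++ C') = A.listInter L C + A.listInter L C' := by
  simp [listInter]

theorem listInter_eq_zero {L C : List C(I, S)}
    (h : ∀ γ ∈ L, ∀ c ∈ C, Disjoint (range γ) (range c)) : A.listInter L C = 0 := by
  rw [listInter, List.sum_eq_zero]
  simp only [List.mem_map, forall_exists_index, and_imp, forall_apply_eq_imp_iff₂]
  intro c hc
  apply List.sum_eq_zero
  simp only [List.mem_map, forall_exists_index, and_imp, forall_apply_eq_imp_iff₂]
  exact fun γ hγ => A.inter_eq_zero (h γ hγ c hc)

end SurfaceAtlas

section Winding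

variable {S : Type*} [TopologicalSpace S]

/-- The total variation of the argument of `φ - z` along a list of curves. -/
noncomputable def listLogVar (φ : S → ℂ) (L : List C(I, S)) (z : ℂ) : ℂ :=
  (L.map fun γ => logVar fun r => φ (γ r) - z).sum

theorem exp_listLogVar {φ : S → ℂ} {D : Set S} (hφ : ContinuousOn φ D) {L : List C(I, S)} {x y : S}
    (hL : CurveChain x L y) (hD : ∀ γ ∈ L, range γ ⊆ D) {z : ℂ}
    (hz : ∀ γ ∈ L, ∀ r, φ (γ r) ≠ z) (hx : φ x ≠ z) :
    Complex.exp (listLogVar φ L z) = (φ y - z) / (φ x - z) := by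
  induction L generalizing x with
  | nil =>
    obtain rfl : x = y := hL
    simp [listLogVar, div_self (sub_ne_zero.2 hx)]
  | cons γ L ih =>
    have h1 := hz γ List.mem_cons_self
    have h2 := ih hL.2 (fun c hc => hD c (List.mem_cons_of_mem _ hc))
      (fun c hc => hz c (List.mem_cons_of_mem _ hc)) (h1 1)
    have hc : Continuous fun r => φ (γ r) - z :=
      (hφ.comp_continuous γ.continuous fun r => hD γ List.mem_cons_self (mem_range_self r)).sub
        continuous_const
    unfold listLogVar at h2 ⊢
    rw [List.map_cons, List.sum_cons, Complex.exp_add, h2, exp_logVar hc fun r => sub_ne_zero.2 (h1 r),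
      hL.1]
    field_simp [sub_ne_zero.2 (h1 1)]

theorem listLogVar_eq_of_convex {φ : S → ℂ} {D : Set S} (hφ : ContinuousOn φ D)
    (hconv : Convex ℝ (φ '' D)) {L : List C(I, S)} {x y : S}
    (hL : CurveChain x L y) (hD : ∀ γ ∈ L, range γ ⊆ D) {z : ℂ} (hz : z ∉ φ '' D) {k : S} (hk : k ∈ D) :
    listLogVar φ L z =
      Complex.log ((φ y - z) / (φ k - z)) - Complex.log ((φ x - z) / (φ k - z)) := by
  rw [← hL.sum_sub fun w => Complex.log ((φ w - z) / (φ k - z)), listLogVar]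
  congr 1
  refine List.map_congr_left fun γ hγ => ?_
  have hγD : ∀ r, γ r ∈ D := fun r => hD γ hγ (mem_range_self r)
  have hmem : ∀ r, (φ (γ r) - z) / (φ k - z) ∈ Complex.slitPlane := fun r =>
    div_sub_mem_slitPlane hconv hz (mem_image_of_mem _ (hγD r)) (mem_image_of_mem _ hk)
  have hc : Continuous fun r => φ (γ r) := hφ.comp_continuous γ.continuous hγD
  have h0 : φ k - z ≠ 0 := sub_ne_zero.2 fun h => hz (h ▸ mem_image_of_mem _ hk)
  rw [logVar_eq (L := fun r => Complex.log ((φ (γ r) - z) / (φ k - z)) + Complex.log (φ k - z))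
    ((((hc.sub continuous_const).div_const _).clog hmem).add continuous_const) fun r => ?_]
  · ring
  · rw [Complex.exp_add, Complex.exp_log (Complex.slitPlane_ne_zero (hmem r)), Complex.exp_log h0,
      div_mul_cancel₀ _ h0]

theorem sum_crossing {φ : S → ℂ} {L : List C(I, S)} {x y : S} (hL : CurveChain x L y) (c : C(I, S)) :
    (L.map fun γ : C(I, S) => crossing (φ ∘ γ) (φ ∘ c)).sum =
      listLogVar φ L (φ (c 0)) - listLogVar φ L (φ (c 1)) +
        (logVar (fun r => φ (c r) - φ y) - logVar (fun r => φ (c r) - φ x)) := by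
  rw [← hL.sum_sub fun w => logVar fun r => φ (c r) - φ w, listLogVar, listLogVar]
  induction L generalizing x with
  | nil => simp
  | cons γ L ih =>
    simp only [List.map_cons, List.sum_cons, ih hL.2]
    simp only [crossing, Function.comp_apply]
    ring

end Winding

namespace SurfaceAtlas

variable {S : Type*} [TopologicalSpace S] (A : SurfaceAtlas S)

theorem exists_sum_inter_eq {j : A.ι} {x y : S} {L₁ L₂ : List C(I, S)} (h₁ : CurveChain x L₁ y)
    (h₂ : CurveChain x L₂ y) (hx : x ∈ A.core j)
    (hp₁ : ∀ γ ∈ L₁, A.IsPiece γ) (hp₂ : ∀ γ ∈ L₂, A.IsPiece γ)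
    (hj₁ : ∀ γ ∈ L₁, range γ ⊆ A.core j) (hj₂ : ∀ γ ∈ L₂, range γ ⊆ A.core j) :
    ∃ n : S → ZMod 2, ∀ c : C(I, S), A.IsPiece c → (∀ r, c r ≠ x) → (∀ γ ∈ L₁, EndsApart γ c) →
      (∀ γ ∈ L₂, EndsApart γ c) →
      (L₁.map fun γ => A.inter γ c).sum = (L₂.map fun γ => A.inter γ c).sum + (n (c 0) + n (c 1)) := by
  classical
  set φ := (A.chart j).toFun with hφ
  have hφc : ContinuousOn φ (A.core j) := (A.chart j).continuousOn_toFun.mono (A.core_subset j)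
  set N : S → ℂ := fun z => listLogVar φ L₁ (φ z) - listLogVar φ L₂ (φ z) with hN
  refine ⟨fun z => if z ∈ A.core j then periodParity (N z) else 0, fun c hc hcx hc₁ hc₂ => ?_⟩
  by_cases hcj : range c ⊆ (A.chart j).source
  · have hn : ∀ r, (if c r ∈ A.core j then periodParity (N (c r)) else 0) = periodParity (N (c r)) := by
      intro r
      split_ifs with hr
      · rfl
      · have hz : φ (c r) ∉ φ '' A.core j := by
          rintro ⟨w, hw, hwr⟩
          rw [(A.chart j).injOn (A.core_subset j hw) (hcj (mem_range_self r)) hwr] at hw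
          exact hr hw
        simp only [hN]
        rw [listLogVar_eq_of_convex hφc (A.convex_core j) h₁ hj₁ hz hx,
          listLogVar_eq_of_convex hφc (A.convex_core j) h₂ hj₂ hz hx, sub_self, periodParity_zero]
    have hne : ∀ {L : List C(I, S)}, (∀ γ ∈ L, range γ ⊆ A.core j) → (∀ γ ∈ L, EndsApart γ c) →
        ∀ γ ∈ L, ∀ r, φ (γ r) ≠ φ (c 0) ∧ φ (γ r) ≠ φ (c 1) := by
      intro L hL hLc γ hγ r
      have h := (hLc γ hγ).1 r
      have hγr := A.core_subset j (hL γ hγ (mem_range_self r))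
      exact ⟨fun e => h.1 ((A.chart j).injOn hγr (hcj (mem_range_self 0)) e),
        fun e => h.2 ((A.chart j).injOn hγr (hcj (mem_range_self 1)) e)⟩
    have hxc : ∀ r, φ x ≠ φ (c r) := fun r e =>
      hcx r ((A.chart j).injOn (A.core_subset j hx) (hcj (mem_range_self r)) e).symm
    have hper : ∀ r, (r = 0 ∨ r = 1) → IsPeriod (N (c r)) := by
      intro r hr
      have h1 : ∀ {L : List C(I, S)}, CurveChain x L y → (∀ γ ∈ L, range γ ⊆ A.core j) →
          (∀ γ ∈ L, EndsApart γ c) → Complex.exp (listLogVar φ L (φ (c r))) =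
            (φ y - φ (c r)) / (φ x - φ (c r)) := fun hL hLj hLc =>
        exp_listLogVar hφc hL hLj (fun γ hγ q => by
          rcases hr with rfl | rfl
          exacts [(hne hLj hLc γ hγ q).1, (hne hLj hLc γ hγ q).2]) (hxc r)
      rw [isPeriod_iff]
      simp only [hN]
      rw [Complex.exp_sub, h1 h₁ hj₁ hc₁, ← h1 h₂ hj₂ hc₂, div_self (Complex.exp_ne_zero _)]
    have hsum : ∀ {L : List C(I, S)}, (∀ γ ∈ L, A.IsPiece γ) → (∀ γ ∈ L, range γ ⊆ A.core j) →
        (∀ γ ∈ L, EndsApart γ c) → IsPeriod (L.map fun γ : C(I, S) => crossing (φ ∘ γ) (φ ∘ c)).sum ∧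
        (L.map fun γ => A.inter γ c).sum =
          periodParity (L.map fun γ : C(I, S) => crossing (φ ∘ γ) (φ ∘ c)).sum := by
      intro L hLp hLj hLc
      have h := periodParity_list_sum (L.map fun γ : C(I, S) => crossing (φ ∘ γ) (φ ∘ c)) (by
        intro w hw
        obtain ⟨γ, hγ, rfl⟩ := List.mem_map.1 hw
        have hγD := (hLj γ hγ).trans (A.core_subset j)
        exact crossing_isPeriod ((A.chart j).continuous_comp hγD) ((A.chart j).continuous_comp hcj)
          ((hLc γ hγ).comp (A.chart j).injOn (fun r => hγD (mem_range_self r))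
            fun r => hcj (mem_range_self r)))
      refine ⟨h.1, ?_⟩
      rw [h.2, List.map_map]
      congr 1
      exact List.map_congr_left fun γ hγ =>
        A.inter_eq_chart (hLp γ hγ) hc (hLj γ hγ) hcj (hLc γ hγ)
    obtain ⟨hP₁, hI₁⟩ := hsum hp₁ hj₁ hc₁
    obtain ⟨hP₂, hI₂⟩ := hsum hp₂ hj₂ hc₂
    have hid : (L₁.map fun γ : C(I, S) => crossing (φ ∘ γ) (φ ∘ c)).sum =
        (L₂.map fun γ : C(I, S) => crossing (φ ∘ γ) (φ ∘ c)).sum + (N (c 0) + -N (c 1)) := by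
      rw [sum_crossing h₁, sum_crossing h₂]
      simp only [hN]
      ring
    simp only [hn]
    rw [hI₁, hI₂, hid, periodParity_add hP₂ ((hper 0 (Or.inl rfl)).add (hper 1 (Or.inr rfl)).neg),
      periodParity_add (hper 0 (Or.inl rfl)) (hper 1 (Or.inr rfl)).neg, periodParity_neg]
  · have hdisj : Disjoint (A.core j) (range c) := by
      rw [disjoint_left]
      intro z hz hzc
      obtain ⟨⟨l, hl⟩, -⟩ := hc
      exact hcj (hl.trans (A.G_subset_source l j ⟨z, hl hzc, hz⟩))
    have hn : ∀ r, c r ∉ A.core j := fun r hr => disjoint_left.1 hdisj hr (mem_range_self r)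
    have h0 : ∀ {L : List C(I, S)}, (∀ γ ∈ L, range γ ⊆ A.core j) →
        (L.map fun γ => A.inter γ c).sum = 0 := by
      intro L hLj
      apply List.sum_eq_zero
      simp only [List.mem_map, forall_exists_index, and_imp, forall_apply_eq_imp_iff₂]
      exact fun γ hγ => A.inter_eq_zero (hdisj.mono_left (hLj γ hγ))
    rw [h0 hj₁, h0 hj₂]
    simp [hn]

/-- Two chains with the same endpoints inside the core of a chart meet every cycle equally often. -/
theorem listInter_eq_of_core {j : A.ι} {x y : S} {L₁ L₂ C : List C(I, S)} (h₁ : CurveChain x L₁ y)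
    (h₂ : CurveChain x L₂ y) (hx : x ∈ A.core j)
    (hp₁ : ∀ γ ∈ L₁, A.IsPiece γ) (hp₂ : ∀ γ ∈ L₂, A.IsPiece γ)
    (hj₁ : ∀ γ ∈ L₁, range γ ⊆ A.core j) (hj₂ : ∀ γ ∈ L₂, range γ ⊆ A.core j)
    (hC : IsModTwoCycle C) (hpC : ∀ c ∈ C, A.IsPiece c) (hCx : ∀ c ∈ C, ∀ r, c r ≠ x)
    (ha₁ : ListApart L₁ C) (ha₂ : ListApart L₂ C) :
    A.listInter L₁ C = A.listInter L₂ C := by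
  obtain ⟨n, hn⟩ := A.exists_sum_inter_eq h₁ h₂ hx hp₁ hp₂ hj₁ hj₂
  have h := hC n
  rw [listInter, List.map_congr_left fun c hc => hn c (hpC c hc) (hCx c hc)
    (fun γ hγ => ha₁ γ hγ c hc) (fun γ hγ => ha₂ γ hγ c hc), List.sum_map_add, h, add_zero, listInter]

end SurfaceAtlas

/-! ## General position -/

section Thin

variable {S : Type*} [TopologicalSpace S]

/-- A closed set with empty interior. -/
def IsThin (B : Set S) : Prop := IsClosed B ∧ interior B = ∅

theorem IsThin.union {A B : Set S} (hA : IsThin A) (hB : IsThin B) : IsThin (A ∪ B) :=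
  ⟨hA.1.union hB.1, by rw [interior_union_isClosed_of_interior_empty hA.1 hB.2, hA.2]⟩

theorem isThin_empty : IsThin (∅ : Set S) := ⟨isClosed_empty, interior_empty⟩

theorem IsThin.biUnion {α : Type*} {s : Set α} (hs : s.Finite) {B : α → Set S}
    (h : ∀ a ∈ s, IsThin (B a)) : IsThin (⋃ a ∈ s, B a) := by
  induction s, hs using Set.Finite.induction_on with
  | empty => simpa using isThin_empty
  | insert _ _ ih =>
    rw [biUnion_insert]
    exact (h _ (mem_insert _ _)).union (ih fun a ha => h a (mem_insert_of_mem _ ha))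

theorem IsThin.exists_notMem {B U : Set S} (hB : IsThin B) (hU : IsOpen U) (hne : U.Nonempty) :
    ∃ x ∈ U, x ∉ B := by
  by_contra! h
  have := interior_maximal h hU
  rw [hB.2] at this
  exact hne.ne_empty (subset_empty_iff.1 this)

/-- The set of points on the curves of a list. -/
def carrier (L : List C(I, S)) : Set S := {x | ∃ γ ∈ L, x ∈ range γ}

/-- The set of endpoints of the curves of a list. -/
def ends (L : List C(I, S)) : Set S := {x | ∃ γ ∈ L, x = γ 0 ∨ x = γ 1}

theorem ends_subset_carrier (L : List C(I, S)) : ends L ⊆ carrier L := by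
  rintro _ ⟨γ, hγ, rfl | rfl⟩
  exacts [⟨γ, hγ, mem_range_self _⟩, ⟨γ, hγ, mem_range_self _⟩]

theorem carrier_eq_biUnion (L : List C(I, S)) : carrier L = ⋃ γ ∈ {γ | γ ∈ L}, range γ := by
  ext x; simp [carrier]

theorem finite_ends (L : List C(I, S)) : (ends L).Finite := by
  have : ends L = ⋃ γ ∈ {γ | γ ∈ L}, {γ 0, γ 1} := by
    ext x; simp [ends]
  rw [this]
  exact L.finite_toSet.biUnion fun γ _ => by simp

theorem listApart_of_notMem {L C : List C(I, S)} (h : ∀ x ∈ ends C, x ∉ carrier L)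
    (h' : ∀ x ∈ ends L, x ∉ carrier C) : ListApart L C := fun γ hγ c hc =>
  ⟨fun r => ⟨fun e => h _ ⟨c, hc, Or.inl rfl⟩ ⟨γ, hγ, r, e⟩,
    fun e => h _ ⟨c, hc, Or.inr rfl⟩ ⟨γ, hγ, r, e⟩⟩,
   fun r => ⟨fun e => h' _ ⟨γ, hγ, Or.inl rfl⟩ ⟨c, hc, r, e⟩,
    fun e => h' _ ⟨γ, hγ, Or.inr rfl⟩ ⟨c, hc, r, e⟩⟩⟩

end Thin

theorem isClosed_line (p v : ℂ) : IsClosed {w : ℂ | ((w - p) * starRingEnd ℂ v).im = 0} :=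
  isClosed_eq (by fun_prop) continuous_const

theorem interior_line (p : ℂ) {v : ℂ} (hv : v ≠ 0) :
    interior {w : ℂ | ((w - p) * starRingEnd ℂ v).im = 0} = ∅ := by
  rw [eq_empty_iff_forall_notMem]
  intro c hc
  have h1 : Tendsto (fun t : ℝ => c + t * Complex.I * v) (𝓝[≠] 0) (𝓝 c) := by
    have : Continuous fun t : ℝ => c + t * Complex.I * v := by fun_prop
    have := this.tendsto 0
    simp only [Complex.ofReal_zero, zero_mul, add_zero] at this
    exact this.mono_left nhdsWithin_le_nhds
  obtain ⟨t, ht, ht0⟩ := ((h1.eventually (mem_interior_iff_mem_nhds.1 hc)).and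
    self_mem_nhdsWithin).exists
  have hc' : ((c - p) * starRingEnd ℂ v).im = 0 := by
    simpa only [mem_ofPred_eq] using interior_subset hc
  have ht' : ((c + t * Complex.I * v - p) * starRingEnd ℂ v).im = 0 := ht
  have h2 : (c + t * Complex.I * v - p) * starRingEnd ℂ v =
      (c - p) * starRingEnd ℂ v + ((t * Complex.normSq v : ℝ) : ℂ) * Complex.I := by
    push_cast
    rw [Complex.normSq_eq_conj_mul_self]
    ring
  rw [h2, Complex.add_im, hc', zero_add, Complex.im_ofReal_mul, Complex.I_im, mul_one] at ht'
  rcases mul_eq_zero.1 ht' with h | h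
  exacts [ht0 h, hv (Complex.normSq_eq_zero.1 h)]

theorem exists_notMem_lines (T : Finset (ℂ × ℂ)) {U : Set ℂ} (hU : IsOpen U) (hne : U.Nonempty) :
    ∃ c ∈ U, ∀ p ∈ T, p.2 ≠ 0 → ((c - p.1) * starRingEnd ℂ p.2).im ≠ 0 := by
  have hB : IsThin (⋃ p ∈ {p | p ∈ T ∧ p.2 ≠ 0}, {w : ℂ | ((w - p.1) * starRingEnd ℂ p.2).im = 0}) :=
    IsThin.biUnion (T.finite_toSet.subset fun p hp => hp.1) fun p hp =>
      ⟨isClosed_line _ _, interior_line _ hp.2⟩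
  obtain ⟨c, hcU, hc⟩ := hB.exists_notMem hU hne
  exact ⟨c, hcU, fun p hp hp0 h => hc (mem_biUnion (x := p) ⟨hp, hp0⟩ h)⟩

namespace ConvexChart

variable {S : Type*} [TopologicalSpace S] (E : ConvexChart S)

theorem isThin_singleton [T1Space S] {x : S} (hx : x ∈ E.source) : IsThin {x} := by
  refine ⟨isClosed_singleton, ?_⟩
  by_contra h
  obtain ⟨y, hy⟩ := nonempty_iff_ne_empty.2 h
  have h1 : interior {x} ⊆ E.source := interior_subset.trans (singleton_subset_iff.2 hx)
  obtain ⟨w, hw⟩ := E.interior_image_nonempty isOpen_interior ⟨y, hy⟩ h1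
  have h2 : E.toFun '' interior {x} ⊆ {w : ℂ | ((w - E.toFun x) * starRingEnd ℂ 1).im = 0} := by
    rintro _ ⟨z, hz, rfl⟩
    rw [mem_singleton_iff.1 (interior_subset hz)]
    simp
  have := interior_mono h2 hw
  rwa [interior_line _ one_ne_zero] at this

theorem exists_segment {a b : S} (ha : a ∈ E.source) (hb : b ∈ E.source) :
    ∃ γ : C(I, S), γ 0 = a ∧ γ 1 = b ∧ range γ ⊆ E.source ∧ interior (range γ) = ∅ ∧
      ∀ r : I, E.toFun (γ r) = (1 - (r : ℝ)) * E.toFun a + (r : ℝ) * E.toFun b := by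
  have hmem : ∀ r : I, ((1 - (r : ℝ)) * E.toFun a + (r : ℝ) * E.toFun b : ℂ) ∈ E.toFun '' E.source := by
    intro r
    have := E.convex (mem_image_of_mem _ ha) (mem_image_of_mem _ hb)
      (sub_nonneg.2 r.2.2) r.2.1 (sub_add_cancel _ _)
    simpa using this
  have hright : ∀ w ∈ E.toFun '' E.source, E.invFun w ∈ E.source ∧ E.toFun (E.invFun w) = w := by
    rintro _ ⟨s, hs, rfl⟩
    rw [E.left_inv s hs]
    exact ⟨hs, rfl⟩
  have hcont : Continuous fun r : I => E.invFun ((1 - (r : ℝ)) * E.toFun a + (r : ℝ) * E.toFun b) :=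
    E.continuousOn_invFun.comp_continuous (by fun_prop) hmem
  have hval : ∀ r : I, E.toFun ((⟨_, hcont⟩ : C(I, S)) r) =
      (1 - (r : ℝ)) * E.toFun a + (r : ℝ) * E.toFun b := fun r => (hright _ (hmem r)).2
  have hsub : range (⟨_, hcont⟩ : C(I, S)) ⊆ E.source := by
    rintro _ ⟨r, rfl⟩; exact (hright _ (hmem r)).1
  refine ⟨⟨_, hcont⟩, ?_, ?_, hsub, ?_, hval⟩
  · simp [E.left_inv a ha]
  · simp [E.left_inv b hb]
  · by_contra h
    obtain ⟨w, hw⟩ := E.interior_image_nonempty isOpen_interior (nonempty_iff_ne_empty.2 h)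
      (interior_subset.trans hsub)
    obtain ⟨v, hv, hvab⟩ : ∃ v : ℂ, v ≠ 0 ∧ ((E.toFun b - E.toFun a) * starRingEnd ℂ v).im = 0 := by
      by_cases hab : E.toFun b - E.toFun a = 0
      · exact ⟨1, one_ne_zero, by simp [hab]⟩
      · refine ⟨_, hab, ?_⟩
        rw [mul_comm, ← Complex.normSq_eq_conj_mul_self, Complex.ofReal_im]
    have h2 : E.toFun '' interior (range (⟨_, hcont⟩ : C(I, S))) ⊆
        {w : ℂ | ((w - E.toFun a) * starRingEnd ℂ v).im = 0} := by
      rintro _ ⟨z, hz, rfl⟩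
      obtain ⟨r, rfl⟩ := interior_subset hz
      have : ((1 - (r : ℝ)) * E.toFun a + (r : ℝ) * E.toFun b - E.toFun a) * starRingEnd ℂ v =
          ((r : ℝ) : ℂ) * ((E.toFun b - E.toFun a) * starRingEnd ℂ v) := by ring
      rw [mem_ofPred_eq, hval, this, Complex.im_ofReal_mul, hvab, mul_zero]
    have := interior_mono h2 hw
    rwa [interior_line _ hv] at this

end ConvexChart

namespace SurfaceAtlas

variable {S : Type*} [TopologicalSpace S] (A : SurfaceAtlas S)

theorem exists_chart (l : Fin A.N) {x : S} (hx : x ∈ A.G l) : ∃ j, A.G l ⊆ A.core j := by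
  obtain ⟨j, hj⟩ := A.exists_core l l ⟨x, hx, hx⟩
  exact ⟨j, subset_union_left.trans hj⟩

theorem isThin_of_finite [T1Space S] (A : SurfaceAtlas S) {F : Set S} (hF : F.Finite) : IsThin F := by
  rw [← biUnion_of_singleton F]
  refine IsThin.biUnion hF fun x _ => ?_
  obtain ⟨l, hl⟩ := A.exists_mem_G x
  obtain ⟨j, hj⟩ := A.exists_chart l hl
  exact (A.chart j).isThin_singleton (A.core_subset j (hj hl))

theorem isThin_carrier [T2Space S] {L : List C(I, S)} (hL : ∀ γ ∈ L, A.IsPiece γ) :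
    IsThin (carrier L) := by
  rw [carrier_eq_biUnion]
  exact IsThin.biUnion L.finite_toSet fun γ hγ =>
    ⟨(isCompact_range γ.continuous).isClosed, (hL γ hγ).2⟩

/-- A chain of pieces from `x` to `y` that avoids `F` and whose inner vertices avoid `B`. -/
def IsGood (F B : Set S) (x y : S) (L : List C(I, S)) : Prop :=
  CurveChain x L y ∧ ∀ γ ∈ L, A.IsPiece γ ∧ Disjoint (range γ) F ∧ (γ 0 = x ∨ γ 0 ∉ B) ∧
    (γ 1 = y ∨ γ 1 ∉ B)

variable {A}

theorem IsGood.append {F B : Set S} {x y z : S} {L L' : List C(I, S)} (h : A.IsGood F B x y L)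
    (h' : A.IsGood F B y z L') (hy : y ∉ B) : A.IsGood F B x z (L ++ L') := by
  refine ⟨h.1.append h'.1, fun γ hγ => ?_⟩
  rcases List.mem_append.1 hγ with hγ | hγ
  · obtain ⟨h1, h2, h3, h4⟩ := h.2 γ hγ
    exact ⟨h1, h2, h3, Or.inr (h4.elim (fun e => e ▸ hy) id)⟩
  · obtain ⟨h1, h2, h3, h4⟩ := h'.2 γ hγ
    exact ⟨h1, h2, Or.inr (h3.elim (fun e => e ▸ hy) id), h4⟩

theorem IsGood.mono {F F' B B' : Set S} {x y : S} {L : List C(I, S)} (h : A.IsGood F B x y L)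
    (hF : F' ⊆ F) (hB : B' ⊆ B) : A.IsGood F' B' x y L := by
  refine ⟨h.1, fun γ hγ => ?_⟩
  obtain ⟨h1, h2, h3, h4⟩ := h.2 γ hγ
  exact ⟨h1, h2.mono_right hF, h3.imp_right fun h e => h (hB e), h4.imp_right fun h e => h (hB e)⟩

theorem IsGood.isPiece {F B : Set S} {x y : S} {L : List C(I, S)} (h : A.IsGood F B x y L) :
    ∀ γ ∈ L, A.IsPiece γ := fun γ hγ => (h.2 γ hγ).1

theorem IsGood.notMem_carrier {F B : Set S} {x y z : S} {L : List C(I, S)} (h : A.IsGood F B x y L)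
    (hz : z ∈ F) : z ∉ carrier L := by
  rintro ⟨γ, hγ, hzγ⟩
  exact disjoint_left.1 (h.2 γ hγ).2.1 hzγ hz

theorem IsGood.ends {F B : Set S} {x y z : S} {L : List C(I, S)} (h : A.IsGood F B x y L)
    (hz : z ∈ ends L) : z = x ∨ z = y ∨ z ∉ B := by
  obtain ⟨γ, hγ, rfl | rfl⟩ := hz
  · exact (h.2 γ hγ).2.2.1.imp_right Or.inr
  · exact Or.inr (h.2 γ hγ).2.2.2

variable (A)

theorem exists_isGood_chart [T1Space S] {E : ConvexChart S} {l : Fin A.N} (hE : E.source ⊆ A.G l) {F B : Set S}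
    (hF : F.Finite) (hB : IsThin B) {x y : S} (hx : x ∈ E.source) (hy : y ∈ E.source) (hxF : x ∉ F)
    (hyF : y ∉ F) : ∃ L, A.IsGood F B x y L ∧ ∀ γ ∈ L, range γ ⊆ E.source := by
  classical
  obtain ⟨z₀, hz₀, hz₀B⟩ := hB.exists_notMem E.isOpen_source ⟨x, hx⟩
  obtain ⟨c, hc, hcT⟩ := exists_notMem_lines
    (hF.toFinset.image (fun f => (E.toFun x, E.toFun f - E.toFun x)) ∪
      hF.toFinset.image (fun f => (E.toFun y, E.toFun f - E.toFun y))) isOpen_interior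
    (E.interior_image_nonempty (E.isOpen_source.sdiff hB.1) ⟨z₀, hz₀, hz₀B⟩ sdiff_subset)
  obtain ⟨z, ⟨hz, hzB⟩, rfl⟩ := interior_subset hc
  have key : ∀ w ∈ E.source, w ∉ F → (∀ f ∈ F, E.toFun f - E.toFun w ≠ 0 →
      ((E.toFun z - E.toFun w) * starRingEnd ℂ (E.toFun f - E.toFun w)).im ≠ 0) →
      ∀ f ∈ F, f ∈ E.source → ∀ r : ℝ, E.toFun f - E.toFun w ≠ r * (E.toFun z - E.toFun w) := by
    intro w hw hwF hT f hf hfE r hr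
    have h0 : E.toFun f - E.toFun w ≠ 0 := fun h =>
      hwF (E.injOn hfE hw (sub_eq_zero.1 h) ▸ hf)
    have h1 := hT f hf h0
    rw [hr, map_mul, Complex.conj_ofReal, mul_left_comm,
      mul_comm (E.toFun z - E.toFun w), ← Complex.normSq_eq_conj_mul_self, ← Complex.ofReal_mul,
      Complex.ofReal_im] at h1
    exact h1 rfl
  have hkx := key x hx hxF fun f hf h0 => hcT (E.toFun x, E.toFun f - E.toFun x)
    (Finset.mem_union_left _ (Finset.mem_image_of_mem _ (hF.mem_toFinset.2 hf))) h0
  have hky := key y hy hyF fun f hf h0 => hcT (E.toFun y, E.toFun f - E.toFun y)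
    (Finset.mem_union_right _ (Finset.mem_image_of_mem _ (hF.mem_toFinset.2 hf))) h0
  obtain ⟨γ₁, h10, h11, h1E, h1i, h1v⟩ := E.exists_segment hx hz
  obtain ⟨γ₂, h20, h21, h2E, h2i, h2v⟩ := E.exists_segment hz hy
  refine ⟨[γ₁, γ₂], ⟨⟨h10, h20.trans h11.symm, h21⟩, ?_⟩, ?_⟩
  · simp only [List.mem_cons, List.not_mem_nil, or_false, forall_eq_or_imp, forall_eq]
    refine ⟨⟨⟨⟨l, h1E.trans hE⟩, h1i⟩, ?_, Or.inl h10, Or.inr (h11 ▸ hzB)⟩,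
      ⟨⟨l, h2E.trans hE⟩, h2i⟩, ?_, Or.inr (h20 ▸ hzB), Or.inl h21⟩
    · rw [disjoint_left]
      rintro _ ⟨r, rfl⟩ hf
      refine hkx _ hf (h1E (mem_range_self r)) r ?_
      rw [h1v]; ring
    · rw [disjoint_left]
      rintro _ ⟨r, rfl⟩ hf
      refine hky _ hf (h2E (mem_range_self r)) (1 - r) ?_
      rw [h2v]; push_cast; ring
  · simp only [List.mem_cons, List.not_mem_nil, or_false, forall_eq_or_imp, forall_eq]
    exact ⟨h1E, h2E⟩

/-- Two points of a connected open set are joined by a chain of pieces in general position. -/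
theorem exists_isGood [T1Space S] {O : Set S} (hO : IsOpen O) (hO' : IsPreconnected O) {F B : Set S}
    (hF : F.Finite) (hB : IsThin B) {x y : S} (hx : x ∈ O) (hy : y ∈ O) (hxF : x ∉ F) (hyF : y ∉ F) :
    ∃ L, A.IsGood F B x y L ∧ ∀ γ ∈ L, range γ ⊆ O := by
  let P : S → S → Prop := fun z w => ∃ U ∈ 𝓝 z, ∃ V ∈ 𝓝 w, ∀ x ∈ U, x ∉ F → ∀ y ∈ V, y ∉ F →
    ∃ L, A.IsGood F B x y L ∧ ∀ γ ∈ L, range γ ⊆ O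
  have hP : P x y := by
    refine hO'.induction₂' P (fun z hz => ?_) (fun u v w _ _ _ huv hvw => ?_) hx hy
    · obtain ⟨l, hl⟩ := A.exists_mem_G z
      obtain ⟨j, hj⟩ := A.exists_chart l hl
      obtain ⟨E, -, hzE, hE⟩ := (A.chart j).exists_subchart (A.core_subset j (hj hl))
        (((A.isOpen_G l).inter hO).mem_nhds ⟨hl, hz⟩)
      have hmem : ∀ {w}, w ∈ E.source → E.source ∈ 𝓝 w := fun h => E.isOpen_source.mem_nhds h
      have hloc : ∀ x ∈ E.source, x ∉ F → ∀ y ∈ E.source, y ∉ F →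
          ∃ L, A.IsGood F B x y L ∧ ∀ γ ∈ L, range γ ⊆ O := by
        intro x hx hxF y hy hyF
        obtain ⟨L, hL, hLE⟩ := A.exists_isGood_chart (fun w hw => (hE hw).2.1) hF hB hx hy hxF hyF
        exact ⟨L, hL, fun γ hγ => (hLE γ hγ).trans fun w hw => (hE hw).2.2⟩
      filter_upwards [mem_nhdsWithin_of_mem_nhds (hmem hzE)] with w hw
      exact ⟨⟨_, hmem hzE, _, hmem hw, hloc⟩, ⟨_, hmem hw, _, hmem hzE, hloc⟩⟩
    · obtain ⟨U, hU, V, hV, h⟩ := huv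
      obtain ⟨V', hV', W, hW, h'⟩ := hvw
      obtain ⟨m, hm, hmFB⟩ := ((A.isThin_of_finite hF).union hB).exists_notMem
        (isOpen_interior (s := V ∩ V')) ⟨v, mem_interior_iff_mem_nhds.2 (inter_mem hV hV')⟩
      rw [mem_union, not_or] at hmFB
      refine ⟨U, hU, W, hW, fun x hx hxF y hy hyF => ?_⟩
      obtain ⟨L, hL, hLO⟩ := h x hx hxF m (interior_subset hm).1 hmFB.1
      obtain ⟨L', hL', hLO'⟩ := h' m (interior_subset hm).2 hmFB.1 y hy hyF
      exact ⟨L ++ L', hL.append hL' hmFB.2, fun γ hγ => (List.mem_append.1 hγ).elim (hLO γ) (hLO' γ)⟩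
  obtain ⟨U, hU, V, hV, h⟩ := hP
  exact h x (mem_of_mem_nhds hU) hxF y (mem_of_mem_nhds hV) hyF

end SurfaceAtlas

/-! ## Labels of chains and intersection numbers -/

section Chains

variable {S : Type*} [TopologicalSpace S]

theorem ListApart.append {L L' C : List C(I, S)} (h : ListApart L C) (h' : ListApart L' C) :
    ListApart (L ++ L') C := fun γ hγ => (List.mem_append.1 hγ).elim (h γ) (h' γ)

theorem ListApart.symm {L C : List C(I, S)} (h : ListApart L C) : ListApart C L :=
  fun c hc γ hγ => (h γ hγ c hc).symm

theorem ListApart.of_cons {γ : C(I, S)} {L C : List C(I, S)} (h : ListApart (γ :: L) C) :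
    ListApart [γ] C ∧ ListApart L C :=
  ⟨fun δ hδ => h δ (by rw [List.mem_singleton.1 hδ]; exact List.mem_cons_self),
    fun δ hδ => h δ (List.mem_cons_of_mem _ hδ)⟩

theorem ListApart.notMem_carrier {L C : List C(I, S)} (h : ListApart L C) {γ : C(I, S)} (hγ : γ ∈ L) :
    γ 0 ∉ carrier C ∧ γ 1 ∉ carrier C :=
  ⟨fun ⟨c, hc, r, hr⟩ => ((h γ hγ c hc).2 r).1 hr, fun ⟨c, hc, r, hr⟩ => ((h γ hγ c hc).2 r).2 hr⟩

end Chains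

namespace SurfaceAtlas

variable {S : Type*} [TopologicalSpace S] (A : SurfaceAtlas S)

theorem listInter_nil (C : List C(I, S)) : A.listInter [] C = 0 := by
  simp [listInter]

theorem listInter_cons (γ : C(I, S)) (L C : List C(I, S)) :
    A.listInter (γ :: L) C = A.listInter [γ] C + A.listInter L C :=
  A.listInter_append_left [γ] L C

variable {A}

theorem IsGood.listApart {C : List C(I, S)} {x y : S} {L : List C(I, S)}
    (h : A.IsGood (_root_.ends C) (carrier C) x y L) (hx : x ∉ carrier C) (hy : y ∉ carrier C) :
    ListApart L C := by
  refine listApart_of_notMem (fun z hz => h.notMem_carrier hz) fun z hz => ?_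
  rcases h.ends hz with rfl | rfl | h
  exacts [hx, hy, h]

variable (A)

theorem exists_chain_apart [T2Space S] {C : List C(I, S)} (hpC : ∀ c ∈ C, A.IsPiece c) (l : Fin A.N)
    {x y : S} (hx : x ∈ A.G l) (hy : y ∈ A.G l) (hxC : x ∉ carrier C) (hyC : y ∉ carrier C) :
    ∃ L, CurveChain x L y ∧ (∀ γ ∈ L, A.IsPiece γ ∧ range γ ⊆ A.G l) ∧ ListApart L C := by
  obtain ⟨L, hL, hLl⟩ := A.exists_isGood (A.isOpen_G l) (A.isPreconnected_G l) (finite_ends C)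
    (A.isThin_carrier hpC) hx hy (fun h => hxC (ends_subset_carrier C h))
    (fun h => hyC (ends_subset_carrier C h))
  exact ⟨L, hL.1, fun γ hγ => ⟨hL.isPiece γ hγ, hLl γ hγ⟩, hL.listApart hxC hyC⟩

theorem exists_potential [T2Space S] {C : List C(I, S)} (hC : IsModTwoCycle C)
    (hpC : ∀ c ∈ C, A.IsPiece c) : ∃ P : Fin A.N → S → ZMod 2, ∀ l x y L, x ∈ A.G l → y ∈ A.G l →
      x ∉ carrier C → CurveChain x L y → (∀ γ ∈ L, A.IsPiece γ ∧ range γ ⊆ A.G l) → ListApart L C →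
      y ∉ carrier C → A.listInter L C = P l x + P l y := by
  classical
  suffices ∀ l, ∃ P : S → ZMod 2, ∀ x y L, x ∈ A.G l → y ∈ A.G l →
      x ∉ carrier C → CurveChain x L y → (∀ γ ∈ L, A.IsPiece γ ∧ range γ ⊆ A.G l) → ListApart L C →
      y ∉ carrier C → A.listInter L C = P x + P y by
    choose P hP using this
    exact ⟨P, hP⟩
  intro l
  by_cases hb : ∃ b ∈ A.G l, b ∉ carrier C
  · obtain ⟨b, hb, hbC⟩ := hb
    obtain ⟨j, hj⟩ := A.exists_chart l hb
    have h := fun x : {x // x ∈ A.G l ∧ x ∉ carrier C} =>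
      A.exists_chain_apart hpC l hb x.2.1 hbC x.2.2
    choose M hM hMp hMC using h
    refine ⟨fun x => if h : x ∈ A.G l ∧ x ∉ carrier C then A.listInter (M ⟨x, h⟩) C else 0, ?_⟩
    intro x y L hx hy hxC hL hLp hLC hyC
    simp only [dif_pos (And.intro hx hxC), dif_pos (And.intro hy hyC)]
    have hp : ∀ γ ∈ M ⟨x, hx, hxC⟩ ++ L, A.IsPiece γ ∧ range γ ⊆ A.G l := fun γ hγ =>
      (List.mem_append.1 hγ).elim (hMp _ γ) (hLp γ)
    have key := A.listInter_eq_of_core ((hM ⟨x, hx, hxC⟩).append hL) (hM ⟨y, hy, hyC⟩) (hj hb)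
      (fun γ hγ => (hp γ hγ).1) (fun γ hγ => (hMp _ γ hγ).1) (fun γ hγ => (hp γ hγ).2.trans hj)
      (fun γ hγ => (hMp _ γ hγ).2.trans hj) hC hpC (fun c hc r e => hbC ⟨c, hc, r, e⟩)
      ((hMC _).append hLC) (hMC _)
    rw [← key, listInter_append_left, ← add_assoc, CharTwo.add_self_eq_zero, zero_add]
  · push Not at hb
    exact ⟨0, fun x y L hx _ hxC => absurd (hb x hx) hxC⟩

theorem exists_transition [T2Space S] {C : List C(I, S)} (hC : IsModTwoCycle C)
    (hpC : ∀ c ∈ C, A.IsPiece c) : ∃ (P : Fin A.N → S → ZMod 2) (κ : Fin A.N × Fin A.N → ZMod 2),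
      (∀ l x y L, x ∈ A.G l → y ∈ A.G l →
        x ∉ carrier C → CurveChain x L y → (∀ γ ∈ L, A.IsPiece γ ∧ range γ ⊆ A.G l) → ListApart L C →
        y ∉ carrier C → A.listInter L C = P l x + P l y) ∧
      ∀ l m x, x ∈ A.G l → x ∈ A.G m → x ∉ carrier C → κ (l, m) = P l x + P m x := by
  obtain ⟨P, hP⟩ := A.exists_potential hC hpC
  suffices ∀ q : Fin A.N × Fin A.N, ∃ k, ∀ x, x ∈ A.G q.1 → x ∈ A.G q.2 → x ∉ carrier C →
      k = P q.1 x + P q.2 x by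
    choose κ hκ using this
    exact ⟨P, κ, hP, fun l m => hκ (l, m)⟩
  rintro ⟨l, m⟩
  by_cases hb : ∃ b ∈ A.G l ∩ A.G m, b ∉ carrier C
  · obtain ⟨b, ⟨hbl, hbm⟩, hbC⟩ := hb
    obtain ⟨j, hj⟩ := A.exists_core l m ⟨b, hbl, hbm⟩
    have hjl := subset_union_left.trans hj
    have hjm := subset_union_right.trans hj
    refine ⟨P l b + P m b, fun x hxl hxm hxC => ?_⟩
    obtain ⟨L, hL, hLp, hLC⟩ := A.exists_chain_apart hpC l hbl hxl hbC hxC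
    obtain ⟨M, hM, hMp, hMC⟩ := A.exists_chain_apart hpC m hbm hxm hbC hxC
    have key := A.listInter_eq_of_core hL hM (hjl hbl) (fun γ hγ => (hLp γ hγ).1)
      (fun γ hγ => (hMp γ hγ).1) (fun γ hγ => (hLp γ hγ).2.trans hjl)
      (fun γ hγ => (hMp γ hγ).2.trans hjm) hC hpC (fun c hc r e => hbC ⟨c, hc, r, e⟩) hLC hMC
    rw [hP l b x L hbl hxl hbC hL hLp hLC hxC, hP m b x M hbm hxm hbC hM hMp hMC hxC] at key
    have h2 : ∀ a b c d : ZMod 2, a + b = c + d → a + c = b + d := by decide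
    exact h2 _ _ _ _ key
  · push Not at hb
    exact ⟨0, fun x hx hx' hxC => absurd (hb x ⟨hx, hx'⟩) hxC⟩

/-- A chain of pieces together with a sequence of members of the atlas carrying them; the last
argument counts modulo two the transitions between members of the atlas. -/
inductive LabeledChain : Fin A.N → S → Fin A.N → S → List C(I, S) →
    (Fin A.N × Fin A.N → ZMod 2) → Prop
  | nil {l : Fin A.N} {x : S} (hx : x ∈ A.G l) : LabeledChain l x l x [] 0
  | cons {l m : Fin A.N} {y : S} {γ : C(I, S)} {L : List C(I, S)} {h : Fin A.N × Fin A.N → ZMod 2}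
      (hγ : A.IsPiece γ) (hγl : range γ ⊆ A.G l) (hL : LabeledChain l (γ 1) m y L h) :
      LabeledChain l (γ 0) m y (γ :: L) h
  | change {l l' m : Fin A.N} {x y : S} {L : List C(I, S)} {h : Fin A.N × Fin A.N → ZMod 2}
      (hx : x ∈ A.G l) (hL : LabeledChain l' x m y L h) :
      LabeledChain l x m y L (h + Pi.single (l, l') 1)

namespace LabeledChain

variable {A} {l m n : Fin A.N} {x y z : S} {L L' C : List C(I, S)} {h h' : Fin A.N × Fin A.N → ZMod 2}

theorem left_mem (hL : A.LabeledChain l x m y L h) : x ∈ A.G l := by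
  cases hL with
  | nil hx => exact hx
  | cons _ hγl _ => exact hγl (mem_range_self _)
  | change hx _ => exact hx

theorem isPiece (hL : A.LabeledChain l x m y L h) : ∀ γ ∈ L, A.IsPiece γ := by
  induction hL with
  | nil => simp
  | cons hγ _ _ ih => exact List.forall_mem_cons.2 ⟨hγ, ih⟩
  | change _ _ ih => exact ih

theorem curveChain (hL : A.LabeledChain l x m y L h) : CurveChain x L y := by
  induction hL with
  | nil => exact rfl
  | cons _ _ _ ih => exact ⟨rfl, ih⟩
  | change _ _ ih => exact ih

theorem append (hL : A.LabeledChain l x m y L h) (hL' : A.LabeledChain m y n z L' h') :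
    A.LabeledChain l x n z (L ++ L') (h + h') := by
  induction hL with
  | nil => simpa using hL'
  | cons hγ hγl _ ih => exact .cons hγ hγl (ih hL')
  | change hx _ ih => rw [add_right_comm]; exact .change hx (ih hL')

theorem of_subset (hL : CurveChain x L y) (hLp : ∀ γ ∈ L, A.IsPiece γ ∧ range γ ⊆ A.G l)
    (hx : x ∈ A.G l) : A.LabeledChain l x l y L 0 := by
  induction L generalizing x with
  | nil => obtain rfl : x = y := hL; exact .nil hx
  | cons γ L ih =>
    obtain ⟨rfl, hL⟩ := hL
    have hγ := hLp γ List.mem_cons_self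
    exact .cons hγ.1 hγ.2 (ih hL (fun c hc => hLp c (List.mem_cons_of_mem _ hc))
      (hγ.2 (mem_range_self _)))

theorem exists_of_curveChain {pt : S → Fin A.N} (hpt : ∀ x, x ∈ A.G (pt x)) (hL : CurveChain x L y)
    (hLp : ∀ γ ∈ L, A.IsPiece γ) : ∃ h, A.LabeledChain (pt x) x (pt y) y L h := by
  induction L generalizing x with
  | nil => obtain rfl : x = y := hL; exact ⟨0, .nil (hpt x)⟩
  | cons γ L ih =>
    obtain ⟨rfl, hL⟩ := hL
    obtain ⟨h, hL'⟩ := ih hL (fun c hc => hLp c (List.mem_cons_of_mem _ hc))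
    have hγ := hLp γ List.mem_cons_self
    obtain ⟨l, hl⟩ := hγ.1
    exact ⟨_, .change (hpt _) (.cons hγ hl (.change (hl (mem_range_self _)) hL'))⟩

theorem listInter_eq_add_sum {P : Fin A.N → S → ZMod 2} {κ : Fin A.N × Fin A.N → ZMod 2}
    (hP : ∀ l x y L, x ∈ A.G l → y ∈ A.G l →
      x ∉ carrier C → CurveChain x L y → (∀ γ ∈ L, A.IsPiece γ ∧ range γ ⊆ A.G l) → ListApart L C →
      y ∉ carrier C → A.listInter L C = P l x + P l y)
    (hκ : ∀ l m x, x ∈ A.G l → x ∈ A.G m → x ∉ carrier C → κ (l, m) = P l x + P m x)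
    (hL : A.LabeledChain l x m y L h) (hx : x ∉ carrier C) (hLC : ListApart L C) :
    A.listInter L C = P l x + P m y + ∑ q, h q * κ q := by
  induction hL with
  | nil _ => simp [listInter_nil, CharTwo.add_self_eq_zero]
  | @cons l m y γ L h hγ hγl _ ih =>
    have h1 := hLC.notMem_carrier List.mem_cons_self
    have h2 := hLC.of_cons
    rw [listInter_cons, ih h1.2 h2.2, hP l (γ 0) (γ 1) [γ] (hγl (mem_range_self _))
      (hγl (mem_range_self _)) h1.1 ⟨rfl, rfl⟩ (by simpa using ⟨hγ, hγl⟩) h2.1 h1.2]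
    have : ∀ a b c d : ZMod 2, a + b + (b + c + d) = a + c + d := by decide
    exact this _ _ _ _
  | @change l l' m x y L h hxl hL ih =>
    rw [ih hx hLC]
    simp only [Pi.add_apply, add_mul, Finset.sum_add_distrib]
    have h1 : ∑ q, (Pi.single (l, l') 1 : Fin A.N × Fin A.N → ZMod 2) q * κ q = κ (l, l') := by
      simp [Pi.single_apply]
    rw [h1, hκ l l' x hxl hL.left_mem hx]
    have : ∀ a b c d : ZMod 2, a + c + d = b + c + (d + (b + a)) := by decide
    exact this _ _ _ _

/-- Chains with the same endpoints and the same label meet a cycle equally often. -/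
theorem listInter_eq [T2Space S] (hL : A.LabeledChain l x m y L h)
    (hL' : A.LabeledChain l x m y L' h) (hC : IsModTwoCycle C) (hpC : ∀ c ∈ C, A.IsPiece c)
    (hx : x ∉ carrier C) (hLC : ListApart L C) (hLC' : ListApart L' C) :
    A.listInter L C = A.listInter L' C := by
  obtain ⟨P, κ, hP, hκ⟩ := A.exists_transition hC hpC
  rw [hL.listInter_eq_add_sum hP hκ hx hLC, hL'.listInter_eq_add_sum hP hκ hx hLC']

theorem right_mem (hL : A.LabeledChain l x m y L h) : y ∈ A.G m := by
  induction hL with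
  | nil hx => exact hx
  | cons _ _ _ ih => exact ih
  | change _ _ ih => exact ih

/-- A labeled chain can be replaced by one in general position with other endpoints. -/
theorem exists_isGood [T2Space S] (hL : A.LabeledChain l x m y L h) {F B : Set S} (hF : F.Finite)
    (hB : IsThin B) {x' y' : S} (hx' : x' ∈ A.G l) (hy' : y' ∈ A.G m) (hxF : x' ∉ F) (hyF : y' ∉ F) :
    ∃ L', A.LabeledChain l x' m y' L' h ∧ A.IsGood F B x' y' L' := by
  induction hL generalizing x' with
  | @nil l x hx =>
    obtain ⟨L, hL, hLl⟩ := A.exists_isGood (A.isOpen_G l) (A.isPreconnected_G l) hF hB hx' hy' hxF hyF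
    exact ⟨L, .of_subset hL.1 (fun γ hγ => ⟨hL.isPiece γ hγ, hLl γ hγ⟩) hx', hL⟩
  | cons _ _ _ ih => exact ih hx' hy' hxF
  | @change l l' m x y L h hxl hL ih =>
    obtain ⟨z, ⟨hz, hz'⟩, hzFB⟩ := ((A.isThin_of_finite hF).union hB).exists_notMem
      ((A.isOpen_G l).inter (A.isOpen_G l')) ⟨x, hxl, hL.left_mem⟩
    rw [mem_union, not_or] at hzFB
    obtain ⟨M, hM, hMl⟩ := A.exists_isGood (A.isOpen_G l) (A.isPreconnected_G l) hF hB hx' hz hxF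
      hzFB.1
    obtain ⟨M', hM', hMg⟩ := ih hz' hy' hzFB.1
    refine ⟨M ++ M', ?_, hM.append hMg hzFB.2⟩
    have h1 : A.LabeledChain l x' l z M 0 :=
      .of_subset hM.1 (fun γ hγ => ⟨hM.isPiece γ hγ, hMl γ hγ⟩) hx'
    simpa using h1.append (.change hz hM')

end LabeledChain

end SurfaceAtlas

/-! ## Families of chains in general position -/

namespace SurfaceAtlas

variable {S : Type*} [TopologicalSpace S] (A : SurfaceAtlas S)

variable {A} in
theorem IsGood.listApart_of_subset {F B : Set S} {C : List C(I, S)} {x y : S} {L : List C(I, S)}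
    (h : A.IsGood (F \ {x, y}) B x y L) (hCF : _root_.ends C ⊆ F) (hCB : carrier C ⊆ B)
    (hx : x ∉ carrier C) (hy : y ∉ carrier C) : ListApart L C := by
  refine (h.mono (fun z hz => ⟨hCF hz, ?_⟩) hCB).listApart hx hy
  rintro (rfl | rfl)
  exacts [hx (ends_subset_carrier C hz), hy (ends_subset_carrier C hz)]

theorem exists_generic_family [T2Space S] {κ : Type*} [Fintype κ] (x y : κ → S)
    (Q : κ → List C(I, S) → Prop)
    (hQ : ∀ i (F B : Set S), F.Finite → IsThin B → x i ∉ F → y i ∉ F →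
      ∃ L, Q i L ∧ A.IsGood F B (x i) (y i) L)
    {F₀ B₀ : Set S} (hF₀ : F₀.Finite) (hB₀ : IsThin B₀) (hx : ∀ i, x i ∈ F₀) (hy : ∀ i, y i ∈ F₀) :
    ∃ L : κ → List C(I, S), (∀ i, Q i (L i) ∧ A.IsGood (F₀ \ {x i, y i}) B₀ (x i) (y i) (L i)) ∧
      ∀ i j, x i ≠ x j → x i ≠ y j → y i ≠ x j → y i ≠ y j → ListApart (L i) (L j) := by
  classical
  have key : ∀ s : Finset κ, ∃ L : κ → List C(I, S),
      (∀ i ∈ s, Q i (L i) ∧ A.IsGood (F₀ \ {x i, y i}) B₀ (x i) (y i) (L i)) ∧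
      ∀ i ∈ s, ∀ j ∈ s, i ≠ j → ∀ v ∈ ends (L i), v = x i ∨ v = y i ∨ v ∉ carrier (L j) := by
    intro s
    induction s using Finset.induction_on with
    | empty => exact ⟨fun _ => [], by simp, by simp⟩
    | insert i s his ih =>
      obtain ⟨L, hL, hLL⟩ := ih
      obtain ⟨M, hQM, hM⟩ := hQ i ((F₀ ∪ ⋃ j ∈ (s : Set κ), ends (L j)) \ {x i, y i})
        (B₀ ∪ ⋃ j ∈ (s : Set κ), carrier (L j))
        ((hF₀.union (s.finite_toSet.biUnion fun j _ => finite_ends _)).subset sdiff_subset)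
        (hB₀.union (IsThin.biUnion s.finite_toSet fun j hj => A.isThin_carrier (hL j hj).2.isPiece))
        (by simp) (by simp)
      have hne : ∀ {j}, j ∈ s → j ≠ i := fun hj h => his (h ▸ hj)
      refine ⟨Function.update L i M, fun j hj => ?_, fun j hj k hk hjk v hv => ?_⟩
      · rcases Finset.mem_insert.1 hj with rfl | hj
        · rw [Function.update_self]
          exact ⟨hQM, hM.mono (sdiff_subset_sdiff_left subset_union_left) subset_union_left⟩
        · rw [Function.update_of_ne (hne hj)]
          exact hL j hj
      · rcases Finset.mem_insert.1 hj with rfl | hjs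
        · rcases Finset.mem_insert.1 hk with rfl | hk
          · exact absurd rfl hjk
          rw [Function.update_self] at hv
          rw [Function.update_of_ne (hne hk)]
          exact (hM.ends hv).imp_right (Or.imp_right fun h hc => h (Or.inr (mem_biUnion hk hc)))
        · rw [Function.update_of_ne (hne hjs)] at hv
          rcases Finset.mem_insert.1 hk with rfl | hk
          · rw [Function.update_self]
            by_contra! hcon
            obtain ⟨h1, h2, h3⟩ := hcon
            have h4 : v ∉ F₀ := fun hv0 =>
              (hL j hjs).2.notMem_carrier ⟨hv0, by simp [h1, h2]⟩ (ends_subset_carrier _ hv)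
            refine hM.notMem_carrier ⟨Or.inr (mem_biUnion hjs hv), ?_⟩ h3
            rintro (rfl | rfl)
            exacts [h4 (hx _), h4 (hy _)]
          · rw [Function.update_of_ne (hne hk)]
            exact hLL j hjs k hk hjk v hv
  obtain ⟨L, hL, hLL⟩ := key Finset.univ
  refine ⟨L, fun i => hL i (Finset.mem_univ i), ?_⟩
  have h0 : ∀ i j, x i ≠ x j → x i ≠ y j → y i ≠ x j → y i ≠ y j → ∀ v ∈ ends (L i),
      v ∉ carrier (L j) := by
    intro i j h1 h2 h3 h4 v hv hc
    have hg := (hL j (Finset.mem_univ j)).2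
    rcases hLL i (Finset.mem_univ i) j (Finset.mem_univ j) (fun h => h1 (h ▸ rfl)) v hv with
      rfl | rfl | h
    · exact hg.notMem_carrier ⟨hx i, by simp [h1, h2]⟩ hc
    · exact hg.notMem_carrier ⟨hy i, by simp [h3, h4]⟩ hc
    · exact h hc
  exact fun i j h1 h2 h3 h4 => listApart_of_notMem (h0 j i h1.symm h3.symm h2.symm h4.symm)
    (h0 i j h1 h2 h3 h4)

end SurfaceAtlas

theorem grid_eq {i j a b r s : ℝ}
    (h : (1 - r : ℂ) * (i + Complex.I) + r * a = (1 - s) * (j + Complex.I) + s * b) :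
    r = s ∧ (1 - r) * i + r * a = (1 - r) * j + r * b := by
  have h1 := congrArg Complex.im h
  have h2 := congrArg Complex.re h
  simp at h1 h2
  subst h1
  exact ⟨rfl, h2⟩

namespace ConvexChart

variable {S : Type*} [TopologicalSpace S] (E : ConvexChart S)

theorem exists_grid : ∃ (c ε : ℂ) (w w' : Fin 3 → S), ε ≠ 0 ∧ (∀ i, w i ∈ E.source ∧ w' i ∈ E.source) ∧
    ∀ i : Fin 3, E.toFun (w i) = c + ε * (((i : ℕ) : ℝ) + Complex.I) ∧
      E.toFun (w' i) = c + ε * ((i : ℕ) : ℝ) := by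
  obtain ⟨c, hc⟩ := E.interior_nonempty
  obtain ⟨δ, hδ, hball⟩ := Metric.isOpen_iff.1 isOpen_interior c hc
  have hmem : ∀ z : ℂ, ‖z‖ ≤ 3 → ∃ w ∈ E.source, E.toFun w = c + ((δ / 4 : ℝ) : ℂ) * z := by
    intro z hz
    have : c + ((δ / 4 : ℝ) : ℂ) * z ∈ ball c δ := by
      rw [mem_ball_iff_norm, add_sub_cancel_left, norm_mul, Complex.norm_real,
        Real.norm_of_nonneg (by positivity)]
      nlinarith
    obtain ⟨w, hw, hwz⟩ := interior_subset (hball this)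
    exact ⟨w, hw, hwz⟩
  have hi : ∀ i : Fin 3, (((i : ℕ) : ℝ)) ≤ 2 := fun i => by
    have := Nat.le_of_lt_succ i.2
    exact_mod_cast this
  have h1 : ∀ i : Fin 3, ‖((((i : ℕ) : ℝ) : ℂ))‖ ≤ 2 := fun i => by
    rw [Complex.norm_real, Real.norm_of_nonneg (Nat.cast_nonneg _)]; exact hi i
  choose w hw hwv using fun i : Fin 3 => hmem (((i : ℕ) : ℝ) + Complex.I)
    ((norm_add_le _ _).trans (by rw [Complex.norm_I]; linarith [h1 i]))
  choose w' hw' hwv' using fun i : Fin 3 => hmem ((i : ℕ) : ℝ) ((h1 i).trans (by norm_num))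
  exact ⟨c, ((δ / 4 : ℝ) : ℂ), w, w', Complex.ofReal_ne_zero.2 (by positivity),
    fun i => ⟨hw i, hw' i⟩, fun i => ⟨hwv i, hwv' i⟩⟩

end ConvexChart

namespace SurfaceAtlas

variable {S : Type*} [TopologicalSpace S] (A : SurfaceAtlas S)

/-- A standard drawing of the complete bipartite graph on two triples inside a small open set. -/
theorem exists_grid {l : Fin A.N} {R : Set S} (hR : IsOpen R) (hne : R.Nonempty) (hRl : R ⊆ A.G l) :
    ∃ (w w' : Fin 3 → S) (e : Fin 3 → Fin 3 → C(I, S)),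
      (∀ i a, e i a 0 = w i ∧ e i a 1 = w' a ∧ A.IsPiece (e i a) ∧ range (e i a) ⊆ R) ∧
      (∀ i j b, w i ∈ range (e j b) → i = j) ∧ (∀ a j b, w' a ∈ range (e j b) → a = b) ∧
      ∀ i j a b, i < j → (b < a → A.inter (e i a) (e j b) = 1) ∧
        (a < b → A.inter (e i a) (e j b) = 0) := by
  obtain ⟨z, hz⟩ := hne
  obtain ⟨j₀, hj₀⟩ := A.exists_chart l (hRl hz)
  obtain ⟨E, hE, hzE, hER⟩ := (A.chart j₀).exists_subchart (A.core_subset j₀ (hj₀ (hRl hz)))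
    (hR.mem_nhds hz)
  obtain ⟨c, ε, w, w', hε, hw, hv⟩ := E.exists_grid
  choose e he0 he1 hesub heint heval using fun i a => E.exists_segment (hw i).1 (hw a).2
  have heval' : ∀ (i a : Fin 3) (r : I), E.toFun (e i a r) =
      c + ε * ((1 - (r : ℝ)) * (((i : ℕ) : ℝ) + Complex.I) + (r : ℝ) * ((a : ℕ) : ℝ)) := by
    intro i a r
    rw [heval, (hv i).1, (hv a).2]
    ring
  have hval : ∀ {i a j b : Fin 3} {r s : I}, e i a r = e j b s → (r : ℝ) = s ∧
      (1 - (r : ℝ)) * ((i : ℕ) : ℝ) + (r : ℝ) * ((a : ℕ) : ℝ) =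
        (1 - (r : ℝ)) * ((j : ℕ) : ℝ) + (r : ℝ) * ((b : ℕ) : ℝ) := by
    intro i a j b r s h
    have h1 := congrArg E.toFun h
    rw [heval', heval'] at h1
    exact grid_eq (mul_left_cancel₀ hε (add_left_cancel h1))
  have hw1 : ∀ i j b, w i ∈ range (e j b) → i = j := by
    rintro i j b ⟨s, hs⟩
    have h := hval (hs.trans (he0 i b).symm).symm
    simp only [Icc.coe_zero] at h
    have h2 : ((i : ℕ) : ℝ) = ((j : ℕ) : ℝ) := by linarith [h.2]
    exact Fin.ext (by exact_mod_cast h2)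
  have hw2 : ∀ a j b, w' a ∈ range (e j b) → a = b := by
    rintro a j b ⟨s, hs⟩
    have h := hval (hs.trans (he1 j a).symm).symm
    simp only [Icc.coe_one] at h
    have h2 : ((a : ℕ) : ℝ) = ((b : ℕ) : ℝ) := by linarith [h.2]
    exact Fin.ext (by exact_mod_cast h2)
  have hpiece : ∀ i a, A.IsPiece (e i a) := fun i a =>
    ⟨⟨l, ((hesub i a).trans fun x hx => (hER hx).2).trans hRl⟩, heint i a⟩
  have hsubR : ∀ i a, range (e i a) ⊆ R := fun i a => (hesub i a).trans fun x hx => (hER hx).2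
  refine ⟨w, w', e, fun i a => ⟨he0 i a, he1 i a, hpiece i a, hsubR i a⟩, hw1, hw2,
    fun i j a b hij => ⟨fun hba => ?_, fun hab => ?_⟩⟩
  · have hij' : ((i : ℕ) : ℝ) < ((j : ℕ) : ℝ) := by exact_mod_cast hij
    have hba' : ((b : ℕ) : ℝ) < ((a : ℕ) : ℝ) := by exact_mod_cast hba
    have hap : ∀ {i j a b : Fin 3}, i ≠ j → a ≠ b → ∀ r, e i a r ≠ e j b 0 ∧ e i a r ≠ e j b 1 :=
      fun hij hab r => ⟨fun h => hij (hw1 _ _ _ ⟨r, h.trans (he0 _ _)⟩).symm,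
        fun h => hab (hw2 _ _ _ ⟨r, h.trans (he1 _ _)⟩).symm⟩
    have hapart : EndsApart (e i a) (e j b) := ⟨hap hij.ne hba.ne', hap hij.ne' hba.ne⟩
    rw [A.inter_eq_chart (hpiece i a) (hpiece j b) (((hsubR i a).trans hRl).trans hj₀)
      ((((hsubR j b).trans hRl).trans hj₀).trans (A.core_subset j₀)) hapart]
    refine periodParity_crossing_segments (c := c) hε hij' hba' (fun r => ?_) (fun r => ?_) ?_
    · rw [← hE]; exact heval' i a r
    · rw [← hE]; exact heval' j b r
    · rw [← hE]
      exact hapart.comp E.injOn (fun r => hesub i a (mem_range_self r))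
        fun r => hesub j b (mem_range_self r)
  · have hij' : ((i : ℕ) : ℝ) < ((j : ℕ) : ℝ) := by exact_mod_cast hij
    have hab' : ((a : ℕ) : ℝ) < ((b : ℕ) : ℝ) := by exact_mod_cast hab
    apply A.inter_eq_zero
    rw [disjoint_left]
    rintro _ ⟨r, rfl⟩ ⟨s, hs⟩
    have h := (hval hs.symm).2
    have hr0 := r.2.1
    have hr1 := r.2.2
    rcases hr0.eq_or_lt with h0 | h0
    · rw [← h0] at h; linarith
    · nlinarith

/-! ## The mod two crossing number of drawings of the complete bipartite graph -/

/-- The number modulo two of crossings between nonadjacent edges of a drawing of the complete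
bipartite graph on two triples. -/
noncomputable def crossingParity (F : Fin 3 → Fin 3 → List C(I, S)) : ZMod 2 :=
  ∑ i, ∑ a, (A.listInter (F i a) (F (i + 1) (a + 1)) + A.listInter (F i a) (F (i + 1) (a + 2)))

theorem crossingParity_update (F : Fin 3 → Fin 3 → List C(I, S)) (i a : Fin 3) (X : List C(I, S))
    (h : A.listInter (F i a) (F (i + 1) (a + 1)) + A.listInter (F i a) (F (i + 1) (a + 2)) +
      (A.listInter (F (i + 2) (a + 1)) (F i a) + A.listInter (F (i + 2) (a + 2)) (F i a)) =
      A.listInter X (F (i + 1) (a + 1)) + A.listInter X (F (i + 1) (a + 2)) +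
      (A.listInter (F (i + 2) (a + 1)) X + A.listInter (F (i + 2) (a + 2)) X)) :
    A.crossingParity F = A.crossingParity fun j b => if (j, b) = (i, a) then X else F j b := by
  simp only [crossingParity, Fin.sum_univ_three]
  fin_cases i <;> fin_cases a <;> simp at h ⊢ <;> linear_combination h

/-- The list of curves in the edges not adjacent to a given one. -/
def opposite (F : Fin 3 → Fin 3 → List C(I, S)) (i a : Fin 3) : List C(I, S) :=
  (F (i + 1) (a + 1) ++ F (i + 1) (a + 2)) ++ (F (i + 2) (a + 1) ++ F (i + 2) (a + 2))

theorem crossingParity_congr (F F' : Fin 3 → Fin 3 → List C(I, S))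
    (h : ∀ G : Fin 3 → Fin 3 → List C(I, S), (∀ i a, G i a = F i a ∨ G i a = F' i a) →
      ∀ i a, A.listInter (F i a) (opposite G i a) = A.listInter (F' i a) (opposite G i a)) :
    A.crossingParity F = A.crossingParity F' := by
  have key : ∀ s : Finset (Fin 3 × Fin 3), A.crossingParity F =
      A.crossingParity fun i a => if (i, a) ∈ s then F' i a else F i a := by
    intro s
    induction s using Finset.induction_on with
    | empty => simp
    | insert q s hq ih =>
      obtain ⟨i, a⟩ := q
      rw [ih]
      set G : Fin 3 → Fin 3 → List C(I, S) := fun i a => if (i, a) ∈ s then F' i a else F i a with hG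
      have hGF : G i a = F i a := by simp only [hG, if_neg hq]
      have h1 := h G (fun j b => by simp only [hG]; split_ifs <;> simp) i a
      simp only [opposite, listInter_append_right] at h1
      rw [A.crossingParity_update G i a (F' i a)]
      · congr 1
        funext j b
        by_cases hjb : (j, b) = (i, a)
        · obtain ⟨rfl, rfl⟩ := Prod.mk.inj hjb
          simp
        · simp [hjb, hG]
      · rw [hGF, A.listInter_comm _ (F i a), A.listInter_comm _ (F i a), A.listInter_comm _ (F' i a),
          A.listInter_comm _ (F' i a)]
        exact h1
  rw [key Finset.univ]
  simp

end SurfaceAtlas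

theorem sum_crossing_terms_eq (rr rh hh : Fin 3 → Fin 3 → ZMod 2) (re eh : Fin 3 → Fin 3 → Fin 3 → ZMod 2)
    (ee : Fin 3 → Fin 3 → Fin 3 → Fin 3 → ZMod 2) (hhh : ∀ a b, hh a b = hh b a) :
    (∑ i : Fin 3, ∑ a : Fin 3, ((rr i (i + 1) + re i (i + 1) (a + 1) + rh i (a + 1) +
      (re (i + 1) i a + ee i a (i + 1) (a + 1) + eh i a (a + 1)) +
      (rh (i + 1) a + eh (i + 1) (a + 1) a + hh a (a + 1))) +
      (rr i (i + 1) + re i (i + 1) (a + 2) + rh i (a + 2) +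
      (re (i + 1) i a + ee i a (i + 1) (a + 2) + eh i a (a + 2)) +
      (rh (i + 1) a + eh (i + 1) (a + 2) a + hh a (a + 2))))) =
    ∑ i : Fin 3, ∑ a : Fin 3, (ee i a (i + 1) (a + 1) + ee i a (i + 1) (a + 2)) := by
  have h2 : (2 : ZMod 2) = 0 := rfl
  have h10 := hhh 1 0
  have h20 := hhh 2 0
  have h21 := hhh 2 1
  simp only [Fin.sum_univ_three]
  simp only [Fin.reduceAdd, zero_add]
  rw [h10, h20, h21]
  ring_nf
  reduce_mod_char

section Chains

variable {S : Type*} [TopologicalSpace S]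

theorem carrier_append (L L' : List C(I, S)) : carrier (L ++ L') = carrier L ∪ carrier L' := by
  ext x
  simp [carrier, or_and_right, exists_or]

theorem carrier_singleton (γ : C(I, S)) : carrier [γ] = range γ := by
  ext x
  simp [carrier]

theorem listApart_of_disjoint {L C : List C(I, S)} (h : Disjoint (carrier L) (carrier C)) :
    ListApart L C :=
  listApart_of_notMem (fun _ hx hx' => disjoint_left.1 h hx' (ends_subset_carrier _ hx))
    fun _ hx hx' => disjoint_left.1 h (ends_subset_carrier _ hx) hx'

theorem Fin.three_add_ne (i : Fin 3) : i + 1 ≠ i ∧ i + 2 ≠ i := by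
  revert i; decide

theorem mem_opposite {F : Fin 3 → Fin 3 → List C(I, S)} {i a : Fin 3} {c : C(I, S)}
    (hc : c ∈ SurfaceAtlas.opposite F i a) : ∃ j b, j ≠ i ∧ b ≠ a ∧ c ∈ F j b := by
  simp only [SurfaceAtlas.opposite, List.mem_append] at hc
  have hi := Fin.three_add_ne i
  have ha := Fin.three_add_ne a
  rcases hc with (hc | hc) | (hc | hc)
  exacts [⟨_, _, hi.1, ha.1, hc⟩, ⟨_, _, hi.1, ha.2, hc⟩, ⟨_, _, hi.2, ha.1, hc⟩,
    ⟨_, _, hi.2, ha.2, hc⟩]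

theorem isModTwoCycle_opposite {u h : Fin 3 → S} {F : Fin 3 → Fin 3 → List C(I, S)}
    (hF : ∀ i a, CurveChain (u i) (F i a) (h a)) (i a : Fin 3) :
    IsModTwoCycle (SurfaceAtlas.opposite F i a) := by
  intro f
  simp only [SurfaceAtlas.opposite, List.map_append, List.sum_append, (hF _ _).sum_add]
  generalize f (u (i + 1)) = x
  generalize f (u (i + 2)) = y
  generalize f (h (a + 1)) = z
  generalize f (h (a + 2)) = t
  revert x y z t
  decide

end Chains

namespace SurfaceAtlas

variable {S : Type*} [TopologicalSpace S] {A : SurfaceAtlas S}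

theorem crossingParity_eq_zero {F : Fin 3 → Fin 3 → List C(I, S)}
    (hF : ∀ i j a b, i ≠ j → a ≠ b → Disjoint (carrier (F i a)) (carrier (F j b))) :
    A.crossingParity F = 0 := by
  have h : ∀ i j a b, i ≠ j → a ≠ b → A.listInter (F i a) (F j b) = 0 := fun i j a b hij hab =>
    A.listInter_eq_zero fun γ hγ c hc => disjoint_left.2 fun z hz hz' =>
      disjoint_left.1 (hF i j a b hij hab) ⟨γ, hγ, hz⟩ ⟨c, hc, hz'⟩
  refine Finset.sum_eq_zero fun i _ => Finset.sum_eq_zero fun a _ => ?_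
  rw [h _ _ _ _ (Fin.three_add_ne i).1.symm (Fin.three_add_ne a).1.symm,
    h _ _ _ _ (Fin.three_add_ne i).1.symm (Fin.three_add_ne a).2.symm, add_zero]

theorem crossingParity_grid {e : Fin 3 → Fin 3 → C(I, S)}
    (he : ∀ i j a b, i < j → (b < a → A.inter (e i a) (e j b) = 1) ∧
      (a < b → A.inter (e i a) (e j b) = 0)) :
    A.crossingParity (fun i a => [e i a]) = 1 := by
  have h : ∀ i j a b : Fin 3, i ≠ j → a ≠ b → A.inter (e i a) (e j b) =
      if (i < j ↔ a < b) then 0 else 1 := by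
    intro i j a b hij hab
    rcases lt_or_gt_of_ne hij with h1 | h1 <;> rcases lt_or_gt_of_ne hab with h2 | h2
    · rw [(he i j a b h1).2 h2, if_pos (iff_of_true h1 h2)]
    · rw [(he i j a b h1).1 h2, if_neg fun h => lt_asymm h2 (h.1 h1)]
    · rw [A.inter_comm, (he j i b a h1).1 h2, if_neg fun h => lt_asymm h1 (h.2 h2)]
    · rw [A.inter_comm, (he j i b a h1).2 h2, if_pos (iff_of_false h1.not_gt h2.not_gt)]
  have h' : A.crossingParity (fun i a => [e i a]) = ∑ i : Fin 3, ∑ a : Fin 3,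
      ((if (i < i + 1 ↔ a < a + 1) then (0 : ZMod 2) else 1) +
        if (i < i + 1 ↔ a < a + 2) then 0 else 1) := by
    refine Finset.sum_congr rfl fun i _ => Finset.sum_congr rfl fun a _ => ?_
    simp only [listInter, List.map_cons, List.map_nil, List.sum_cons, List.sum_nil, add_zero]
    rw [h _ _ _ _ (Fin.three_add_ne i).1.symm (Fin.three_add_ne a).1.symm,
      h _ _ _ _ (Fin.three_add_ne i).1.symm (Fin.three_add_ne a).2.symm]
  rw [h']
  decide

theorem crossingParity_detour (r r' : Fin 3 → List C(I, S)) (e : Fin 3 → Fin 3 → List C(I, S)) :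
    A.crossingParity (fun i a => r i ++ (e i a ++ r' a)) = A.crossingParity e := by
  have h := sum_crossing_terms_eq (fun i j => A.listInter (r i) (r j))
    (fun i b => A.listInter (r i) (r' b)) (fun a b => A.listInter (r' a) (r' b))
    (fun i j b => A.listInter (r i) (e j b)) (fun i a b => A.listInter (e i a) (r' b))
    (fun i a j b => A.listInter (e i a) (e j b)) fun a b => A.listInter_comm _ _
  rw [crossingParity, crossingParity, ← h]
  refine Finset.sum_congr rfl fun i _ => Finset.sum_congr rfl fun a _ => ?_
  simp only [listInter_append_left, listInter_append_right]
  rw [A.listInter_comm (e i a) (r (i + 1)), A.listInter_comm (r' a) (r (i + 1)),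
    A.listInter_comm (r' a) (e (i + 1) (a + 1)), A.listInter_comm (r' a) (e (i + 1) (a + 2)),
    A.listInter_comm (r' a) (r' (a + 1)), A.listInter_comm (r' (a + 1)) (r' a)]
  ring

/-- A drawing of the complete bipartite graph on two triples in which nonadjacent edges are disjoint
cannot have labels independent of the first vertex. -/
theorem false_of_labels_eq [T2Space S] {u h : Fin 3 → S} {e : Fin 3 → Fin 3 → List C(I, S)}
    {l : Fin A.N} {m : Fin 3 → Fin A.N} {lab : Fin 3 → Fin A.N × Fin A.N → ZMod 2}
    (he : ∀ i a, A.LabeledChain l (u i) (m a) (h a) (e i a) (lab a))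
    (hdisj : ∀ i j a b, i ≠ j → a ≠ b → Disjoint (carrier (e i a)) (carrier (e j b)))
    (hu : Function.Injective u) (hh : Function.Injective h) (huh : ∀ i a, u i ≠ h a)
    (hue : ∀ i j b, i ≠ j → u i ∉ carrier (e j b)) (hhe : ∀ a j b, a ≠ b → h a ∉ carrier (e j b)) :
    False := by
  have hethin : IsThin (⋃ q ∈ (univ : Set (Fin 3 × Fin 3)), carrier (e q.1 q.2)) :=
    IsThin.biUnion finite_univ fun q _ => A.isThin_carrier (he q.1 q.2).isPiece
  have hecar : ∀ i a, carrier (e i a) ⊆ ⋃ q ∈ (univ : Set (Fin 3 × Fin 3)), carrier (e q.1 q.2) :=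
    fun i a x hx => mem_biUnion (mem_univ (i, a)) hx
  have hthin₁ := (hethin.union (A.isThin_of_finite (finite_range u))).union
    (A.isThin_of_finite (finite_range h))
  obtain ⟨z, hz, hzB⟩ := hthin₁.exists_notMem (A.isOpen_G l) ⟨u 0, (he 0 0).left_mem⟩
  obtain ⟨w, w', s, hs, hws, hw's, hcross⟩ := A.exists_grid ((A.isOpen_G l).sdiff hthin₁.1)
    ⟨z, hz, hzB⟩ sdiff_subset
  have hse : ∀ i a j b x, x ∈ range (s i a) → x ∉ carrier (e j b) := fun i a j b x hx hx' =>
    ((hs i a).2.2.2 hx).2 (Or.inl (Or.inl (hecar j b hx')))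
  have hsu : ∀ i a j, u j ∉ range (s i a) := fun i a j hx =>
    ((hs i a).2.2.2 hx).2 (Or.inl (Or.inr (mem_range_self j)))
  have hsh : ∀ i a j, h j ∉ range (s i a) := fun i a j hx =>
    ((hs i a).2.2.2 hx).2 (Or.inr (mem_range_self j))
  have hwm : ∀ i a, w i ∈ range (s i a) := fun i a => ⟨0, (hs i a).1⟩
  have hw'm : ∀ i a, w' a ∈ range (s i a) := fun i a => ⟨1, (hs i a).2.1⟩
  have hw : Function.Injective w := fun i j hij => hws i j 0 (hij ▸ hwm j 0)
  have hw' : Function.Injective w' := fun a b hab => hw's a 0 b (hab ▸ hw'm 0 b)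
  have hww' : ∀ i a, w i ≠ w' a := fun i a hia =>
    (Fin.three_add_ne i).1 (hws i (i + 1) a (hia ▸ hw'm (i + 1) a)).symm
  have huw : ∀ i j, u i ≠ w j := fun i j e => hsu j 0 i (e ▸ hwm j 0)
  have huw' : ∀ i j, u i ≠ w' j := fun i j e => hsu 0 j i (e ▸ hw'm 0 j)
  have hhw : ∀ i j, h i ≠ w j := fun i j e => hsh j 0 i (e ▸ hwm j 0)
  have hhw' : ∀ i j, h i ≠ w' j := fun i j e => hsh 0 j i (e ▸ hw'm 0 j)
  set F₀ : Set S := range u ∪ range h ∪ range w ∪ range w' ∪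
    ⋃ q ∈ (univ : Set (Fin 3 × Fin 3)), ends (e q.1 q.2) with hF₀
  have hF₀fin : F₀.Finite := ((((finite_range u).union (finite_range h)).union (finite_range w)).union
    (finite_range w')).union (finite_univ.biUnion fun q _ => finite_ends _)
  have hF₀u : ∀ i, u i ∈ F₀ := fun i => Or.inl (Or.inl (Or.inl (Or.inl (mem_range_self i))))
  have hF₀h : ∀ i, h i ∈ F₀ := fun i => Or.inl (Or.inl (Or.inl (Or.inr (mem_range_self i))))
  have hF₀w : ∀ i, w i ∈ F₀ := fun i => Or.inl (Or.inl (Or.inr (mem_range_self i)))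
  have hF₀w' : ∀ i, w' i ∈ F₀ := fun i => Or.inl (Or.inr (mem_range_self i))
  have hF₀e : ∀ i a, ends (e i a) ⊆ F₀ := fun i a x hx => Or.inr (mem_biUnion (mem_univ (i, a)) hx)
  have hF₀s : ∀ i a, ends [s i a] ⊆ F₀ := by
    rintro i a _ ⟨γ, hγ, hx⟩
    rw [List.mem_singleton] at hγ
    subst hγ
    rcases hx with rfl | rfl
    · rw [(hs i a).1]; exact hF₀w i
    · rw [(hs i a).2.1]; exact hF₀w' a
  set B₀ : Set S := (⋃ q ∈ (univ : Set (Fin 3 × Fin 3)), carrier (e q.1 q.2)) ∪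
    ⋃ q ∈ (univ : Set (Fin 3 × Fin 3)), carrier [s q.1 q.2] with hB₀
  have hB₀thin : IsThin B₀ := hethin.union (IsThin.biUnion finite_univ fun q _ =>
    A.isThin_carrier (by simpa using (hs q.1 q.2).2.2.1))
  have hB₀e : ∀ i a, carrier (e i a) ⊆ B₀ := fun i a x hx => Or.inl (hecar i a hx)
  have hB₀s : ∀ i a, carrier [s i a] ⊆ B₀ := fun i a x hx => Or.inr (mem_biUnion (mem_univ (i, a)) hx)
  have hsl : ∀ i a, range (s i a) ⊆ A.G l := fun i a => (hs i a).2.2.2.trans sdiff_subset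
  obtain ⟨L, hL, hLL⟩ := A.exists_generic_family (Sum.elim u w') (Sum.elim w h)
    (Sum.elim (fun i L => A.LabeledChain l (u i) l (w i) L 0)
      fun a L => A.LabeledChain l (w' a) (m a) (h a) L (lab a)) (by
    rintro (i | a) F B hF hB hxF hyF
    · exact (LabeledChain.nil (he i 0).left_mem).exists_isGood hF hB (he i 0).left_mem
        (hsl i 0 (hwm i 0)) hxF hyF
    · exact (he 0 a).exists_isGood hF hB (hsl 0 a (hw'm 0 a)) (he 0 a).right_mem hxF hyF)
    hF₀fin hB₀thin (by rintro (i | a); exacts [hF₀u i, hF₀w' a])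
    (by rintro (i | a); exacts [hF₀w i, hF₀h a])
  set r : Fin 3 → List C(I, S) := fun i => L (Sum.inl i) with hr
  set r' : Fin 3 → List C(I, S) := fun a => L (Sum.inr a) with hr'
  have hrl : ∀ i, A.LabeledChain l (u i) l (w i) (r i) 0 := fun i => (hL (Sum.inl i)).1
  have hr'l : ∀ a, A.LabeledChain l (w' a) (m a) (h a) (r' a) (lab a) := fun a => (hL (Sum.inr a)).1
  have hrg : ∀ i, A.IsGood (F₀ \ {u i, w i}) B₀ (u i) (w i) (r i) := fun i => (hL (Sum.inl i)).2
  have hr'g : ∀ a, A.IsGood (F₀ \ {w' a, h a}) B₀ (w' a) (h a) (r' a) := fun a => (hL (Sum.inr a)).2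
  have hrr : ∀ i j, i ≠ j → ListApart (r i) (r j) := fun i j hij =>
    hLL (Sum.inl i) (Sum.inl j) (hu.ne hij) (huw i j) (huw j i).symm (hw.ne hij)
  have hr'r' : ∀ i j, i ≠ j → ListApart (r' i) (r' j) := fun i j hij =>
    hLL (Sum.inr i) (Sum.inr j) (hw'.ne hij) (hhw' j i).symm (hhw' i j) (hh.ne hij)
  have hrr' : ∀ i a, ListApart (r i) (r' a) := fun i a =>
    hLL (Sum.inl i) (Sum.inr a) (huw' i a) (huh i a) (hww' i a) (hhw a i).symm
  have hre : ∀ i j b, i ≠ j → ListApart (r i) (e j b) := fun i j b hij =>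
    (hrg i).listApart_of_subset (hF₀e j b) (hB₀e j b) (hue i j b hij) (hse i 0 j b _ (hwm i 0))
  have hr'e : ∀ a j b, a ≠ b → ListApart (r' a) (e j b) := fun a j b hab =>
    (hr'g a).listApart_of_subset (hF₀e j b) (hB₀e j b) (hse 0 a j b _ (hw'm 0 a)) (hhe a j b hab)
  have hrs : ∀ i j b, i ≠ j → ListApart (r i) [s j b] := fun i j b hij =>
    (hrg i).listApart_of_subset (hF₀s j b) (hB₀s j b) (by rw [carrier_singleton]; exact hsu j b i)
      (by rw [carrier_singleton]; exact fun h => hij (hws i j b h))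
  have hr's : ∀ a j b, a ≠ b → ListApart (r' a) [s j b] := fun a j b hab =>
    (hr'g a).listApart_of_subset (hF₀s j b) (hB₀s j b)
      (by rw [carrier_singleton]; exact fun h => hab (hw's a j b h))
      (by rw [carrier_singleton]; exact hsh j b a)
  have hsee : ∀ i a j b, ListApart [s i a] (e j b) := fun i a j b =>
    listApart_of_disjoint (disjoint_left.2 fun x hx => hse i a j b x (by rwa [carrier_singleton] at hx))
  have hends : ∀ i a x, x ∈ ends [s i a] → x = w i ∨ x = w' a := by
    rintro i a _ ⟨γ, hγ, hx⟩
    rw [List.mem_singleton] at hγ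
    subst hγ
    rwa [(hs i a).1, (hs i a).2.1] at hx
  have hss' : ∀ i j a b, i ≠ j → a ≠ b → ∀ x ∈ ends [s i a], x ∉ carrier [s j b] := by
    intro i j a b hij hab x hx hx'
    rw [carrier_singleton] at hx'
    rcases hends i a x hx with rfl | rfl
    exacts [hij (hws _ _ _ hx'), hab (hw's _ _ _ hx')]
  have hss : ∀ i j a b, i ≠ j → a ≠ b → ListApart [s i a] [s j b] := fun i j a b hij hab =>
    listApart_of_notMem (hss' j i b a hij.symm hab.symm) (hss' i j a b hij hab)
  set e' : Fin 3 → Fin 3 → List C(I, S) := fun i a => r i ++ ([s i a] ++ r' a) with he'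
  have he'l : ∀ i a, A.LabeledChain l (u i) (m a) (h a) (e' i a) (lab a) := by
    intro i a
    have h1 : A.LabeledChain l (w i) l (w' a) [s i a] 0 :=
      .of_subset ⟨(hs i a).1, (hs i a).2.1⟩ (by simpa using ⟨(hs i a).2.2.1, hsl i a⟩)
        (hsl i a (hwm i a))
    have h2 := (hrl i).append (h1.append (hr'l a))
    rw [zero_add, zero_add] at h2
    exact h2
  have hee : ∀ i j a b, i ≠ j → a ≠ b → ListApart (e i a) (e j b) := fun i j a b hij hab =>
    listApart_of_disjoint (hdisj i j a b hij hab)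
  have he'e : ∀ i j a b, i ≠ j → a ≠ b → ListApart (e' i a) (e j b) := fun i j a b hij hab =>
    (hre i j b hij).append ((hsee i a j b).append (hr'e a j b hab))
  have he'e' : ∀ i j a b, i ≠ j → a ≠ b → ListApart (e' i a) (e' j b) := by
    intro i j a b hij hab
    have h1 := hij.symm
    have h2 := hab.symm
    refine ((hrr i j hij).symm.append ((hrs i j b hij).symm.append (hrr' i b).symm)).symm.append
      (ListApart.append (ListApart.symm ?_) (ListApart.symm ?_))
    · exact (hrs j i a h1).append ((hss j i b a h1 h2).append (hr's b i a h2))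
    · exact (hrr' j a).append ((hr's a j b hab).symm.append (hr'r' b a h2))
  have hue' : ∀ i j b, i ≠ j → u i ∉ carrier (e' j b) := by
    intro i j b hij
    rw [he', carrier_append, carrier_append, carrier_singleton]
    rintro (hx | hx | hx)
    · refine (hrg j).notMem_carrier ⟨hF₀u i, ?_⟩ hx
      rintro (h | h)
      exacts [hij (hu h), huw i j h]
    · exact hsu j b i hx
    · refine (hr'g b).notMem_carrier ⟨hF₀u i, ?_⟩ hx
      rintro (h | h)
      exacts [huw' i b h, huh i b h]
  have hcongr : A.crossingParity e = A.crossingParity e' := by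
    refine A.crossingParity_congr e e' fun G hG i a => ?_
    refine (he i a).listInter_eq (he'l i a) (isModTwoCycle_opposite (u := u) (h := h) ?_ i a)
      ?_ ?_ ?_ ?_
    · intro j b
      rcases hG j b with h | h <;> rw [h]
      exacts [(he j b).curveChain, (he'l j b).curveChain]
    · intro c hc
      obtain ⟨j, b, -, -, hc⟩ := mem_opposite hc
      rcases hG j b with h | h <;> rw [h] at hc
      exacts [(he j b).isPiece c hc, (he'l j b).isPiece c hc]
    · rintro ⟨c, hc, hx⟩
      obtain ⟨j, b, hj, -, hc⟩ := mem_opposite hc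
      rcases hG j b with h | h <;> rw [h] at hc
      exacts [hue i j b hj.symm ⟨c, hc, hx⟩, hue' i j b hj.symm ⟨c, hc, hx⟩]
    · intro γ hγ c hc
      obtain ⟨j, b, hj, hb, hc⟩ := mem_opposite hc
      rcases hG j b with h | h <;> rw [h] at hc
      exacts [hee i j a b hj.symm hb.symm γ hγ c hc,
        ((he'e j i b a hj hb).symm) γ hγ c hc]
    · intro γ hγ c hc
      obtain ⟨j, b, hj, hb, hc⟩ := mem_opposite hc
      rcases hG j b with h | h <;> rw [h] at hc
      exacts [he'e i j a b hj.symm hb.symm γ hγ c hc, he'e' i j a b hj.symm hb.symm γ hγ c hc]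
  rw [crossingParity_eq_zero hdisj, he', crossingParity_detour, crossingParity_grid hcross] at hcongr
  exact zero_ne_one hcongr

end SurfaceAtlas

theorem injective_vecCons_three {α : Type*} {a b c : α} (hab : a ≠ b) (hac : a ≠ c)
    (hbc : b ≠ c) : Function.Injective ![a, b, c] := by
  intro i j hij
  fin_cases i <;> fin_cases j <;> simp [hab, hac, hbc, hab.symm, hac.symm, hbc.symm] at hij ⊢

/-- A compact surface does not contain large bipartite configurations. -/
theorem IsSurface.exists_not_bipartiteConfig {S : Type} [MetricSpace S] [CompactSpace S]
    (hS : IsSurface S) : ∃ p, ¬ BipartiteConfig p S := by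
  classical
  obtain ⟨A⟩ := hS.nonempty_surfaceAtlas
  let V := Fin A.N × (Fin 3 → (Fin A.N × Fin A.N → ZMod 2))
  obtain ⟨p, hp, hp'⟩ : ∃ p, Fintype.card V * 2 < p ∧ 2 ≤ p :=
    ⟨Fintype.card V * 2 + 2, by lia, by lia⟩
  have : NeZero p := ⟨by lia⟩
  have : Nontrivial (Fin p) := Fin.nontrivial_iff_two_le.2 hp'
  refine ⟨p, ?_⟩
  rintro ⟨h, u, O, hO, hdisj⟩
  have hother : ∀ a : Fin 3, ∃ b, b ≠ a := fun a => ⟨_, (Fin.three_add_ne a).1⟩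
  have hother' : ∀ i : Fin p, ∃ j, j ≠ i := fun i => exists_ne i
  have hu : Function.Injective u := by
    intro i j hij
    by_contra hne
    exact disjoint_left.1 (hdisj i j 0 1 hne (by decide)) (hO i 0).2.2.1 (hij ▸ (hO j 1).2.2.1)
  have hh : Function.Injective h := by
    intro a b hab
    by_contra hne
    obtain ⟨j, hj⟩ := hother' 0
    exact disjoint_left.1 (hdisj j 0 a b hj hne) (hO j a).2.2.2 (hab ▸ (hO 0 b).2.2.2)
  have huh : ∀ i a, u i ≠ h a := by
    intro i a hia
    obtain ⟨j, hj⟩ := hother' i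
    obtain ⟨b, hb⟩ := hother a
    exact disjoint_left.1 (hdisj i j b a hj.symm hb) (hO i b).2.2.1 (hia ▸ (hO j a).2.2.2)
  choose e he heO using fun i a => A.exists_isGood (hO i a).1 (hO i a).2.1 finite_empty isThin_empty
    (hO i a).2.2.1 (hO i a).2.2.2 (notMem_empty _) (notMem_empty _)
  choose pt hpt using A.exists_mem_G
  choose lab hlab using fun i a =>
    SurfaceAtlas.LabeledChain.exists_of_curveChain hpt (he i a).1 (he i a).isPiece
  have hcar : ∀ i a, carrier (e i a) ⊆ O i a := by
    rintro i a x ⟨γ, hγ, hx⟩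
    exact heO i a γ hγ hx
  obtain ⟨v, hv⟩ := Fintype.exists_lt_card_fiber_of_mul_lt_card (n := 2)
    (fun i => ((pt (u i), lab i) : V)) (by rwa [Fintype.card_fin])
  obtain ⟨i₀, i₁, i₂, h0, h1, h2, h01, h02, h12⟩ := Finset.two_lt_card_iff.1 hv
  let t : Fin 3 → Fin p := ![i₀, i₁, i₂]
  have ht : Function.Injective t :=
    injective_vecCons_three h01 h02 h12
  have htv : ∀ i, pt (u (t i)) = v.1 ∧ lab (t i) = v.2 := by
    have h3 : ∀ i, ((pt (u (t i)), lab (t i)) : V) = v := by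
      simp only [Finset.mem_filter, Finset.mem_univ, true_and] at h0 h1 h2
      intro i
      fin_cases i
      exacts [h0, h1, h2]
    exact fun i => ⟨congrArg Prod.fst (h3 i), congrArg Prod.snd (h3 i)⟩
  refine SurfaceAtlas.false_of_labels_eq (A := A) (u := fun i => u (t i)) (h := h)
    (e := fun i a => e (t i) a) (l := v.1) (m := fun a => pt (h a)) (lab := v.2) ?_ ?_
    (hu.comp ht) hh (fun i a => huh (t i) a) ?_ ?_
  · intro i a
    have := hlab (t i) a
    rwa [(htv i).1, (htv i).2] at this
  · exact fun i j a b hij hab => (hdisj (t i) (t j) a b (ht.ne hij) hab).mono (hcar _ _) (hcar _ _)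
  · intro i j b hij hx
    obtain ⟨a, ha⟩ := hother b
    exact disjoint_left.1 (hdisj (t i) (t j) a b (ht.ne hij) ha) (hO (t i) a).2.2.1 (hcar _ _ hx)
  · intro a j b hab hx
    obtain ⟨i, hi⟩ := hother' (t j)
    exact disjoint_left.1 (hdisj i (t j) a b hi hab) (hO i a).2.2.2 (hcar _ _ hx)

theorem IsSurface.of_homeomorph {X Y : Type*} [TopologicalSpace X] [TopologicalSpace Y]
    (e : Y ≃ₜ X) (hX : IsSurface X) : IsSurface Y := by
  intro y
  obtain ⟨U, V, hU, hy, hV, ⟨φ⟩⟩ := hX (e y)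
  exact ⟨e ⁻¹' U, V, hU.preimage e.continuous, hy, hV,
    ⟨(e.sets rfl).trans φ⟩⟩

/-! ## STATEMENT 0 -/

theorem stmt0
    (X : Type) [MetricSpace X] [CompactSpace X] [Nonempty X]
    (S : Type) [TopologicalSpace S] (hS : IsCompactSurface S)
    (K : ℕ → GromovHausdorff.GHSpace)
    (hlen : ∀ n, IsLengthSpace (K n).Rep)
    (hhomeo : ∀ n, Nonempty ((K n).Rep ≃ₜ S))
    (hconv : Filter.Tendsto K Filter.atTop (nhds (GromovHausdorff.toGHSpace X))) :
    CoveringDimLE X 2 := by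
  obtain ⟨e₀⟩ := hhomeo 0
  obtain ⟨p, hp⟩ := (hS.2.2.2.of_homeomorph e₀).exists_not_bipartiteConfig
  refine coveringDimLE_two_of_limit hlen (p := p) (fun n hn => ?_) hconv
  obtain ⟨e⟩ := hhomeo n
  exact hp (hn.of_homeomorph (e.trans e₀.symm))
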